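/- Let D̄ denote the closed unit disk in ℝ² and let h : D̄ → D̄ be a continuous map. Then h is monotone if and only if there exists a sequence of homeomorphisms h_j : D̄ → D̄ of D̄ onto itself (j = 1, 2, ...) converging to h uniformly on D̄. -/

import Mathlib

open Set Filter Topology

/-! ### Continuous logarithms -/

/-- A continuous nowhere vanishing function on a contractible, locally path connected space has
a continuous logarithm. -/
theorem exists_continuous_log {X : Type*} [TopologicalSpace X] [ContractibleSpace X]
    [LocallyPathConnectedSpace X] {g : X → ℂ} (hg : Continuous g) (h0 : ∀ x, g x ≠ 0) :
    ∃ L : X → ℂ, Continuous L ∧ ∀ x, Complex.exp (L x) = g x := by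
  obtain ⟨x₀⟩ : Nonempty X := inferInstance
  obtain ⟨f, ⟨-, hf⟩, -⟩ := Complex.isCoveringMapOn_exp.existsUnique_continuousMap_lifts
    ⟨g, hg⟩ (a₀ := x₀) (Complex.exp_log (h0 x₀)) (fun x => h0 x)
  exact ⟨f, f.continuous, fun x => congrFun hf x⟩

/-- A continuous function on a preconnected set whose values are logarithms of `1` is constant. -/
theorem IsPreconnected.eq_of_exp_eq_one {X : Type*} [TopologicalSpace X] {s : Set X}
    (hs : IsPreconnected s) {f : X → ℂ} (hf : ContinuousOn f s)
    (h1 : ∀ x ∈ s, Complex.exp (f x) = 1) {x y : X} (hx : x ∈ s) (hy : y ∈ s) : f x = f y := by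
  have key : IsPreconnected ((fun x => (f x).im / (2 * Real.pi)) '' s) :=
    hs.image _ ((Complex.continuous_im.comp_continuousOn hf).div_const _)
  have hlog : ∀ x ∈ s, ∃ n : ℤ, f x = n * (2 * Real.pi * Complex.I) := fun x hx =>
    Complex.exp_eq_one_iff.1 (h1 x hx)
  have hval : ∀ x ∈ s, ∃ n : ℤ, (f x).im / (2 * Real.pi) = n ∧
      f x = n * (2 * Real.pi * Complex.I) := by
    intro x hx
    obtain ⟨n, hn⟩ := hlog x hx
    refine ⟨n, ?_, hn⟩
    rw [hn]
    have : Real.pi ≠ 0 := Real.pi_ne_zero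
    simp
  obtain ⟨n, hn, hn'⟩ := hval x hx
  obtain ⟨m, hm, hm'⟩ := hval y hy
  have hor : (n : ℝ) = m := by
    by_contra hne
    have hoc := key.ordConnected
    rcases lt_or_gt_of_ne hne with hlt | hlt
    · have hlt' : n + 1 ≤ m := by exact_mod_cast hlt
      have hlt'' : (n : ℝ) + 1 ≤ m := by exact_mod_cast hlt'
      obtain ⟨z, hz, hz'⟩ := hoc.out (mem_image_of_mem _ hx) (mem_image_of_mem _ hy)
        (show (n : ℝ) + 1 / 2 ∈ _ from ⟨by simp only [hn]; linarith, by simp only [hm]; linarith⟩)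
      obtain ⟨k, hk, -⟩ := hval z hz
      simp only [hk] at hz'
      have h2 : (2 * k : ℝ) = 2 * n + 1 := by linarith
      have h3 : 2 * k = 2 * n + 1 := by exact_mod_cast h2
      omega
    · have hlt' : m + 1 ≤ n := by exact_mod_cast hlt
      have hlt'' : (m : ℝ) + 1 ≤ n := by exact_mod_cast hlt'
      obtain ⟨z, hz, hz'⟩ := hoc.out (mem_image_of_mem _ hy) (mem_image_of_mem _ hx)
        (show (m : ℝ) + 1 / 2 ∈ _ from ⟨by simp only [hm]; linarith, by simp only [hn]; linarith⟩)
      obtain ⟨k, hk, -⟩ := hval z hz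
      simp only [hk] at hz'
      have h2 : (2 * k : ℝ) = 2 * m + 1 := by linarith
      have h3 : 2 * k = 2 * m + 1 := by exact_mod_cast h2
      omega
  have : n = m := by exact_mod_cast hor
  rw [hn', hm', this]

/-- Along an interval on which `cos φ > 0`, the function `φ` stays in one component. -/
theorem exists_int_abs_sub_lt_of_cos_pos {φ : ℝ → ℝ} (hφ : Continuous φ)
    (hc : ∀ t ∈ Icc (0 : ℝ) 1, 0 < Real.cos (φ t)) :
    ∃ k : ℤ, ∀ t ∈ Icc (0 : ℝ) 1, |φ t - 2 * Real.pi * k| < Real.pi / 2 := by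
  have hπ := Real.pi_pos
  have hval : ∀ t ∈ Icc (0 : ℝ) 1, ∀ k : ℤ, |φ t - 2 * Real.pi * k| ≠ Real.pi / 2 := by
    intro t ht k hk
    have h1 : Real.cos (|φ t - 2 * Real.pi * k|) = 0 := by rw [hk]; exact Real.cos_pi_div_two
    rw [Real.cos_abs, mul_comm (2 * Real.pi), Real.cos_sub_int_mul_two_pi] at h1
    exact (hc t ht).ne' h1
  have h0 : ∃ k : ℤ, |φ 0 - 2 * Real.pi * k| < Real.pi / 2 := by
    have hcos := hc 0 ⟨le_rfl, zero_le_one⟩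
    refine ⟨round (φ 0 / (2 * Real.pi)), ?_⟩
    set k := round (φ 0 / (2 * Real.pi))
    have h1 : |φ 0 - 2 * Real.pi * k| ≤ Real.pi := by
      have := abs_sub_round (φ 0 / (2 * Real.pi))
      have h2 : φ 0 - 2 * Real.pi * k = (2 * Real.pi) * (φ 0 / (2 * Real.pi) - k) := by
        field_simp
      rw [h2, abs_mul, abs_of_pos (by positivity)]
      nlinarith
    by_contra hcon
    push Not at hcon
    have h3 : Real.cos (|φ 0 - 2 * Real.pi * k|) ≤ 0 :=
      Real.cos_nonpos_of_pi_div_two_le_of_le hcon (by linarith)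
    rw [Real.cos_abs, mul_comm (2 * Real.pi), Real.cos_sub_int_mul_two_pi] at h3
    linarith
  obtain ⟨k, hk⟩ := h0
  refine ⟨k, fun t ht => ?_⟩
  by_contra hcon
  push Not at hcon
  have hcont : ContinuousOn (fun t => |φ t - 2 * Real.pi * k|) (Icc 0 t) := by fun_prop
  obtain ⟨s, hs, hφs⟩ := intermediate_value_Icc ht.1 hcont ⟨hk.le, hcon⟩
  exact hval s ⟨hs.1, hs.2.trans ht.2⟩ k hφs

/-- A nowhere vanishing map cannot wind once around the boundary of the unit square. -/
theorem false_of_sides_in_half_planes {F : ℝ × ℝ → ℂ} (hF : Continuous F) (h0 : ∀ x, F x ≠ 0)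
    {A₁ A₂ A₃ A₄ : ℝ} (h12 : |A₂ - A₁| < Real.pi) (h23 : |A₃ - A₂| < Real.pi)
    (h34 : |A₄ - A₃| < Real.pi) (h41 : |A₁ + 2 * Real.pi - A₄| < Real.pi)
    (s1 : ∀ t ∈ Icc (0 : ℝ) 1, 0 < (F (0, t) * Complex.exp (-(A₁ * Complex.I))).re)
    (s2 : ∀ t ∈ Icc (0 : ℝ) 1, 0 < (F (t, 1) * Complex.exp (-(A₂ * Complex.I))).re)
    (s3 : ∀ t ∈ Icc (0 : ℝ) 1, 0 < (F (1, t) * Complex.exp (-(A₃ * Complex.I))).re)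
    (s4 : ∀ t ∈ Icc (0 : ℝ) 1, 0 < (F (t, 0) * Complex.exp (-(A₄ * Complex.I))).re) : False := by
  obtain ⟨L, hL, hLF⟩ := exists_continuous_log hF h0
  have hside : ∀ (c : ℝ → ℝ × ℝ), Continuous c → ∀ A : ℝ,
      (∀ t ∈ Icc (0 : ℝ) 1, 0 < (F (c t) * Complex.exp (-(A * Complex.I))).re) →
      ∃ k : ℤ, ∀ t ∈ Icc (0 : ℝ) 1, |(L (c t)).im - A - 2 * Real.pi * k| < Real.pi / 2 := by
    intro c hc A hA
    have hcont : Continuous fun t => (L (c t)).im - A :=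
      (Complex.continuous_im.comp (hL.comp hc)).sub continuous_const
    refine exists_int_abs_sub_lt_of_cos_pos hcont fun t ht => ?_
    have h1 := hA t ht
    rw [← hLF, ← Complex.exp_add, Complex.exp_re] at h1
    have h2 := pos_of_mul_pos_right h1 (Real.exp_pos _).le
    simpa [sub_eq_add_neg] using h2
  obtain ⟨k₁, h1⟩ := hside (fun t => (0, t)) (by fun_prop) A₁ s1
  obtain ⟨k₂, h2⟩ := hside (fun t => (t, 1)) (by fun_prop) A₂ s2
  obtain ⟨k₃, h3⟩ := hside (fun t => (1, t)) (by fun_prop) A₃ s3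
  obtain ⟨k₄, h4⟩ := hside (fun t => (t, 0)) (by fun_prop) A₄ s4
  have m0 : (0 : ℝ) ∈ Icc (0 : ℝ) 1 := ⟨le_rfl, zero_le_one⟩
  have m1 : (1 : ℝ) ∈ Icc (0 : ℝ) 1 := ⟨zero_le_one, le_rfl⟩
  have hπ := Real.pi_pos
  have step : ∀ {x A B : ℝ} {k l : ℤ}, |B - A| < Real.pi →
      |x - A - 2 * Real.pi * k| < Real.pi / 2 → |x - B - 2 * Real.pi * l| < Real.pi / 2 →
      k = l := by
    intro x A B k l hAB hk hl
    rw [abs_lt] at *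
    have e1 : 2 * Real.pi * ((k : ℝ) - l) < 2 * Real.pi * 1 := by linarith
    have e2 : 2 * Real.pi * (-1 : ℝ) < 2 * Real.pi * ((k : ℝ) - l) := by linarith
    have e1' := lt_of_mul_lt_mul_left e1 (by positivity)
    have e2' := lt_of_mul_lt_mul_left e2 (by positivity)
    have e3 : (k : ℝ) < l + 1 := by linarith
    have e4 : (l : ℝ) < k + 1 := by linarith
    have e3' : k < l + 1 := by exact_mod_cast e3
    have e4' : l < k + 1 := by exact_mod_cast e4
    omega
  have k12 := step h12 (h1 1 m1) (h2 0 m0)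
  have k23 := step h23 (h2 1 m1) (h3 1 m1)
  have k34 := step h34 (h3 0 m0) (h4 1 m1)
  subst k12 k23 k34
  have a := h1 0 m0
  have b := h4 0 m0
  rw [abs_lt] at *
  linarith

/-- Crossing lemma in a box: a left-right path meets a bottom-top path. -/
theorem exists_eq_of_crossing_box {α β : ℝ → ℂ} (hα : Continuous α) (hβ : Continuous β)
    (h1 : ∀ t ∈ Icc (0 : ℝ) 1, (α 0).re < (β t).re) (h2 : ∀ t ∈ Icc (0 : ℝ) 1, (β t).re < (α 1).re)
    (h3 : ∀ s ∈ Icc (0 : ℝ) 1, (β 0).im < (α s).im)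
    (h4 : ∀ s ∈ Icc (0 : ℝ) 1, (α s).im < (β 1).im) : ∃ s t, α s = β t := by
  by_contra hcon
  push Not at hcon
  have hπ := Real.pi_pos
  have e1 : Complex.exp (-(Real.pi * Complex.I)) = -1 := by
    rw [Complex.exp_neg, Complex.exp_pi_mul_I]; norm_num
  have e2 : Complex.exp (-((Real.pi + Real.pi / 2 : ℝ) * Complex.I)) = Complex.I := by
    have : (-((Real.pi + Real.pi / 2 : ℝ) * Complex.I)) =
      -(Real.pi * Complex.I) + (-(Real.pi / 2 * Complex.I)) := by push_cast; ring
    rw [this, Complex.exp_add, e1, Complex.exp_neg, Complex.exp_pi_div_two_mul_I]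
    simp
  have e3 : Complex.exp (-((2 * Real.pi : ℝ) * Complex.I)) = 1 := by
    rw [Complex.exp_neg]; push_cast; rw [Complex.exp_two_pi_mul_I]; simp
  have e4 : Complex.exp (-((2 * Real.pi + Real.pi / 2 : ℝ) * Complex.I)) = -Complex.I := by
    have : (-((2 * Real.pi + Real.pi / 2 : ℝ) * Complex.I)) =
      -((2 * Real.pi : ℝ) * Complex.I) + (-(Real.pi / 2 * Complex.I)) := by push_cast; ring
    rw [this, Complex.exp_add, e3, Complex.exp_neg, Complex.exp_pi_div_two_mul_I]
    simp
  refine false_of_sides_in_half_planes (F := fun x => α x.1 - β x.2) (by fun_prop)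
    (fun x => sub_ne_zero.2 (hcon _ _)) (A₁ := Real.pi) (A₂ := Real.pi + Real.pi / 2)
    (A₃ := 2 * Real.pi) (A₄ := 2 * Real.pi + Real.pi / 2)
    (by rw [abs_lt]; constructor <;> linarith) (by rw [abs_lt]; constructor <;> linarith)
    (by rw [abs_lt]; constructor <;> linarith) (by rw [abs_lt]; constructor <;> linarith)
    ?_ ?_ ?_ ?_
  · intro t ht; have := h1 t ht; simp only [e1]; simpa using this
  · intro t ht; have := h4 t ht; simp only [e2]; simpa using this
  · intro t ht; have := h2 t ht; simp only [e3]; simpa using this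
  · intro t ht; have := h3 t ht; simp only [e4]; simpa using this

/-- Re-reading of the half-plane condition for unit vectors. -/
theorem re_exp_sub_mul_exp_neg_pos {θ : ℝ} {w : ℂ} (hw : ‖w‖ ≤ 1)
    (hne : Complex.exp (θ * Complex.I) ≠ w) :
    0 < ((Complex.exp (θ * Complex.I) - w) * Complex.exp (-(θ * Complex.I))).re := by
  have e : (Complex.exp (θ * Complex.I) - w) * Complex.exp (-(θ * Complex.I)) =
      1 - w * Complex.exp (-(θ * Complex.I)) := by
    rw [sub_mul, ← Complex.exp_add]; simp
  rw [e]
  set v := w * Complex.exp (-(θ * Complex.I)) with hv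
  have hn : ‖v‖ ≤ 1 := by
    have : ‖Complex.exp (-(θ * Complex.I))‖ = 1 := by
      rw [← neg_mul, ← Complex.ofReal_neg, Complex.norm_exp_ofReal_mul_I]
    rw [hv, norm_mul, this, mul_one]; exact hw
  have hv1 : v ≠ 1 := by
    intro h
    apply hne
    have : w = v * Complex.exp (θ * Complex.I) := by
      rw [hv, mul_assoc, ← Complex.exp_add]; simp
    rw [this, h, one_mul]
  have hre : v.re ≠ 1 := by
    intro h
    apply hv1
    have h2 : v.re * v.re + v.im * v.im ≤ 1 := by
      rw [← Complex.normSq_apply, Complex.normSq_eq_norm_sq]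
      have := norm_nonneg v
      nlinarith
    rw [h] at h2
    have : v.im = 0 := by nlinarith [mul_self_nonneg v.im]
    exact Complex.ext (by simp [h]) (by simp [this])
  have := (Complex.re_le_norm v).trans hn
  simp only [Complex.sub_re, Complex.one_re]
  have := lt_of_le_of_ne this hre
  linarith

/-- Crossing lemma in a disk: paths joining two interlaced pairs of boundary points meet. -/
theorem exists_eq_of_crossing_disk {α β : ℝ → ℂ} (hα : Continuous α) (hβ : Continuous β)
    (hα1 : ∀ t, ‖α t‖ ≤ 1) (hβ1 : ∀ t, ‖β t‖ ≤ 1) {a b c d : ℝ}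
    (hab : a < b) (hbc : b < c) (hcd : c < d) (hda : d < a + 2 * Real.pi)
    (h1 : α 0 = Complex.exp (a * Complex.I)) (h2 : α 1 = Complex.exp (c * Complex.I))
    (h3 : β 0 = Complex.exp (b * Complex.I)) (h4 : β 1 = Complex.exp (d * Complex.I)) :
    ∃ s t, α s = β t := by
  by_contra hcon
  push Not at hcon
  have hπ := Real.pi_pos
  have e1 : ∀ x : ℝ, Complex.exp (-(((x - Real.pi : ℝ) : ℂ) * Complex.I)) =
      - Complex.exp (-(x * Complex.I)) := by
    intro x
    have : (-(((x - Real.pi : ℝ) : ℂ) * Complex.I)) = -(x * Complex.I) + Real.pi * Complex.I := by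
      push_cast; ring
    rw [this, Complex.exp_add, Complex.exp_pi_mul_I]; ring
  have e2 : ∀ x : ℝ, Complex.exp (-(((x + Real.pi : ℝ) : ℂ) * Complex.I)) =
      - Complex.exp (-(x * Complex.I)) := by
    intro x
    have : (-(((x + Real.pi : ℝ) : ℂ) * Complex.I)) =
        -(x * Complex.I) + -(Real.pi * Complex.I) := by
      push_cast; ring
    rw [this, Complex.exp_add, Complex.exp_neg (Real.pi * Complex.I), Complex.exp_pi_mul_I]
    norm_num
  refine false_of_sides_in_half_planes (F := fun x => α x.1 - β x.2) (by fun_prop)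
    (fun x => sub_ne_zero.2 (hcon _ _)) (A₁ := a) (A₂ := d - Real.pi)
    (A₃ := c) (A₄ := b + Real.pi)
    (by rw [abs_lt]; constructor <;> linarith) (by rw [abs_lt]; constructor <;> linarith)
    (by rw [abs_lt]; constructor <;> linarith) (by rw [abs_lt]; constructor <;> linarith)
    ?_ ?_ ?_ ?_
  · intro t _
    simp only [h1]
    exact re_exp_sub_mul_exp_neg_pos (hβ1 t) (h1 ▸ hcon 0 t)
  · intro t _
    simp only [e1, h4]
    rw [show ∀ x y z : ℂ, (x - y) * (-z) = (y - x) * z by intros; ring]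
    exact re_exp_sub_mul_exp_neg_pos (hα1 t) (h4 ▸ (hcon t 1).symm)
  · intro t _
    simp only [h2]
    exact re_exp_sub_mul_exp_neg_pos (hβ1 t) (h2 ▸ hcon 1 t)
  · intro t _
    simp only [e2, h3]
    rw [show ∀ x y z : ℂ, (x - y) * (-z) = (y - x) * z by intros; ring]
    exact re_exp_sub_mul_exp_neg_pos (hα1 t) (h3 ▸ (hcon t 0).symm)

/-! ### Separation of the plane -/

/-- If `p` and `q` lie in a connected set missing the closed set `A`, then `(z - p) / (z - q)`
has a continuous logarithm on `A`. -/
theorem exists_log_of_isPreconnected {A Γ : Set ℂ} (hA : IsClosed A) (hΓ : IsPreconnected Γ)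
    (hd : Disjoint Γ A) {p q : ℂ} (hp : p ∈ Γ) (hq : q ∈ Γ) :
    ∃ L : ℂ → ℂ, ContinuousOn L A ∧ ∀ z ∈ A, z - p = (z - q) * Complex.exp (L z) := by
  refine hΓ.induction₂ (fun p q => ∃ L : ℂ → ℂ, ContinuousOn L A ∧
    ∀ z ∈ A, z - p = (z - q) * Complex.exp (L z)) ?_ ?_ ?_ hp hq
  · intro x hx
    have hxA : x ∉ A := disjoint_left.1 hd hx
    obtain ⟨r, hr, hrA⟩ := Metric.mem_nhds_iff.1 (hA.isOpen_compl.mem_nhds hxA)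
    have hball : ∀ y ∈ Metric.ball x (r / 2), ∃ L : ℂ → ℂ, ContinuousOn L A ∧
        ∀ z ∈ A, z - x = (z - y) * Complex.exp (L z) := by
      intro y hy
      have hzy : ∀ z ∈ A, ‖x - y‖ < ‖z - y‖ := by
        intro z hz
        have h1 : ¬ dist z x < r := fun h => hrA h hz
        have h2 : dist y x < r / 2 := hy
        have h3 : dist z x ≤ dist z y + dist y x := dist_triangle _ _ _
        rw [← dist_eq_norm, ← dist_eq_norm, dist_comm x y]
        linarith
      have hne : ∀ z ∈ A, z - y ≠ 0 := fun z hz h => by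
        have := hzy z hz
        rw [h, norm_zero] at this
        exact absurd (norm_nonneg (x - y)) (not_le.2 this)
      have hslit : ∀ z ∈ A, (z - x) / (z - y) ∈ Complex.slitPlane := by
        intro z hz
        have e : (z - x) / (z - y) = 1 - (x - y) / (z - y) := by
          field_simp [hne z hz]; ring
        rw [e]
        refine Or.inl ?_
        have hlt : ‖(x - y) / (z - y)‖ < 1 := by
          rw [norm_div, div_lt_one (norm_pos_iff.2 (hne z hz))]
          exact hzy z hz
        have := (Complex.re_le_norm ((x - y) / (z - y))).trans_lt hlt
        simp only [Complex.sub_re, Complex.one_re]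
        linarith
      refine ⟨fun z => Complex.log ((z - x) / (z - y)), ?_, fun z hz => ?_⟩
      · refine ContinuousOn.clog (ContinuousOn.div (by fun_prop) (by fun_prop) hne) hslit
      · have h0 : (z - x) / (z - y) ≠ 0 := Complex.slitPlane_ne_zero (hslit z hz)
        simp only
        rw [Complex.exp_log h0, mul_div_cancel₀ _ (hne z hz)]
    exact mem_nhdsWithin_of_mem_nhds (mem_of_superset (Metric.ball_mem_nhds x (half_pos hr)) hball)
  · rintro x y z - - - ⟨L, hL, h1⟩ ⟨M, hM, h2⟩
    refine ⟨fun w => M w + L w, hM.add hL, fun w hw => ?_⟩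
    rw [h1 w hw, h2 w hw, Complex.exp_add, mul_assoc]
  · rintro x y - - ⟨L, hL, h1⟩
    refine ⟨fun w => - L w, hL.neg, fun w hw => ?_⟩
    rw [h1 w hw, mul_assoc, ← Complex.exp_add]
    simp

/-- The function `z - p` has no continuous logarithm near infinity. -/
theorem not_exists_log_sub {M : ℂ → ℂ} (hM : Continuous M) {p : ℂ} {R : ℝ}
    (h : ∀ z, R < ‖z‖ → Complex.exp (M z) = z - p) : False := by
  obtain ⟨ρ, hρ0, hρ⟩ : ∃ ρ : ℝ, 0 < ρ ∧ R + ‖p‖ < ρ :=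
    ⟨max 0 (R + ‖p‖) + 1, by positivity, by
      have := le_max_right 0 (R + ‖p‖); linarith⟩
  have hexp : ∀ θ : ℝ, Complex.exp (M (p + ρ * Complex.exp (θ * Complex.I))) =
      ρ * Complex.exp (θ * Complex.I) := by
    intro θ
    rw [h]
    · ring
    · have h1 : ‖(ρ : ℂ) * Complex.exp (θ * Complex.I)‖ = ρ := by
        rw [norm_mul, Complex.norm_exp_ofReal_mul_I, mul_one, Complex.norm_of_nonneg hρ0.le]
      have h2 := norm_sub_norm_le ((ρ : ℂ) * Complex.exp (θ * Complex.I)) (-p)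
      rw [h1, norm_neg, sub_neg_eq_add, add_comm ((ρ : ℂ) * _)] at h2
      linarith
  have key := isPreconnected_univ.eq_of_exp_eq_one (s := (univ : Set ℝ))
    (f := fun θ : ℝ => M (p + ρ * Complex.exp (θ * Complex.I)) - θ * Complex.I - Real.log ρ)
    (by fun_prop) (fun θ _ => by
      rw [Complex.exp_sub, Complex.exp_sub, hexp, ← Complex.ofReal_exp, Real.exp_log hρ0]
      have : (ρ : ℂ) ≠ 0 := by exact_mod_cast hρ0.ne'
      field_simp [Complex.exp_ne_zero]) (mem_univ 0) (mem_univ (2 * Real.pi))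
  simp only [Complex.ofReal_zero, zero_mul, Complex.exp_zero, mul_one, sub_zero, Complex.ofReal_mul,
    Complex.ofReal_ofNat, Complex.exp_two_pi_mul_I, sub_left_inj] at key
  have h2 := sub_eq_self.1 key.symm
  simp at h2

/-- A form of Janiszewski's theorem: if `A`, `B` are closed with connected intersection and
neither separates `p` from `q`, then `A ∪ B` does not separate them either. -/
theorem not_separated_of_isPreconnected_inter {A B Γ₁ Γ₂ N S : Set ℂ} (hA : IsClosed A)
    (hB : IsClosed B) (hAB : IsPreconnected (A ∩ B)) (hΓ₁ : IsPreconnected Γ₁)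
    (hΓ₂ : IsPreconnected Γ₂) (h1 : Disjoint Γ₁ A) (h2 : Disjoint Γ₂ B) {p q : ℂ}
    (hp₁ : p ∈ Γ₁) (hq₁ : q ∈ Γ₁) (hp₂ : p ∈ Γ₂) (hq₂ : q ∈ Γ₂) (hN : IsOpen N) (hS : IsOpen S)
    (hNS : Disjoint N S) (hcover : (A ∪ B)ᶜ = N ∪ S) (hpN : p ∈ N) (hqS : q ∈ S)
    (hbdd : Bornology.IsBounded N) : False := by
  classical
  obtain ⟨LA, hLA, hA'⟩ := exists_log_of_isPreconnected hA hΓ₁ h1 hp₁ hq₁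
  obtain ⟨LB, hLB, hB'⟩ := exists_log_of_isPreconnected hB hΓ₂ h2 hp₂ hq₂
  have hqA : ∀ z ∈ A, z - q ≠ 0 := fun z hz h => disjoint_left.1 h1 hq₁ (sub_eq_zero.1 h ▸ hz)
  have hqB : ∀ z ∈ B, z - q ≠ 0 := fun z hz h => disjoint_left.1 h2 hq₂ (sub_eq_zero.1 h ▸ hz)
  obtain ⟨c, hc, hc1⟩ : ∃ c : ℂ, (∀ z ∈ A ∩ B, LA z = LB z + c) ∧ Complex.exp c = 1 := by
    have hexp : ∀ z ∈ A ∩ B, Complex.exp (LA z - LB z) = 1 := by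
      intro z hz
      have : (z - q) * Complex.exp (LA z) = (z - q) * Complex.exp (LB z) := by
        rw [← hA' z hz.1, ← hB' z hz.2]
      rw [Complex.exp_sub, mul_left_cancel₀ (hqA z hz.1) this, div_self (Complex.exp_ne_zero _)]
    rcases (A ∩ B).eq_empty_or_nonempty with he | ⟨z₀, hz₀⟩
    · exact ⟨0, by simp [he], by simp⟩
    · refine ⟨LA z₀ - LB z₀, fun z hz => ?_, hexp z₀ hz₀⟩
      have := hAB.eq_of_exp_eq_one (f := fun z => LA z - LB z)
        ((hLA.mono inter_subset_left).sub (hLB.mono inter_subset_right)) hexp hz hz₀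
      rw [← this]; ring
  set L : ℂ → ℂ := fun z => if z ∈ A then LA z else LB z + c with hLdef
  have hL1 : EqOn L LA A := fun z hz => by simp [hLdef, hz]
  have hL2 : EqOn L (fun z => LB z + c) B := fun z hz => by
    by_cases hzA : z ∈ A
    · simp [hLdef, hzA, hc z ⟨hzA, hz⟩]
    · simp [hLdef, hzA]
  have hL : ContinuousOn L (A ∪ B) :=
    (hLA.congr hL1).union_of_isClosed ((hLB.add continuousOn_const).congr hL2) hA hB
  have hLeq : ∀ z ∈ A ∪ B, z - p = (z - q) * Complex.exp (L z) := by
    rintro z (hz | hz)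
    · rw [hL1 hz, hA' z hz]
    · rw [hL2 hz, hB' z hz]; simp [Complex.exp_add, hc1]
  obtain ⟨E, hE⟩ := ContinuousMap.exists_restrict_eq (hA.union hB)
    (⟨(A ∪ B).domRestrict L, continuousOn_iff_continuous_domRestrict.1 hL⟩ : C((A ∪ B : Set ℂ), ℂ))
  have hE' : ∀ z ∈ A ∪ B, E z = L z := fun z hz => congrArg (fun f => f ⟨z, hz⟩) hE
  have hfr : frontier N ⊆ A ∪ B := by
    intro z hz
    by_contra hcon
    have : z ∈ N ∪ S := hcover ▸ hcon
    rw [hN.frontier_eq] at hz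
    rcases this with h | h
    · exact hz.2 h
    · obtain ⟨w, hw, hw'⟩ := mem_closure_iff.1 hz.1 S hS h
      exact disjoint_left.1 hNS hw' hw
  have hF : Continuous fun z => if z ∈ N then (z - q) * Complex.exp (E z) else z - p := by
    refine Continuous.if (fun z hz => ?_) (by fun_prop) (by fun_prop)
    have hz' := hfr hz
    rw [hE' z hz', hLeq z hz']
  have hF0 : ∀ z, (if z ∈ N then (z - q) * Complex.exp (E z) else z - p) ≠ 0 := by
    intro z
    split_ifs with hz
    · refine mul_ne_zero (fun h => ?_) (Complex.exp_ne_zero _)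
      exact disjoint_left.1 hNS hz ((sub_eq_zero.1 h) ▸ hqS)
    · intro h
      exact hz ((sub_eq_zero.1 h) ▸ hpN)
  obtain ⟨M, hM, hMF⟩ := exists_continuous_log hF hF0
  obtain ⟨R, hR⟩ := hbdd.exists_norm_le
  refine not_exists_log_sub hM (R := R) (p := p) fun z hz => ?_
  rw [hMF, if_neg fun h => absurd (hR z h) (not_le.2 hz)]

/-! ### Preimages of connected sets -/

/-- If `f` is closed on `K` and has connected fibres over `C`, the preimage of the connected set
`C` is connected. -/
theorem IsPreconnected.inter_preimage_of_fibers {X Y : Type*} [TopologicalSpace X]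
    [TopologicalSpace Y] {f : X → Y} {K : Set X}
    (hcl : ∀ F, IsClosed F → IsClosed (f '' (K ∩ F))) {C : Set Y} (hC : IsPreconnected C)
    (hfib : ∀ y ∈ C, IsConnected (K ∩ f ⁻¹' {y})) : IsPreconnected (K ∩ f ⁻¹' C) := by
  rw [isPreconnected_iff_subset_of_disjoint]
  intro u v hu hv huv hdis
  have hU := (hcl uᶜ hu.isClosed_compl).isOpen_compl
  have hV := (hcl vᶜ hv.isClosed_compl).isOpen_compl
  have memU : ∀ w : Set X, ∀ y, K ∩ f ⁻¹' {y} ⊆ w ↔ y ∈ (f '' (K ∩ wᶜ))ᶜ := by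
    intro w y
    constructor
    · rintro h ⟨x, ⟨hx, hxw⟩, rfl⟩
      exact hxw (h ⟨hx, rfl⟩)
    · rintro h x ⟨hx, rfl⟩
      by_contra hxw
      exact h ⟨x, ⟨hx, hxw⟩, rfl⟩
  have hsub : ∀ y ∈ C, K ∩ f ⁻¹' {y} ⊆ K ∩ f ⁻¹' C := by
    rintro y hy x ⟨hx, rfl⟩
    exact ⟨hx, hy⟩
  have hcov : C ⊆ (f '' (K ∩ uᶜ))ᶜ ∪ (f '' (K ∩ vᶜ))ᶜ := by
    intro y hy
    have := isPreconnected_iff_subset_of_disjoint.1 (hfib y hy).isPreconnected u v hu hv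
      ((hsub y hy).trans huv)
      (by rw [← subset_empty_iff, ← hdis]; exact inter_subset_inter_left _ (hsub y hy))
    exact this.imp (memU u y).1 (memU v y).1
  have hdis' : C ∩ ((f '' (K ∩ uᶜ))ᶜ ∩ (f '' (K ∩ vᶜ))ᶜ) = ∅ := by
    rw [← subset_empty_iff]
    rintro y ⟨hy, hyu, hyv⟩
    obtain ⟨x, hx⟩ := (hfib y hy).nonempty
    have hmem : x ∈ K ∩ f ⁻¹' C ∩ (u ∩ v) :=
      ⟨hsub y hy hx, (memU u y).2 hyu hx, (memU v y).2 hyv hx⟩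
    rw [hdis] at hmem
    exact hmem
  refine (isPreconnected_iff_subset_of_disjoint.1 hC _ _ hU hV hcov hdis').imp ?_ ?_ <;>
  · rintro h x ⟨hx, hxC⟩
    exact (memU _ (f x)).2 (h hxC) ⟨hx, rfl⟩

/-! ### Monotone maps of the disk, extended radially -/

/-- The radial retraction of the plane onto the closed unit disk. -/
noncomputable def diskRetract (x : ℂ) : ℂ := ((max 1 ‖x‖)⁻¹ : ℝ) * x

theorem continuous_diskRetract : Continuous diskRetract := by
  unfold diskRetract
  refine Continuous.mul (Complex.continuous_ofReal.comp (Continuous.inv₀ (by fun_prop) ?_))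
    continuous_id
  intro x
  positivity

theorem diskRetract_of_norm_le {x : ℂ} (hx : ‖x‖ ≤ 1) : diskRetract x = x := by
  simp [diskRetract, max_eq_left hx]

theorem norm_diskRetract_le (x : ℂ) : ‖diskRetract x‖ ≤ 1 := by
  unfold diskRetract
  rw [norm_mul, Complex.norm_of_nonneg (by positivity), inv_mul_le_iff₀ (by positivity)]
  simp

theorem diskRetract_mul {x : ℂ} (hx : ‖x‖ = 1) {t : ℝ} (ht : 1 ≤ t) : diskRetract (t * x) = x := by
  have ht0 : (t : ℂ) ≠ 0 := by exact_mod_cast (by linarith : t ≠ 0)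
  unfold diskRetract
  rw [norm_mul, hx, mul_one, Complex.norm_of_nonneg (by linarith), max_eq_right ht]
  push_cast
  field_simp

/-- The preimage of a connected subset of the disk under the radial retraction is connected. -/
theorem IsPreconnected.diskRetract_preimage {K : Set ℂ}
    (hK : IsPreconnected (Metric.closedBall 0 1 ∩ K)) : IsPreconnected (diskRetract ⁻¹' K) := by
  have hseg : ∀ x ∈ diskRetract ⁻¹' K, segment ℝ (diskRetract x) x ⊆ diskRetract ⁻¹' K := by
    rintro x hx y ⟨a, b, ha, hb, hab, rfl⟩
    rcases le_total ‖x‖ 1 with h | h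
    · have e : a • diskRetract x + b • x = x := by
        rw [diskRetract_of_norm_le h, ← add_smul, hab, one_smul]
      rw [e]; exact hx
    · have hpos : 0 < ‖x‖ := by linarith
      set u : ℂ := (‖x‖⁻¹ : ℝ) * x with hu
      have hxu : diskRetract x = u := by simp [diskRetract, max_eq_right h, hu]
      have hun : ‖u‖ = 1 := by
        rw [hu, norm_mul, Complex.norm_of_nonneg (by positivity)]
        field_simp
      have hx' : x = (‖x‖ : ℝ) * u := by
        rw [hu, ← mul_assoc, ← Complex.ofReal_mul, mul_inv_cancel₀ hpos.ne']; simp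
      have e : a • diskRetract x + b • x = ((a + b * ‖x‖ : ℝ) : ℂ) * u := by
        rw [hxu]
        simp only [Complex.real_smul]
        rw [show (b : ℂ) * x = b * ((‖x‖ : ℝ) * u) by rw [← hx']]
        push_cast; ring
      rw [mem_preimage, e, diskRetract_mul hun (by nlinarith), ← hxu]
      exact hx
  have hbase : Metric.closedBall 0 1 ∩ K ⊆ diskRetract ⁻¹' K := by
    rintro x ⟨hx, hxK⟩
    rw [mem_closedBall_zero_iff] at hx
    rwa [mem_preimage, diskRetract_of_norm_le hx]
  rcases (diskRetract ⁻¹' K).eq_empty_or_nonempty with he | ⟨x₀, hx₀⟩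
  · rw [he]; exact isPreconnected_empty
  refine isPreconnected_of_forall (diskRetract x₀) fun x hx => ?_
  refine ⟨Metric.closedBall 0 1 ∩ K ∪ segment ℝ (diskRetract x) x,
    union_subset hbase (hseg x hx), Or.inl ⟨by simpa using norm_diskRetract_le x₀, hx₀⟩,
    Or.inr (right_mem_segment _ _ _), ?_⟩
  exact hK.union (diskRetract x) ⟨by simpa using norm_diskRetract_le x, hx⟩
    (left_mem_segment _ _ _) (convex_segment _ _).isPreconnected

/-- A monotone self-map of the closed unit disk, extended to the plane by the radial retraction. -/
structure DiskMonotone (g : ℂ → ℂ) : Prop where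
  continuous : Continuous g
  norm_le : ∀ x, ‖g x‖ ≤ 1
  retract : ∀ x, g (diskRetract x) = g x
  fiber : ∀ b : ℂ, ‖b‖ ≤ 1 → IsConnected (Metric.closedBall 0 1 ∩ g ⁻¹' {b})

namespace DiskMonotone

variable {g : ℂ → ℂ}

theorem isPreconnected_inter_preimage (hg : DiskMonotone g) {C : Set ℂ} (hC : IsPreconnected C)
    (hC1 : ∀ y ∈ C, ‖y‖ ≤ 1) : IsPreconnected (Metric.closedBall 0 1 ∩ g ⁻¹' C) :=
  hC.inter_preimage_of_fibers
    (fun _ hF => (((isCompact_closedBall _ _).inter_right hF).image hg.continuous).isClosed)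
    fun y hy => hg.fiber y (hC1 y hy)

theorem isPreconnected_preimage (hg : DiskMonotone g) {C : Set ℂ} (hC : IsPreconnected C)
    (hC1 : ∀ y ∈ C, ‖y‖ ≤ 1) : IsPreconnected (g ⁻¹' C) := by
  have h := (hg.isPreconnected_inter_preimage hC hC1).diskRetract_preimage
  rwa [← preimage_comp, show g ∘ diskRetract = g from funext hg.retract] at h

theorem exists_eq (hg : DiskMonotone g) {b : ℂ} (hb : ‖b‖ ≤ 1) : ∃ x, ‖x‖ ≤ 1 ∧ g x = b := by
  obtain ⟨x, hx, hxb⟩ := (hg.fiber b hb).nonempty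
  exact ⟨x, by simpa using hx, hxb⟩

theorem const_mul (hg : DiskMonotone g) {c : ℂ} (hc : ‖c‖ = 1) :
    DiskMonotone fun x => c * g x where
  continuous := continuous_const.mul hg.continuous
  norm_le x := by rw [norm_mul, hc, one_mul]; exact hg.norm_le x
  retract x := by rw [hg.retract]
  fiber b hb := by
    have hc0 : c ≠ 0 := by rintro rfl; simp at hc
    have e : (fun x => c * g x) ⁻¹' {b} = g ⁻¹' {c⁻¹ * b} := by
      ext x
      simp only [mem_preimage, mem_singleton_iff]
      rw [eq_inv_mul_iff_mul_eq₀ hc0]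
    rw [e]
    exact hg.fiber _ (by rw [norm_mul, norm_inv, hc]; simpa using hb)

theorem star (hg : DiskMonotone g) : DiskMonotone fun x => (starRingEnd ℂ) (g x) where
  continuous := Complex.continuous_conj.comp hg.continuous
  norm_le x := by rw [Complex.norm_conj]; exact hg.norm_le x
  retract x := by rw [hg.retract]
  fiber b hb := by
    have e : (fun x => (starRingEnd ℂ) (g x)) ⁻¹' {b} = g ⁻¹' {(starRingEnd ℂ) b} := by
      ext x
      simp only [mem_preimage, mem_singleton_iff]
      constructor
      · rintro rfl; simp
      · intro h; rw [h]; simp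
    rw [e]
    exact hg.fiber _ (by rwa [Complex.norm_conj])

/-- An interior value cannot be taken in such a way that its fibre, together with a
neighbourhood `O` of infinity, is connected. -/
theorem false_of_fiber_union (hg : DiskMonotone g) {b : ℂ} (hb : ‖b‖ < 1) {O : Set ℂ}
    (hO : IsClosed O) (hO1 : ∀ x ∈ O, 1 < ‖x‖) (hconn : IsPreconnected (g ⁻¹' {b} ∪ O))
    (hbdd : Bornology.IsBounded (Oᶜ ∩ {x | b.im < (g x).im})) : False := by
  set δ : ℝ := (1 - ‖b‖) / 2 with hδ
  have hδ0 : 0 < δ := by rw [hδ]; linarith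
  have hnear : ∀ v : ℂ, ‖v‖ ≤ 1 → ‖b + δ * v‖ ≤ 1 := by
    intro v hv
    calc ‖b + δ * v‖ ≤ ‖b‖ + ‖(δ : ℂ) * v‖ := norm_add_le _ _
      _ ≤ ‖b‖ + δ := by
        rw [norm_mul, Complex.norm_of_nonneg hδ0.le]; nlinarith
      _ ≤ 1 := by rw [hδ]; linarith
  obtain ⟨p, hp1, hp⟩ := hg.exists_eq (hnear Complex.I (by simp))
  obtain ⟨q, hq1, hq⟩ := hg.exists_eq (hnear (-Complex.I) (by simp))
  have hpoly : ∀ e : ℝ, |e| = 1 → ∃ P : Set ℂ, IsPreconnected P ∧ (∀ y ∈ P, ‖y‖ ≤ 1) ∧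
      b + δ * Complex.I ∈ P ∧ b + δ * (-Complex.I) ∈ P ∧
      ∀ y ∈ P, y.im = b.im → 0 < e * (y.re - b.re) := by
    intro e he
    have hball : ∀ {v w : ℂ}, ‖v‖ ≤ 1 → ‖w‖ ≤ 1 → ∀ y ∈ segment ℝ (b + δ * v) (b + δ * w),
        ‖y‖ ≤ 1 := by
      intro v w hv hw y hy
      simpa using (convex_closedBall (0 : ℂ) 1).segment_subset
        (by simpa using hnear v hv) (by simpa using hnear w hw) hy
    have he1 : ‖(e : ℂ)‖ ≤ 1 := by simp [he]
    have hee : e * e = 1 := by rw [← abs_mul_abs_self, he, one_mul]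
    refine ⟨segment ℝ (b + δ * Complex.I) (b + δ * e) ∪
      segment ℝ (b + δ * e) (b + δ * (-Complex.I)), ?_, ?_, Or.inl (left_mem_segment _ _ _),
      Or.inr (right_mem_segment _ _ _), ?_⟩
    · exact (convex_segment _ _).isPreconnected.union (b + δ * e) (right_mem_segment _ _ _)
        (left_mem_segment _ _ _) (convex_segment _ _).isPreconnected
    · rintro y (hy | hy)
      · exact hball (by simp) he1 y hy
      · exact hball he1 (by simp) y hy
    · rintro y (⟨s, t, hs, ht, hst, rfl⟩ | ⟨s, t, hs, ht, hst, rfl⟩) him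
      · simp at him ⊢
        have hs' : s * δ = 0 := by
          have h1 : t = 1 - s := by linarith
          rw [h1] at him; linarith
        have h0 : s = 0 := (mul_eq_zero.1 hs').resolve_right hδ0.ne'
        have h1 : t = 1 := by linarith
        subst h0 h1
        nlinarith
      · simp at him ⊢
        have ht' : t * δ = 0 := by
          have h1 : s = 1 - t := by linarith
          rw [h1] at him; linarith
        have h0 : t = 0 := (mul_eq_zero.1 ht').resolve_right hδ0.ne'
        have h1 : s = 1 := by linarith
        subst h0 h1
        nlinarith
  obtain ⟨P, hP, hP1, hpP, hqP, hPe⟩ := hpoly 1 (by simp)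
  obtain ⟨Q, hQ, hQ1, hpQ, hqQ, hQe⟩ := hpoly (-1) (by simp)
  have hgre : Continuous fun x => (g x).re := Complex.continuous_re.comp hg.continuous
  have hgim : Continuous fun x => (g x).im := Complex.continuous_im.comp hg.continuous
  have hnotO : ∀ x, ‖x‖ ≤ 1 → x ∉ O := fun x hx h => absurd hx (not_le.2 (hO1 x h))
  refine not_separated_of_isPreconnected_inter
    (A := {x | (g x).im = b.im ∧ (g x).re ≤ b.re} ∪ O)
    (B := {x | (g x).im = b.im ∧ b.re ≤ (g x).re} ∪ O)
    (Γ₁ := Metric.closedBall 0 1 ∩ g ⁻¹' P) (Γ₂ := Metric.closedBall 0 1 ∩ g ⁻¹' Q)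
    (N := Oᶜ ∩ {x | b.im < (g x).im}) (S := Oᶜ ∩ {x | (g x).im < b.im}) (p := p) (q := q)
    ?_ ?_ ?_ ?_ ?_ ?_ ?_ ?_ ?_ ?_ ?_ ?_ ?_ ?_ ?_ ?_ ?_ hbdd
  · exact ((isClosed_eq hgim continuous_const).inter (isClosed_le hgre continuous_const)).union hO
  · exact ((isClosed_eq hgim continuous_const).inter (isClosed_le continuous_const hgre)).union hO
  · convert hconn using 1
    rw [← inter_union_distrib_right]
    congr 1
    ext x
    simp only [mem_inter_iff, mem_ofPred_eq, mem_preimage, mem_singleton_iff]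
    constructor
    · rintro ⟨⟨h1, h2⟩, -, h3⟩
      exact Complex.ext (le_antisymm h2 h3) h1
    · intro h; simp [h]
  · exact hg.isPreconnected_inter_preimage hP hP1
  · exact hg.isPreconnected_inter_preimage hQ hQ1
  · rw [disjoint_left]
    rintro x ⟨hx, hxP⟩ (⟨h1, h2⟩ | h)
    · have := hPe _ hxP h1; linarith
    · exact hnotO x (by simpa using hx) h
  · rw [disjoint_left]
    rintro x ⟨hx, hxQ⟩ (⟨h1, h2⟩ | h)
    · have := hQe _ hxQ h1; linarith
    · exact hnotO x (by simpa using hx) h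
  · exact ⟨by simpa using hp1, by rwa [mem_preimage, hp]⟩
  · exact ⟨by simpa using hq1, by rwa [mem_preimage, hq]⟩
  · exact ⟨by simpa using hp1, by rwa [mem_preimage, hp]⟩
  · exact ⟨by simpa using hq1, by rwa [mem_preimage, hq]⟩
  · exact hO.isOpen_compl.inter (isOpen_lt continuous_const hgim)
  · exact hO.isOpen_compl.inter (isOpen_lt hgim continuous_const)
  · rw [disjoint_left]
    rintro x ⟨-, h1⟩ ⟨-, h2⟩
    rw [mem_ofPred_eq] at h1 h2
    exact lt_asymm h1 h2
  · ext x
    simp only [mem_compl_iff, mem_union, mem_ofPred_eq, mem_inter_iff]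
    rcases lt_trichotomy (g x).im b.im with h | h | h
    · have := h.ne; have := h.not_gt; tauto
    · have := h.not_lt; have := h.not_gt; have := le_total (g x).re b.re; tauto
    · have := h.ne'; have := h.not_gt; tauto
  · exact ⟨hnotO p hp1, by simp [hp, hδ0]⟩
  · exact ⟨hnotO q hq1, by simp [hq, hδ0]⟩

/-- A monotone map of the disk sends the boundary circle into itself. -/
theorem norm_eq_one (hg : DiskMonotone g) {x : ℂ} (hx : ‖x‖ = 1) : ‖g x‖ = 1 := by
  by_contra hne
  have hlt : ‖g x‖ < 1 := lt_of_le_of_ne (hg.norm_le x) hne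
  refine hg.false_of_fiber_union hlt (O := {z | 2 ≤ ‖z‖})
    (isClosed_le continuous_const continuous_norm)
    (fun z hz => lt_of_lt_of_le (by norm_num) hz) ?_ ?_
  · have hO : IsPreconnected {z : ℂ | 2 ≤ ‖z‖} := by
      have h1 : {z : ℂ | 2 ≤ ‖z‖} =
          (fun p : ℝ × ℝ => (p.1 : ℂ) * Complex.exp (p.2 * Complex.I)) '' (Ici 2 ×ˢ univ) := by
        ext z
        constructor
        · intro hz
          exact ⟨(‖z‖, z.arg), ⟨hz, mem_univ _⟩, Complex.norm_mul_exp_arg_mul_I z⟩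
        · rintro ⟨⟨r, θ⟩, ⟨hr, -⟩, rfl⟩
          have hr' : (2 : ℝ) ≤ r := hr
          simp only [mem_ofPred_eq, norm_mul, Complex.norm_exp_ofReal_mul_I, mul_one]
          rw [Complex.norm_of_nonneg (by linarith)]
          exact hr'
      rw [h1]
      exact (isPreconnected_Ici.prod isPreconnected_univ).image _ (by fun_prop)
    refine (hg.isPreconnected_preimage isPreconnected_singleton (by simpa using hlt.le)).union
      (2 * x) ?_ ?_ hO
    · have := diskRetract_mul hx (t := 2) (by norm_num)
      rw [mem_preimage, mem_singleton_iff, ← hg.retract]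
      push_cast at this
      rw [this]
    · simp [hx]
  · refine (Metric.isBounded_ball (x := (0 : ℂ)) (r := 2)).subset ?_
    rintro z ⟨hz, -⟩
    simpa using hz

/-- A monotone map of the disk is not constant on the boundary circle. -/
theorem exists_ne_on_circle (hg : DiskMonotone g) (w : ℂ) : ∃ x : ℂ, ‖x‖ = 1 ∧ g x ≠ w := by
  by_contra hcon
  push Not at hcon
  have hw : ‖w‖ = 1 := by rw [← hcon 1 (by simp)]; exact hg.norm_eq_one (by simp)
  set c : ℂ := -Complex.I * (starRingEnd ℂ) w with hc
  have hc1 : ‖c‖ = 1 := by simp [hc, hw]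
  have hcw : c * w = -Complex.I := by
    rw [hc, mul_assoc, mul_comm _ w, Complex.mul_conj, Complex.normSq_eq_norm_sq, hw]; simp
  have hout : ∀ x : ℂ, 1 ≤ ‖x‖ → c * g x = -Complex.I := by
    intro x hx
    rw [← hg.retract, hcon, hcw]
    unfold diskRetract
    rw [max_eq_right hx, norm_mul, Complex.norm_of_nonneg (by positivity)]
    field_simp
  have hb : Bornology.IsBounded {x | (0 : ℂ).im < (c * g x).im} := by
    refine (Metric.isBounded_ball (x := (0 : ℂ)) (r := 1)).subset fun x hx => ?_
    by_contra hx1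
    have := hout x (by simpa using hx1)
    simp only [mem_ofPred_eq, this] at hx
    norm_num at hx
  refine (hg.const_mul hc1).false_of_fiber_union (b := 0) (by simp) (O := ∅) isClosed_empty
    (by simp) ?_ (by simpa using hb)
  rw [union_empty]
  exact (hg.const_mul hc1).isPreconnected_preimage isPreconnected_singleton (by simp)

end DiskMonotone

/-! ### The boundary map -/

namespace DiskMonotone

variable {g : ℂ → ℂ}

/-- Fibres of the boundary map do not interlace with their complement. -/
theorem eq_or_eq_of_interlaced (hg : DiskMonotone g) {a b c d : ℝ} (hab : a < b) (hbc : b < c)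
    (hcd : c < d) (hda : d < a + 2 * Real.pi)
    (hac : g (Complex.exp (a * Complex.I)) = g (Complex.exp (c * Complex.I))) :
    g (Complex.exp (b * Complex.I)) = g (Complex.exp (a * Complex.I)) ∨
      g (Complex.exp (d * Complex.I)) = g (Complex.exp (a * Complex.I)) := by
  by_contra hcon
  push Not at hcon
  obtain ⟨hb, hd⟩ := hcon
  set w := g (Complex.exp (a * Complex.I)) with hw
  have hw1 : ‖w‖ = 1 := hg.norm_eq_one (Complex.norm_exp_ofReal_mul_I a)
  have hconv : Convex ℝ (Metric.closedBall (0 : ℂ) 1 \ {w}) := by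
    have hext : w ∈ (Metric.closedBall (0 : ℂ) 1).extremePoints ℝ := by
      rw [StrictConvexSpace.extremePoints_closedBall_eq_sphere]
      simpa using hw1
    exact ((convex_closedBall (0 : ℂ) 1).mem_extremePoints_iff_convex_sdiff.1 hext).2
  have hβset : g ⁻¹' (Metric.closedBall (0 : ℂ) 1 \ {w}) = {x | g x ≠ w} := by
    ext x; simp [hg.norm_le x]
  have hβconn : IsConnected {x | g x ≠ w} := by
    refine ⟨⟨_, hb⟩, ?_⟩
    rw [← hβset]
    exact hg.isPreconnected_preimage hconv.isPreconnected fun y hy => by simpa using hy.1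
  have hβopen : IsOpen {x | g x ≠ w} := isOpen_ne_fun hg.continuous continuous_const
  obtain ⟨β, hβ⟩ := (hβopen.isConnected_iff_isPathConnected.1 hβconn).joinedIn _ hb _ hd
  obtain ⟨ρ, hρ, hβρ⟩ : ∃ ρ > 0, ∀ t, ρ ≤ ‖g (β t) - w‖ := by
    obtain ⟨t₀, -, ht₀⟩ := isCompact_univ.exists_isMinOn (univ_nonempty (α := unitInterval))
      (f := fun t => ‖g (β t) - w‖)
      (((hg.continuous.comp β.continuous).sub continuous_const).norm.continuousOn)
    exact ⟨_, norm_pos_iff.2 (sub_ne_zero.2 (hβ t₀)), fun t => ht₀ (mem_univ t)⟩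
  have hαset : g ⁻¹' (Metric.closedBall (0 : ℂ) 1 ∩ Metric.ball w ρ) = {x | ‖g x - w‖ < ρ} := by
    ext x; simp [hg.norm_le x, dist_eq_norm]
  have ha' : Complex.exp (a * Complex.I) ∈ {x | ‖g x - w‖ < ρ} := by simp [← hw, hρ]
  have hc' : Complex.exp (c * Complex.I) ∈ {x | ‖g x - w‖ < ρ} := by simp [← hac, hρ]
  have hαconn : IsConnected {x | ‖g x - w‖ < ρ} := by
    refine ⟨⟨_, ha'⟩, ?_⟩
    rw [← hαset]
    exact hg.isPreconnected_preimage
      ((convex_closedBall _ _).inter (convex_ball _ _)).isPreconnected fun y hy => by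
        simpa using hy.1
  have hαopen : IsOpen {x | ‖g x - w‖ < ρ} :=
    isOpen_lt (hg.continuous.sub continuous_const).norm continuous_const
  obtain ⟨α, hα⟩ := (hαopen.isConnected_iff_isPathConnected.1 hαconn).joinedIn _ ha' _ hc'
  have hr : ∀ x : ℝ, diskRetract (Complex.exp (x * Complex.I)) = Complex.exp (x * Complex.I) :=
    fun x => diskRetract_of_norm_le (Complex.norm_exp_ofReal_mul_I x).le
  obtain ⟨s, t, hst⟩ := exists_eq_of_crossing_disk
    (α := fun t => diskRetract (α.extend t)) (β := fun t => diskRetract (β.extend t))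
    (continuous_diskRetract.comp α.continuous_extend)
    (continuous_diskRetract.comp β.continuous_extend)
    (fun _ => norm_diskRetract_le _) (fun _ => norm_diskRetract_le _) hab hbc hcd hda
    (by simp [hr]) (by simp [hr]) (by simp [hr]) (by simp [hr])
  have hst' : g (α.extend s) = g (β.extend t) := by
    rw [← hg.retract (α.extend s), ← hg.retract (β.extend t), hst]
  have h1 : ‖g (α.extend s) - w‖ < ρ := hα _
  have h2 : ρ ≤ ‖g (β.extend t) - w‖ := hβρ _
  rw [hst'] at h1
  linarith

/-- The lift of the boundary map to the universal cover. -/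
theorem exists_lift (hg : DiskMonotone g) : ∃ ψ : ℝ → ℝ, Continuous ψ ∧
    (∀ θ : ℝ, g (Complex.exp (θ * Complex.I)) = Complex.exp (ψ θ * Complex.I)) ∧
    ∃ d : ℤ, ∀ θ, ψ (θ + 2 * Real.pi) = ψ θ + 2 * Real.pi * d := by
  have h1 : ∀ θ : ℝ, ‖g (Complex.exp (θ * Complex.I))‖ = 1 := fun θ =>
    hg.norm_eq_one (Complex.norm_exp_ofReal_mul_I θ)
  obtain ⟨L, hL, hLg⟩ := exists_continuous_log
    (g := fun θ : ℝ => g (Complex.exp (θ * Complex.I))) (hg.continuous.comp (by fun_prop))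
    (fun θ => by rw [← norm_ne_zero_iff, h1]; exact one_ne_zero)
  have hre : ∀ θ, (L θ).re = 0 := by
    intro θ
    have := h1 θ
    rw [← hLg, Complex.norm_exp] at this
    simpa using this
  have hψ : ∀ θ, L θ = (L θ).im * Complex.I := fun θ => Complex.ext (by simp [hre]) (by simp)
  refine ⟨fun θ => (L θ).im, Complex.continuous_im.comp hL, fun θ => ?_, ?_⟩
  · rw [← hLg, ← hψ θ]
  · have hper : ∀ θ : ℝ, Complex.exp (L (θ + 2 * Real.pi) - L θ) = 1 := by
      intro θ
      rw [Complex.exp_sub, hLg, hLg]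
      have : Complex.exp (((θ + 2 * Real.pi : ℝ) : ℂ) * Complex.I) =
          Complex.exp (θ * Complex.I) := by
        push_cast
        rw [add_mul, Complex.exp_add, Complex.exp_two_pi_mul_I, mul_one]
      rw [this, div_self]
      rw [← norm_ne_zero_iff, h1]; exact one_ne_zero
    obtain ⟨d, hd⟩ := Complex.exp_eq_one_iff.1 (hper 0)
    refine ⟨d, fun θ => ?_⟩
    have hconst := isPreconnected_univ.eq_of_exp_eq_one (s := (univ : Set ℝ))
      (f := fun θ => L (θ + 2 * Real.pi) - L θ) (by fun_prop) (fun θ _ => hper θ)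
      (mem_univ θ) (mem_univ 0)
    rw [hd] at hconst
    have := congrArg Complex.im hconst
    simp at this
    linarith

/-- A boundary fibre contains one of the two arcs between any two of its points. -/
theorem const_or_const (hg : DiskMonotone g) {ψ : ℝ → ℝ} (hψ : Continuous ψ)
    (hψg : ∀ θ : ℝ, g (Complex.exp (θ * Complex.I)) = Complex.exp (ψ θ * Complex.I))
    {a c : ℝ} (hac : a < c)
    (hca : c < a + 2 * Real.pi) {k : ℤ} (heq : ψ c = ψ a + 2 * Real.pi * k) :
    (∀ x ∈ Icc a c, ψ x = ψ a) ∨ (∀ x ∈ Icc c (a + 2 * Real.pi), ψ x = ψ c) := by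
  have hexp : ∀ x y : ℝ, g (Complex.exp (x * Complex.I)) = g (Complex.exp (y * Complex.I)) ↔
      Complex.exp ((ψ x - ψ y) * Complex.I) = 1 := by
    intro x y
    rw [hψg, hψg, sub_mul, Complex.exp_sub, div_eq_one_iff_eq (Complex.exp_ne_zero _)]
  have hac' : g (Complex.exp (a * Complex.I)) = g (Complex.exp (c * Complex.I)) := by
    rw [hψg, hψg, heq]
    push_cast
    rw [add_mul, Complex.exp_add, Complex.exp_eq_one_iff (x := 2 * Real.pi * k * Complex.I) |>.2
      ⟨k, by ring⟩, mul_one]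
  have hconst : ∀ x y : ℝ, x ≤ y → (∀ z ∈ Ioo x y, g (Complex.exp (z * Complex.I)) =
      g (Complex.exp (x * Complex.I))) → g (Complex.exp (y * Complex.I)) =
      g (Complex.exp (x * Complex.I)) → ∀ z ∈ Icc x y, ψ z = ψ x := by
    intro x y hxy hIoo hy z hz
    have h1 := isPreconnected_Icc.eq_of_exp_eq_one (s := Icc x y)
      (f := fun z => ((ψ z : ℂ) - ψ x) * Complex.I) (by fun_prop) (fun z hz => by
        rw [← hexp]
        rcases eq_or_lt_of_le hz.1 with h | h
        · rw [h]
        · rcases eq_or_lt_of_le hz.2 with h' | h'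
          · rw [h', hy]
          · exact hIoo z ⟨h, h'⟩) hz (left_mem_Icc.2 hxy)
    simp only [sub_self, zero_mul, mul_eq_zero, Complex.I_ne_zero, or_false, sub_eq_zero] at h1
    exact_mod_cast h1
  have hper : g (Complex.exp (((a + 2 * Real.pi : ℝ) : ℂ) * Complex.I)) =
      g (Complex.exp (a * Complex.I)) := by
    congr 1
    push_cast
    rw [add_mul, Complex.exp_add, Complex.exp_two_pi_mul_I, mul_one]
  by_cases h : ∀ z ∈ Ioo a c, g (Complex.exp (z * Complex.I)) = g (Complex.exp (a * Complex.I))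
  · exact Or.inl (hconst a c hac.le h hac'.symm)
  · push Not at h
    obtain ⟨b, hb, hbne⟩ := h
    refine Or.inr (hconst c (a + 2 * Real.pi) hca.le (fun z hz => ?_) (by rw [hper, hac']))
    rw [← hac']
    exact (hg.eq_or_eq_of_interlaced hb.1 hb.2 hz.1 hz.2 hac').resolve_left hbne

theorem degree_ne_zero (hg : DiskMonotone g) {ψ : ℝ → ℝ} (hψ : Continuous ψ)
    (hψg : ∀ θ : ℝ, g (Complex.exp (θ * Complex.I)) = Complex.exp (ψ θ * Complex.I))
    {d : ℤ} (hd : ∀ θ, ψ (θ + 2 * Real.pi) = ψ θ + 2 * Real.pi * d) : d ≠ 0 := by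
  rintro rfl
  have hπ := Real.pi_pos
  have hper : Function.Periodic ψ (2 * Real.pi) := fun x => by simpa using hd x
  have hnc : ∃ x : ℝ, ψ x ≠ ψ 0 := by
    by_contra hcon
    push Not at hcon
    obtain ⟨x, hx, hne⟩ := hg.exists_ne_on_circle (Complex.exp (ψ 0 * Complex.I))
    apply hne
    have : x = Complex.exp (x.arg * Complex.I) := by
      have := Complex.norm_mul_exp_arg_mul_I x
      rw [hx] at this
      simpa using this.symm
    rw [this, hψg, hcon]
  obtain ⟨m, -, hm⟩ := isCompact_Icc.exists_isMinOn (nonempty_Icc.2 (by positivity :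
    (0 : ℝ) ≤ 2 * Real.pi)) hψ.continuousOn
  have hmin : ∀ x, ψ m ≤ ψ x := by
    intro x
    obtain ⟨y, hy, hxy⟩ := hper.exists_mem_Ico₀ (by positivity) x
    rw [hxy]
    exact hm ⟨hy.1, hy.2.le⟩
  obtain ⟨M, hMI, hM⟩ := isCompact_Icc.exists_isMaxOn (nonempty_Icc.2 (by linarith :
    m ≤ m + 2 * Real.pi)) hψ.continuousOn
  have hmax : ∀ x, ψ x ≤ ψ M := by
    intro x
    obtain ⟨y, hy, hxy⟩ := hper.exists_mem_Ico (by positivity : 0 < 2 * Real.pi) x m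
    rw [hxy]
    exact hM ⟨hy.1, hy.2.le⟩
  have hlt : ψ m < ψ M := by
    obtain ⟨x, hx⟩ := hnc
    rcases lt_or_gt_of_ne hx with h | h
    · exact (hmin x).trans_lt (h.trans_le (hmax 0))
    · exact (hmin 0).trans_lt (h.trans_le (hmax x))
  set c := (ψ m + ψ M) / 2 with hc
  have hcm : ψ m < c := by linarith
  have hcM : c < ψ M := by linarith
  obtain ⟨a, ha, hac⟩ := intermediate_value_Icc hMI.1 hψ.continuousOn ⟨hcm.le, hcM.le⟩
  have hm2 : ψ (m + 2 * Real.pi) = ψ m := hper m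
  obtain ⟨b, hb, hbc⟩ := intermediate_value_Icc' hMI.2 hψ.continuousOn
    (show c ∈ Icc (ψ (m + 2 * Real.pi)) (ψ M) from ⟨by rw [hm2]; exact hcm.le, hcM.le⟩)
  have ham : m < a := lt_of_le_of_ne ha.1 (by rintro rfl; exact hcm.ne hac)
  have haM : a < M := lt_of_le_of_ne ha.2 (by rintro rfl; exact hcM.ne' hac)
  have hMb : M < b := lt_of_le_of_ne hb.1 (by rintro rfl; exact hcM.ne' hbc)
  rcases hg.const_or_const hψ hψg (a := a) (c := b) (k := 0) (by linarith) (by linarith [hb.2])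
    (by rw [hac, hbc]; simp) with h | h
  · have := h M ⟨haM.le, hMb.le⟩
    linarith
  · have := h (m + 2 * Real.pi) ⟨hb.2, by linarith⟩
    linarith

theorem monotone_of_degree_pos (hg : DiskMonotone g) {ψ : ℝ → ℝ} (hψ : Continuous ψ)
    (hψg : ∀ θ : ℝ, g (Complex.exp (θ * Complex.I)) = Complex.exp (ψ θ * Complex.I))
    {d : ℤ} (hd : ∀ θ, ψ (θ + 2 * Real.pi) = ψ θ + 2 * Real.pi * d) (hd0 : 0 < d) :
    Monotone ψ ∧ d = 1 := by
  have hπ := Real.pi_pos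
  have hd1 : (1 : ℝ) ≤ d := by exact_mod_cast hd0
  have hpos : ∀ x, ψ x + 2 * Real.pi ≤ ψ (x + 2 * Real.pi) := fun x => by
    rw [hd x]; nlinarith
  have key : ∀ a b, a ≤ b → b < a + 2 * Real.pi → ψ a ≤ ψ b := by
    intro a b hab hba
    by_contra hlt
    push Not at hlt
    have h2 := hpos a
    obtain ⟨e, he, hea⟩ := intermediate_value_Icc hba.le hψ.continuousOn
      (show ψ a ∈ Icc (ψ b) (ψ (a + 2 * Real.pi)) from ⟨hlt.le, by linarith⟩)
    have hab' : a < b := lt_of_le_of_ne hab (by rintro rfl; exact lt_irrefl _ hlt)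
    have hea' : e < a + 2 * Real.pi := lt_of_le_of_ne he.2 (by rintro rfl; linarith)
    rcases hg.const_or_const hψ hψg (a := a) (c := e) (k := 0) (by linarith [he.1]) hea'
      (by rw [hea]; simp) with h | h
    · have := h b ⟨hab, he.1⟩
      linarith
    · have := h (a + 2 * Real.pi) ⟨hea'.le, le_rfl⟩
      linarith
  have hnat : ∀ (n : ℕ) x, ψ x ≤ ψ (x + n * (2 * Real.pi)) := by
    intro n
    induction n with
    | zero => intro x; simp
    | succ n ih =>
      intro x
      have e : x + ((n + 1 : ℕ) : ℝ) * (2 * Real.pi) = x + n * (2 * Real.pi) + 2 * Real.pi := by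
        push_cast; ring
      rw [e]
      linarith [ih x, hpos (x + n * (2 * Real.pi))]
  refine ⟨fun a b hab => ?_, ?_⟩
  · set n := ⌊(b - a) / (2 * Real.pi)⌋₊ with hn
    have h1 : (n : ℝ) * (2 * Real.pi) ≤ b - a := by
      rw [← le_div_iff₀ (by positivity)]
      exact Nat.floor_le (div_nonneg (by linarith) (by positivity))
    have h2 : b - a < (n + 1) * (2 * Real.pi) := by
      rw [← div_lt_iff₀ (by positivity)]
      exact Nat.lt_floor_add_one _
    exact (hnat n a).trans (key _ _ (by linarith) (by linarith))
  · by_contra hne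
    have hd2 : (2 : ℝ) ≤ d := by
      have : 2 ≤ d := by omega
      exact_mod_cast this
    have h2 : ψ (0 + 2 * Real.pi) = ψ 0 + 2 * Real.pi * d := hd 0
    obtain ⟨e, he, hea⟩ := intermediate_value_Icc (by linarith : (0 : ℝ) ≤ 0 + 2 * Real.pi)
      hψ.continuousOn (show ψ 0 + 2 * Real.pi ∈ _ from ⟨by linarith, by rw [h2]; nlinarith⟩)
    have he0 : 0 < e := lt_of_le_of_ne he.1 (by rintro rfl; linarith)
    have he2 : e < 0 + 2 * Real.pi := lt_of_le_of_ne he.2 (by rintro rfl; nlinarith)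
    rcases hg.const_or_const hψ hψg (a := 0) (c := e) (k := 1) he0 he2
      (by rw [hea]; simp) with h | h
    · have := h e ⟨he0.le, le_rfl⟩
      linarith
    · have := h (0 + 2 * Real.pi) ⟨he2.le, le_rfl⟩
      nlinarith

/-- A lift of the boundary map that is monotone of degree one. -/
def MonotoneLift (g : ℂ → ℂ) (ψ : ℝ → ℝ) : Prop :=
  Continuous ψ ∧ Monotone ψ ∧ (∀ θ, ψ (θ + 2 * Real.pi) = ψ θ + 2 * Real.pi) ∧
    ∀ θ : ℝ, g (Complex.exp (θ * Complex.I)) = Complex.exp (ψ θ * Complex.I)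

/-- Up to a reflection, the boundary map of a monotone map is monotone of degree one. -/
theorem exists_monotoneLift (hg : DiskMonotone g) :
    (∃ ψ, MonotoneLift g ψ) ∨ ∃ ψ, MonotoneLift (fun x => (starRingEnd ℂ) (g x)) ψ := by
  obtain ⟨ψ, hψ, hψg, d, hd⟩ := hg.exists_lift
  rcases lt_or_gt_of_ne (hg.degree_ne_zero hψ hψg hd) with h | h
  · refine Or.inr ⟨fun θ => -ψ θ, ?_⟩
    have hψg' : ∀ θ : ℝ, (starRingEnd ℂ) (g (Complex.exp (θ * Complex.I))) =
        Complex.exp (((-ψ θ : ℝ) : ℂ) * Complex.I) := by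
      intro θ
      rw [hψg, ← Complex.exp_conj]; simp
    have hd' : ∀ θ, -ψ (θ + 2 * Real.pi) = -ψ θ + 2 * Real.pi * (-d : ℤ) := fun θ => by
      rw [hd]; push_cast; ring
    obtain ⟨h1, h2⟩ := hg.star.monotone_of_degree_pos hψ.neg hψg' hd' (by omega)
    exact ⟨hψ.neg, h1, fun θ => by have := hd' θ; rw [h2] at this; simpa using this, hψg'⟩
  · obtain ⟨h1, h2⟩ := hg.monotone_of_degree_pos hψ hψg hd h
    subst h2
    exact Or.inl ⟨ψ, hψ, h1, fun θ => by simpa using hd θ, hψg⟩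

end DiskMonotone

/-! ### The triangular lattice and sign changes around its vertices -/

/-- The six directions of the triangulated square lattice, in counterclockwise order. -/
def latticeDir : Fin 6 → ℤ × ℤ := ![(1, 0), (1, 1), (0, 1), (-1, 0), (-1, -1), (0, -1)]

theorem latticeDir_add_two (k : Fin 6) :
    latticeDir k + latticeDir (k + 2) = latticeDir (k + 1) := by
  revert k; decide

theorem latticeDir_add_three (k : Fin 6) : latticeDir (k + 3) = -latticeDir k := by
  revert k; decide

theorem triangle_vertices (v : ℤ × ℤ) (k : Fin 6) :
    v + latticeDir k + latticeDir (k + 2) = v + latticeDir (k + 1) ∧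
      v + latticeDir k + latticeDir (k + 2 + 1) = v ∧
      v + latticeDir (k + 1) + latticeDir (k + 4) = v ∧
      v + latticeDir (k + 1) + latticeDir (k + 4 + 1) = v + latticeDir k := by
  have h : ∀ k : Fin 6, latticeDir k + latticeDir (k + 2 + 1) = 0 ∧
      latticeDir (k + 1) + latticeDir (k + 4) = 0 ∧
      latticeDir (k + 1) + latticeDir (k + 4 + 1) = latticeDir k := by decide
  obtain ⟨h1, h2, h3⟩ := h k
  simp only [add_assoc v, latticeDir_add_two, h1, h2, h3, add_zero, and_self]

/-- Indicator of the vertex `v` having the middle value of `u` in its `k`-th triangle. -/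
noncomputable def turn (u : ℤ × ℤ → ℝ) (v : ℤ × ℤ) (k : Fin 6) : ℤ :=
  if (u (v + latticeDir k) - u v) * (u (v + latticeDir (k + 1)) - u v) < 0 then 1 else 0

theorem middle_count {a b c : ℝ} (hab : a ≠ b) (hbc : b ≠ c) (hca : c ≠ a) :
    (if (b - a) * (c - a) < 0 then (1 : ℤ) else 0) + (if (c - b) * (a - b) < 0 then 1 else 0) +
      (if (a - c) * (b - c) < 0 then 1 else 0) = 1 := by
  simp only [mul_neg_iff, sub_pos, sub_neg]
  grind

/-- Vertices around which a function takes differing values on the ends of each edge. -/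
def EdgeGeneric (u : ℤ × ℤ → ℝ) : Prop := ∀ v k, u (v + latticeDir k) ≠ u v

theorem EdgeGeneric.turn_triangle {u : ℤ × ℤ → ℝ} (hu : EdgeGeneric u) (v : ℤ × ℤ) (k : Fin 6) :
    turn u v k + turn u (v + latticeDir k) (k + 2) + turn u (v + latticeDir (k + 1)) (k + 4) =
      1 := by
  obtain ⟨e1, e2, e3, e4⟩ := triangle_vertices v k
  rw [turn, turn, turn, e1, e2, e3, e4]
  refine middle_count (hu v k).symm ?_ (hu v (k + 1))
  have := hu (v + latticeDir k) (k + 2)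
  rw [e1] at this
  exact this.symm

theorem finite_support_turn_sub {u u' : ℤ × ℤ → ℝ} {F : Set (ℤ × ℤ)} (hF : F.Finite)
    (h : ∀ v ∉ F, u v = u' v) (k : Fin 6) : (fun v => turn u v k - turn u' v k).support.Finite := by
  have h1 : ∀ w : ℤ × ℤ, ((fun v => v + w) ⁻¹' F).Finite := fun w =>
    hF.preimage (add_left_injective w).injOn
  refine ((hF.union (h1 (latticeDir k))).union (h1 (latticeDir (k + 1)))).subset fun v hv => ?_
  by_contra hcon
  simp only [mem_union, mem_preimage, not_or] at hcon
  apply hv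
  simp only [turn, h _ hcon.1.1, h _ hcon.1.2, h _ hcon.2, sub_self]

theorem finsum_turn_sub {u u' : ℤ × ℤ → ℝ} (hu : EdgeGeneric u) (hu' : EdgeGeneric u')
    {F : Set (ℤ × ℤ)} (hF : F.Finite) (h : ∀ v ∉ F, u v = u' v) :
    ∑ᶠ v, ∑ k, (turn u v k - turn u' v k) = 0 := by
  have hfin := finite_support_turn_sub hF h
  have hshift : ∀ (w : ℤ × ℤ) (k : Fin 6), ∑ᶠ v, (turn u (v + w) k - turn u' (v + w) k) =
      ∑ᶠ v, (turn u v k - turn u' v k) := fun w k =>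
    finsum_comp_equiv (Equiv.addRight w) (f := fun v => turn u v k - turn u' v k)
  have hfin' : ∀ (w : ℤ × ℤ) (k : Fin 6),
      (fun v => turn u (v + w) k - turn u' (v + w) k).support.Finite := fun w k =>
    ((hfin k).preimage (add_left_injective w).injOn)
  have htri : ∀ k : Fin 6, ∑ᶠ v, (turn u v k - turn u' v k) +
      ∑ᶠ v, (turn u v (k + 2) - turn u' v (k + 2)) +
      ∑ᶠ v, (turn u v (k + 4) - turn u' v (k + 4)) = 0 := by
    intro k
    rw [← hshift (latticeDir k) (k + 2), ← hshift (latticeDir (k + 1)) (k + 4),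
      ← finsum_add_distrib (hfin k) (hfin' _ _), ← finsum_add_distrib _ (hfin' _ _)]
    · rw [← finsum_zero (α := ℤ × ℤ)]
      refine finsum_congr fun v => ?_
      have h1 := hu.turn_triangle v k
      have h2 := hu'.turn_triangle v k
      linarith
    · exact ((hfin k).union (hfin' _ _)).subset (Function.support_add _ _)
  rw [finsum_sum_comm _ _ fun k _ => hfin k, Fin.sum_univ_six]
  have h0 := htri 0
  have h1 := htri 1
  simp only [Fin.isValue, zero_add, Fin.reduceAdd] at h0 h1
  linarith

theorem two_le_sign_changes : ∀ s : Fin 6 → Bool, (∃ k l, s k ≠ s l) →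
    2 ≤ ∑ k, if s k = s (k + 1) then (0 : ℤ) else 1 := by decide

theorem sign_changes_eq_two : ∀ s : Fin 6 → Bool, (∀ k, s (k + 3) = !s k) →
    (∀ k, s k = s (k + 2) → s (k + 1) = s k) →
    ∑ k, (if s k = s (k + 1) then (0 : ℤ) else 1) = 2 := by decide

theorem eq_of_sign_changes_eq_two : ∀ s : Fin 6 → Bool,
    ∑ k, (if s k = s (k + 1) then (0 : ℤ) else 1) = 2 → ∀ k, s k ≠ s (k + 1) →
    s (k + 1) ≠ s (k + 2) → ∀ l, l ≠ k + 1 → s l = s k := by decide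

theorem exists_rising_sign : ∀ s : Fin 6 → Bool, (∃ k l, s k ≠ s l) →
    ∃ k, s k = false ∧ s (k + 1) = true := by decide

theorem EdgeGeneric.turn_eq {u : ℤ × ℤ → ℝ} (hu : EdgeGeneric u) (v : ℤ × ℤ) (k : Fin 6) :
    turn u v k = if decide (0 < u (v + latticeDir k) - u v) =
      decide (0 < u (v + latticeDir (k + 1)) - u v) then 0 else 1 := by
  have h1 := sub_ne_zero.2 (hu v k)
  have h2 := sub_ne_zero.2 (hu v (k + 1))
  rw [turn]
  rcases h1.lt_or_gt with h1 | h1 <;> rcases h2.lt_or_gt with h2 | h2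
  · simp [h1.not_gt, h2.not_gt, (mul_pos_of_neg_of_neg h1 h2).not_gt]
  · simp [h1.not_gt, h2, mul_neg_of_neg_of_pos h1 h2]
  · simp [h1, h2.not_gt, mul_neg_of_pos_of_neg h1 h2]
  · simp [h1, h2, (mul_pos h1 h2).not_gt]

/-- If `u` agrees with the linear function `u'` off a finite set and `u` has no local extremum,
then `u` changes sign exactly twice around each vertex. -/
theorem sum_turn_eq_two {u u' : ℤ × ℤ → ℝ} (hu : EdgeGeneric u) (hu' : EdgeGeneric u')
    {F : Set (ℤ × ℤ)} (hF : F.Finite) (h : ∀ v ∉ F, u v = u' v)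
    (hadd : ∀ v w, u' (v + w) = u' v + u' w)
    (hext : ∀ v, ∃ k l, u (v + latticeDir k) < u v ∧ u v < u (v + latticeDir l)) (v : ℤ × ℤ) :
    ∑ k, turn u v k = 2 := by
  have h2 : ∀ v, ∑ k, turn u' v k = 2 := by
    intro v
    have hd : ∀ k, u' (v + latticeDir k) - u' v = u' (latticeDir k) := fun k => by rw [hadd]; ring
    have h0 : u' 0 = 0 := by simpa using hadd 0 0
    have hne : ∀ k, u' (latticeDir k) ≠ 0 := fun k => by rw [← hd k]; exact sub_ne_zero.2 (hu' v k)
    simp only [hu'.turn_eq, hd]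
    refine sign_changes_eq_two (fun k => decide (0 < u' (latticeDir k))) (fun k => ?_)
      fun k hk => ?_
    · have : u' (latticeDir (k + 3)) = -u' (latticeDir k) := by
        have := hadd (latticeDir k) (-latticeDir k)
        rw [add_neg_cancel, h0] at this
        rw [latticeDir_add_three]; linarith
      rcases (hne k).lt_or_gt with h | h <;> simp [this, h, h.not_gt]
    · have : u' (latticeDir (k + 1)) = u' (latticeDir k) + u' (latticeDir (k + 2)) := by
        rw [← latticeDir_add_two, hadd]
      rcases (hne k).lt_or_gt with h1 | h1 <;> rcases (hne (k + 2)).lt_or_gt with h2 | h2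
      · rw [this]; simp [h1.not_gt, (add_neg h1 h2).not_gt]
      · simp [h1.not_gt, h2] at hk
      · simp [h1, h2.not_gt] at hk
      · rw [this]; simp [h1, add_pos h1 h2]
  have h3 : ∀ v, 0 ≤ ∑ k, (turn u v k - turn u' v k) := by
    intro v
    rw [Finset.sum_sub_distrib, h2]
    simp only [hu.turn_eq]
    obtain ⟨k, l, hk, hl⟩ := hext v
    have := two_le_sign_changes (fun k => decide (0 < u (v + latticeDir k) - u v))
      ⟨k, l, by simp [hl, hk.not_gt]⟩
    linarith
  have h4 : ∑ k, (turn u v k - turn u' v k) ≤ ∑ᶠ v, ∑ k, (turn u v k - turn u' v k) := by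
    refine single_le_finsum v ?_ h3
    refine (finite_iUnion fun k => finite_support_turn_sub hF h k).subset fun w hw => ?_
    by_contra hcon
    simp only [mem_iUnion, not_exists, Function.mem_support, not_not] at hcon
    exact hw (Finset.sum_eq_zero fun k _ => hcon k)
  rw [finsum_turn_sub hu hu' hF h] at h4
  have h5 := le_antisymm h4 (h3 v)
  rw [Finset.sum_sub_distrib, h2] at h5
  linarith

/-! ### Orientation of the triangles of a Tutte map -/

/-- The determinant of two plane vectors. -/
def cross (a b : ℂ) : ℝ := a.re * b.im - a.im * b.re

/-- The lattice point with given integer coordinates. -/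
def latticePt (v : ℤ × ℤ) : ℂ := ⟨v.1, v.2⟩

@[simp] theorem latticePt_re (v : ℤ × ℤ) : (latticePt v).re = v.1 := rfl

@[simp] theorem latticePt_im (v : ℤ × ℤ) : (latticePt v).im = v.2 := rfl

theorem latticePt_add (v w : ℤ × ℤ) : latticePt (v + w) = latticePt v + latticePt w := by
  apply Complex.ext <;> simp

/-- The lattice points inside the open box of half-width `N`. -/
def latticeBox (N : ℕ) : Set (ℤ × ℤ) := {v | |v.1| < N ∧ |v.2| < N}

theorem mem_latticeBox {N : ℕ} {v : ℤ × ℤ} : v ∈ latticeBox N ↔ |v.1| < N ∧ |v.2| < N := Iff.rfl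

theorem finite_latticeBox (N : ℕ) : (latticeBox N).Finite := by
  refine ((finite_Icc (-(N : ℤ)) N).prod (finite_Icc (-(N : ℤ)) N)).subset fun v hv => ?_
  rw [mem_latticeBox, abs_lt, abs_lt] at hv
  simp only [mem_prod, mem_Icc]
  omega

theorem exists_pos_lt_forall_ne_zero {ι : Type*} [Countable ι] (a b : ι → ℝ)
    (h : ∀ i, a i ≠ 0 ∨ b i ≠ 0) {η : ℝ} (hη : 0 < η) :
    ∃ δ, 0 < δ ∧ δ < η ∧ ∀ i, a i + δ * b i ≠ 0 := by
  have hc : (⋃ i, {δ : ℝ | a i + δ * b i = 0}).Countable := by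
    refine countable_iUnion fun i => ?_
    refine Set.Subsingleton.countable fun x hx y hy => ?_
    rw [mem_ofPred_eq] at hx hy
    have hb : b i ≠ 0 := by
      intro hb
      rw [hb, mul_zero, add_zero] at hx
      exact (h i).elim (fun h => h hx) fun h => h hb
    exact mul_right_cancel₀ hb (by linarith)
  obtain ⟨δ, hδ, hδ'⟩ := (hc.dense_compl ℝ).exists_between hη
  refine ⟨δ, hδ'.1, hδ'.2, fun i hi => hδ ?_⟩
  exact mem_iUnion.2 ⟨i, hi⟩

/-- A map of the lattice, pinned outside a box, each inner vertex being a strictly convex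
combination of its neighbours, with nondegenerate image triangles. -/
structure TutteMap (N : ℕ) (φ : ℤ × ℤ → ℂ) : Prop where
  outside : ∀ v ∉ latticeBox N, φ v = latticePt v
  balanced : ∀ v ∈ latticeBox N, ∃ w : Fin 6 → ℝ, (∀ k, 0 < w k) ∧
    ∑ k, (w k : ℂ) * (φ (v + latticeDir k) - φ v) = 0
  nondegenerate : ∀ v k, cross (φ (v + latticeDir k) - φ v) (φ (v + latticeDir (k + 1)) - φ v) ≠ 0
  neg_le_im : ∀ v, v ∈ latticeBox N → -(N : ℝ) ≤ (φ v).im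

namespace TutteMap

variable {N : ℕ} {φ : ℤ × ℤ → ℂ}

theorem sum_cross (w : Fin 6 → ℝ) (d : Fin 6 → ℂ) (hw : ∑ k, (w k : ℂ) * d k = 0) (c : ℂ) :
    ∑ k, w k * cross c (d k) = 0 := by
  have h1 := congrArg Complex.re hw
  have h2 := congrArg Complex.im hw
  simp only [Complex.re_sum, Complex.im_sum, Complex.mul_re, Complex.mul_im, Complex.ofReal_re,
    Complex.ofReal_im, zero_mul, sub_zero, add_zero, Complex.zero_re, Complex.zero_im] at h1 h2
  have : ∑ k, w k * cross c (d k) = c.re * ∑ k, w k * (d k).im - c.im * ∑ k, w k * (d k).re := by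
    rw [Finset.mul_sum, Finset.mul_sum, ← Finset.sum_sub_distrib]
    exact Finset.sum_congr rfl fun k _ => by rw [cross]; ring
  rw [this, h1, h2]
  ring

theorem cross_sub (c a b : ℂ) : cross c (a - b) = cross c a - cross c b := by
  simp only [cross, Complex.sub_re, Complex.sub_im]; ring

theorem cross_add (c a b : ℂ) : cross c (a + b) = cross c a + cross c b := by
  simp only [cross, Complex.add_re, Complex.add_im]; ring

theorem exists_cross_neg_pos (hφ : TutteMap N φ) {c : ℂ}
    (hc : ∀ v k, cross c (φ (v + latticeDir k) - φ v) ≠ 0) (v : ℤ × ℤ) :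
    ∃ k l, cross c (φ (v + latticeDir k) - φ v) < 0 ∧ 0 < cross c (φ (v + latticeDir l) - φ v) := by
  by_cases hv : v ∈ latticeBox N
  · obtain ⟨w, hw, hsum⟩ := hφ.balanced v hv
    have h := sum_cross w _ hsum c
    by_contra hcon
    push Not at hcon
    have hdich : (∀ k, 0 < w k * cross c (φ (v + latticeDir k) - φ v)) ∨
        ∀ k, w k * cross c (φ (v + latticeDir k) - φ v) < 0 := by
      rcases (hc v 0).lt_or_gt with h0 | h0
      · exact Or.inr fun k => mul_neg_of_pos_of_neg (hw k) ((hcon 0 k h0).lt_of_ne (hc v k))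
      · refine Or.inl fun k => mul_pos (hw k) ?_
        by_contra hk
        exact (hcon k 0 ((not_lt.1 hk).lt_of_ne (hc v k))).not_gt h0
    rcases hdich with h' | h'
    · exact (Finset.sum_pos (fun k _ => h' k) ⟨0, Finset.mem_univ 0⟩).ne' h
    · have := Finset.sum_pos (fun k _ => neg_pos.2 (h' k)) ⟨(0 : Fin 6), Finset.mem_univ 0⟩
      rw [Finset.sum_neg_distrib, h] at this
      simp at this
  · have hopp : ∃ k : Fin 6, v + latticeDir k ∉ latticeBox N ∧
        v + latticeDir (k + 3) ∉ latticeBox N := by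
      rw [mem_latticeBox, not_and_or] at hv
      rcases hv with h | h
      · refine ⟨2, ?_, ?_⟩ <;> rw [mem_latticeBox] <;>
          simp only [latticeDir, Prod.fst_add] <;> simp <;> intro h' <;> exact absurd h' h
      · refine ⟨0, ?_, ?_⟩ <;> rw [mem_latticeBox] <;>
          simp only [latticeDir, Prod.snd_add] <;> simp <;> intro _ <;> exact not_lt.1 h
    obtain ⟨k, h1, h2⟩ := hopp
    have e : φ (v + latticeDir (k + 3)) - φ v = -(φ (v + latticeDir k) - φ v) := by
      rw [hφ.outside _ h1, hφ.outside _ h2, hφ.outside v hv, latticeDir_add_three,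
        latticePt_add, latticePt_add]
      have : latticePt (-latticeDir k) = -latticePt (latticeDir k) := by
        apply Complex.ext <;> simp
      rw [this]; ring
    have e' : cross c (φ (v + latticeDir (k + 3)) - φ v) =
        -cross c (φ (v + latticeDir k) - φ v) := by
      rw [e]; simp only [cross, Complex.neg_re, Complex.neg_im]; ring
    rcases (hc v k).lt_or_gt with h | h
    · exact ⟨k, k + 3, h, by rw [e']; linarith⟩
    · exact ⟨k + 3, k, by rw [e']; linarith, h⟩

theorem sum_turn (hφ : TutteMap N φ) {c : ℂ}
    (hc : ∀ v k, cross c (φ (v + latticeDir k) - φ v) ≠ 0)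
    (hc' : ∀ k, cross c (latticePt (latticeDir k)) ≠ 0) (v : ℤ × ℤ) :
    ∑ k, turn (fun v => cross c (φ v)) v k = 2 := by
  refine sum_turn_eq_two (u' := fun v => cross c (latticePt v)) (fun v k h => hc v k ?_)
    (fun v k h => hc' k ?_) (finite_latticeBox N) (fun v hv => by rw [hφ.outside v hv])
    (fun v w => by rw [latticePt_add, cross_add]) (fun v => ?_) v
  · rw [cross_sub, h, sub_self]
  · have h : cross c (latticePt (v + latticeDir k)) = cross c (latticePt v) := h
    rw [latticePt_add, cross_add] at h; linarith
  · obtain ⟨k, l, h1, h2⟩ := hφ.exists_cross_neg_pos hc v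
    rw [cross_sub] at h1 h2
    exact ⟨k, l, by linarith, by linarith⟩

theorem sub_ne_zero (hφ : TutteMap N φ) (v : ℤ × ℤ) (k : Fin 6) :
    φ (v + latticeDir k) - φ v ≠ 0 := fun h => hφ.nondegenerate v k (by rw [h]; simp [cross])

theorem latticePt_latticeDir_ne_zero (k : Fin 6) : latticePt (latticeDir k) ≠ 0 := by
  have : ∀ k, latticeDir k ≠ 0 := by decide
  intro h
  apply this k
  have h1 := congrArg Complex.re h
  have h2 := congrArg Complex.im h
  simp only [latticePt_re, latticePt_im, Complex.zero_re, Complex.zero_im,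
    Int.cast_eq_zero] at h1 h2
  exact Prod.ext h1 h2

/-- Small perturbations of a nonzero functional which vanish on no edge. -/
theorem exists_generic (hφ : TutteMap N φ) {w : ℂ} (hw : w ≠ 0) (σ : ℝ) (hσ : σ ≠ 0) {η : ℝ}
    (hη : 0 < η) : ∃ δ, 0 < δ ∧ δ < η ∧
      (∀ v k, σ * cross w (φ (v + latticeDir k) - φ v) +
        δ * cross (Complex.I * w) (φ (v + latticeDir k) - φ v) ≠ 0) ∧
      ∀ k, σ * cross w (latticePt (latticeDir k)) +
        δ * cross (Complex.I * w) (latticePt (latticeDir k)) ≠ 0 := by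
  have key : ∀ e : ℂ, e ≠ 0 → σ * cross w e ≠ 0 ∨ cross (Complex.I * w) e ≠ 0 := by
    intro e he
    by_contra hcon
    push Not at hcon
    obtain ⟨h1, h2⟩ := hcon
    have h1 := (mul_eq_zero.1 h1).resolve_left hσ
    have h3 : (Complex.normSq w) * (Complex.normSq e) = (cross w e) ^ 2 +
        (cross (Complex.I * w) e) ^ 2 := by
      simp only [cross, Complex.normSq_apply, Complex.mul_re, Complex.mul_im, Complex.I_re,
        Complex.I_im]
      ring
    rw [h1, h2] at h3
    have := mul_pos (Complex.normSq_pos.2 hw) (Complex.normSq_pos.2 he)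
    simp at h3
    exact h3.elim hw he
  obtain ⟨δ, h1, h2, h3⟩ := exists_pos_lt_forall_ne_zero
    (fun i : ((ℤ × ℤ) × Fin 6) ⊕ Fin 6 => σ * cross w (Sum.elim
      (fun i => φ (i.1 + latticeDir i.2) - φ i.1) (fun k => latticePt (latticeDir k)) i))
    (fun i => cross (Complex.I * w) (Sum.elim
      (fun i => φ (i.1 + latticeDir i.2) - φ i.1) (fun k => latticePt (latticeDir k)) i))
    (fun i => key _ (by
      rcases i with i | i
      · exact hφ.sub_ne_zero _ _
      · exact latticePt_latticeDir_ne_zero _)) hη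
  exact ⟨δ, h1, h2, fun v k => h3 (Sum.inl (v, k)), fun k => h3 (Sum.inr k)⟩

theorem cross_swap (a b : ℂ) : cross a b = -cross b a := by
  simp only [cross]; ring

theorem cross_comb (σ δ : ℝ) (w x : ℂ) :
    cross (σ * w + δ * (Complex.I * w)) x = σ * cross w x + δ * cross (Complex.I * w) x := by
  simp only [cross, Complex.add_re, Complex.add_im, Complex.mul_re, Complex.mul_im,
    Complex.ofReal_re, Complex.ofReal_im, Complex.I_re, Complex.I_im]
  ring

/-- Consecutive triangles at an inner vertex are equally oriented. -/
theorem not_flip (hφ : TutteMap N φ) {v : ℤ × ℤ} (hv : v ∈ latticeBox N) (k : Fin 6) {σ : ℝ}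
    (hσ : σ ≠ 0)
    (h1 : 0 < σ * cross (φ (v + latticeDir (k + 1)) - φ v) (φ (v + latticeDir k) - φ v))
    (h2 : 0 < σ * cross (φ (v + latticeDir (k + 1)) - φ v) (φ (v + latticeDir (k + 2)) - φ v)) :
    False := by
  set d : Fin 6 → ℂ := fun k => φ (v + latticeDir k) - φ v with hd
  set w := d (k + 1) with hw
  have hw0 : w ≠ 0 := hφ.sub_ne_zero v _
  change 0 < σ * cross w (d k) at h1
  change 0 < σ * cross w (d (k + 2)) at h2
  have hsmall : ∀ x : ℂ, 0 < σ * cross w x → ∀ᶠ δ : ℝ in 𝓝 0,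
      0 < σ * cross w x + δ * cross (Complex.I * w) x := by
    intro x hx
    have : ContinuousAt (fun δ : ℝ => σ * cross w x + δ * cross (Complex.I * w) x) 0 := by fun_prop
    refine this.eventually (lt_mem_nhds ?_)
    simpa using hx
  have hww : cross w w = 0 := by simp only [cross]; ring
  have hneg : cross (Complex.I * w) w < 0 := by
    have : cross (Complex.I * w) w = -Complex.normSq w := by
      simp only [cross, Complex.normSq_apply, Complex.mul_re, Complex.mul_im, Complex.I_re,
        Complex.I_im]
      ring
    rw [this]
    linarith [Complex.normSq_pos.2 hw0]
  have hall : ∀ l, 0 ≤ σ * cross w (d l) := by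
    intro l
    by_contra hl
    push Not at hl
    have hl' : ∀ᶠ δ : ℝ in 𝓝 0, σ * cross w (d l) + δ * cross (Complex.I * w) (d l) < 0 := by
      have : ContinuousAt
        (fun δ : ℝ => σ * cross w (d l) + δ * cross (Complex.I * w) (d l)) 0 := by fun_prop
      refine this.eventually (gt_mem_nhds ?_)
      simpa using hl
    obtain ⟨η, hη, hη'⟩ := Metric.eventually_nhds_iff.1
      (((hsmall _ h1).and (hsmall _ h2)).and hl')
    obtain ⟨δ, hδ0, hδη, hg1, hg2⟩ := hφ.exists_generic hw0 σ hσ hη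
    obtain ⟨⟨hk, hk2⟩, hl2⟩ := hη' (y := δ) (by
      rw [Real.dist_eq, sub_zero, abs_of_pos hδ0]; exact hδη)
    have hturn := hφ.sum_turn (c := σ * w + δ * (Complex.I * w))
      (by simpa only [cross_comb] using hg1) (by simpa only [cross_comb] using hg2) v
    have hgen : EdgeGeneric (fun v => cross (σ * w + δ * (Complex.I * w)) (φ v)) := by
      intro v k h
      apply hg1 v k
      rw [← cross_comb, cross_sub]
      exact sub_eq_zero.2 h
    simp only [hgen.turn_eq] at hturn
    simp only [← cross_sub] at hturn
    simp only [cross_comb] at hturn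
    have hk1 : σ * cross w (d (k + 1)) + δ * cross (Complex.I * w) (d (k + 1)) < 0 := by
      rw [← hw, hww, mul_zero, zero_add]
      exact mul_neg_of_pos_of_neg hδ0 hneg
    have hne : l ≠ k + 1 := by
      rintro rfl
      rw [← hw, hww, mul_zero] at hl
      exact lt_irrefl _ hl
    have := eq_of_sign_changes_eq_two
      (fun k => decide (0 < σ * cross w (d k) + δ * cross (Complex.I * w) (d k))) hturn k
      (by simp [hk, hk1.not_gt]) (by simp [hk2, hk1.not_gt]) l hne
    simp [hk, hl2.not_gt] at this
  obtain ⟨w', hw', hsum⟩ := hφ.balanced v hv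
  have hzero := sum_cross w' _ hsum w
  have : 0 < ∑ l, w' l * (σ * cross w (d l)) :=
    Finset.sum_pos' (fun l _ => mul_nonneg (hw' l).le (hall l))
      ⟨k, Finset.mem_univ k, mul_pos (hw' k) h1⟩
  have h3 : ∑ l, w' l * (σ * cross w (d l)) = σ * ∑ l, w' l * cross w (d l) := by
    rw [Finset.mul_sum]
    exact Finset.sum_congr rfl fun l _ => by ring
  rw [h3, hzero, mul_zero] at this
  exact lt_irrefl _ this

/-- The signed area (doubled) of the `k`-th triangle at `v`. -/
def area (φ : ℤ × ℤ → ℂ) (v : ℤ × ℤ) (k : Fin 6) : ℝ :=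
  cross (φ (v + latticeDir k) - φ v) (φ (v + latticeDir (k + 1)) - φ v)

theorem area_rotate (φ : ℤ × ℤ → ℂ) (v : ℤ × ℤ) (k : Fin 6) :
    area φ (v + latticeDir k) (k + 2) = area φ v k := by
  obtain ⟨e1, e2, -, -⟩ := triangle_vertices v k
  rw [area, e1, e2, area]
  simp only [cross, Complex.sub_re, Complex.sub_im]
  ring

theorem area_succ_pos (hφ : TutteMap N φ) {v : ℤ × ℤ} (hv : v ∈ latticeBox N) {k : Fin 6}
    (h : 0 < area φ v k) : 0 < area φ v (k + 1) := by
  by_contra hcon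
  have h2 : area φ v (k + 1) < 0 := (not_lt.1 hcon).lt_of_ne (hφ.nondegenerate v (k + 1))
  refine hφ.not_flip hv k (σ := -1) (by norm_num) ?_ ?_
  · rw [cross_swap]
    unfold area at h
    linarith
  · unfold area at h2
    rw [show k + 1 + 1 = k + 2 by grind] at h2
    linarith

theorem area_pos_of_area_pos (hφ : TutteMap N φ) {v : ℤ × ℤ} (hv : v ∈ latticeBox N) {k : Fin 6}
    (h : 0 < area φ v k) (l : Fin 6) : 0 < area φ v l := by
  have h1 := hφ.area_succ_pos hv h
  have h2 := hφ.area_succ_pos hv h1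
  have h3 := hφ.area_succ_pos hv h2
  have h4 := hφ.area_succ_pos hv h3
  have h5 := hφ.area_succ_pos hv h4
  have key : ∀ k l : Fin 6, l = k ∨ l = k + 1 ∨ l = k + 1 + 1 ∨ l = k + 1 + 1 + 1 ∨
    l = k + 1 + 1 + 1 + 1 ∨ l = k + 1 + 1 + 1 + 1 + 1 := by decide
  rcases key k l with rfl | rfl | rfl | rfl | rfl | rfl <;> assumption

theorem area_pos_of_mem (hφ : TutteMap N φ) : ∀ (n : ℕ) (v : ℤ × ℤ), v ∈ latticeBox N →
    v.2 = -(N : ℤ) + 1 + n → ∀ k, 0 < area φ v k := by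
  intro n
  induction n with
  | zero =>
    intro v hv hn
    refine hφ.area_pos_of_area_pos hv (k := 4) (lt_of_le_of_ne ?_ (hφ.nondegenerate v 4).symm)
    have h1 : v + latticeDir 4 ∉ latticeBox N := by
      rw [mem_latticeBox, abs_lt, abs_lt]; simp [latticeDir]; omega
    have h2 : v + latticeDir (4 + 1) ∉ latticeBox N := by
      rw [mem_latticeBox, abs_lt, abs_lt]
      rw [show (4 + 1 : Fin 6) = 5 by decide]
      simp [latticeDir]; omega
    rw [area, hφ.outside _ h1, hφ.outside _ h2]
    have him := hφ.neg_le_im v hv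
    have hv2 : (v.2 : ℝ) = -N + 1 := by rw [hn]; push_cast; ring
    rw [show (4 + 1 : Fin 6) = 5 by decide]
    simp only [cross, latticePt_add, Complex.sub_re, Complex.sub_im, Complex.add_re,
      Complex.add_im, latticePt_re, latticePt_im, hv2]
    simp [latticeDir]
    nlinarith
  | succ n ih =>
    intro v hv hn
    have hv' : v + latticeDir 5 ∈ latticeBox N := by
      rw [mem_latticeBox, abs_lt, abs_lt] at hv ⊢
      simp [latticeDir]; push_cast at hn; omega
    have h := ih (v + latticeDir 5) hv' (by simp [latticeDir]; push_cast at hn; omega) 1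
    refine hφ.area_pos_of_area_pos hv (k := 5) ?_
    have := area_rotate φ v 5
    rw [show (5 + 2 : Fin 6) = 1 by decide] at this
    rwa [← this]

/-- All image triangles of a Tutte map are positively oriented. -/
theorem area_pos (hφ : TutteMap N φ) (v : ℤ × ℤ) (k : Fin 6) : 0 < area φ v k := by
  have hbox : ∀ v ∈ latticeBox N, ∀ k, 0 < area φ v k := fun v hv => by
    have h := hv
    rw [mem_latticeBox, abs_lt, abs_lt] at h
    exact hφ.area_pos_of_mem (v.2 + N - 1).toNat v hv (by omega)
  by_cases h0 : v ∈ latticeBox N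
  · exact hbox v h0 k
  by_cases h1 : v + latticeDir k ∈ latticeBox N
  · rw [← area_rotate]
    exact hbox _ h1 _
  by_cases h2 : v + latticeDir (k + 1) ∈ latticeBox N
  · rw [← area_rotate, ← area_rotate, (triangle_vertices v k).1]
    exact hbox _ h2 _
  · rw [area, hφ.outside _ h0, hφ.outside _ h1, hφ.outside _ h2, latticePt_add, latticePt_add,
      add_sub_cancel_left, add_sub_cancel_left]
    fin_cases k <;> simp [cross, latticeDir]

end TutteMap

/-! ### Piecewise linear extension of a Tutte map -/

/-- The point with affine coordinates `α, β` in the `k`-th image triangle at `v`. -/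
noncomputable def tri (φ : ℤ × ℤ → ℂ) (v : ℤ × ℤ) (k : Fin 6) (α β : ℝ) : ℂ :=
  φ v + α * (φ (v + latticeDir k) - φ v) + β * (φ (v + latticeDir (k + 1)) - φ v)

theorem tri_rotate (φ : ℤ × ℤ → ℂ) (v : ℤ × ℤ) (k : Fin 6) (α β : ℝ) :
    tri φ (v + latticeDir k) (k + 2) β (1 - α - β) = tri φ v k α β := by
  obtain ⟨e1, e2, -, -⟩ := triangle_vertices v k
  rw [tri, e1, e2, tri]
  push_cast
  ring

theorem tri_succ (φ : ℤ × ℤ → ℂ) (v : ℤ × ℤ) (k : Fin 6) (β : ℝ) :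
    tri φ v (k + 1) β 0 = tri φ v k 0 β := by
  simp [tri]

/-- Any triangle is of the first or second kind at one of its vertices. -/
theorem exists_tri_normal (v : ℤ × ℤ) (k : Fin 6) : ∃ v' k', (k' = 0 ∨ k' = 1) ∧
    ∀ α β : ℝ, 0 ≤ α → 0 ≤ β → α + β ≤ 1 → ∃ α' β' : ℝ, 0 ≤ α' ∧ 0 ≤ β' ∧ α' + β' ≤ 1 ∧
      (0 < α → 0 < β → α + β < 1 → 0 < α' ∧ 0 < β' ∧ α' + β' < 1) ∧
      ∀ φ, tri φ v' k' α' β' = tri φ v k α β := by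
  by_cases h0 : k = 0 ∨ k = 1
  · exact ⟨v, k, h0, fun α β h1 h2 h3 => ⟨α, β, h1, h2, h3, fun h1 h2 h3 => ⟨h1, h2, h3⟩,
      fun φ => rfl⟩⟩
  by_cases h4 : k + 2 = 0 ∨ k + 2 = 1
  · exact ⟨v + latticeDir k, k + 2, h4, fun α β h1 h2 h3 => ⟨β, 1 - α - β, h2, by linarith,
      by linarith, fun _ _ _ => ⟨by linarith, by linarith, by linarith⟩,
      fun φ => tri_rotate φ v k α β⟩⟩
  have h5 : k + 2 + 2 = 0 ∨ k + 2 + 2 = 1 := by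
    revert k; decide
  refine ⟨v + latticeDir k + latticeDir (k + 2), k + 2 + 2, h5, fun α β h1 h2 h3 =>
    ⟨1 - α - β, α, by linarith, by linarith, by linarith, fun _ _ _ =>
      ⟨by linarith, by linarith, by linarith⟩, fun φ => ?_⟩⟩
  rw [← tri_rotate φ v k α β, ← tri_rotate φ (v + latticeDir k) (k + 2) β (1 - α - β)]
  congr 1
  ring

/-- Any point of a triangle is a point off the far side of the same triangle. -/
theorem exists_tri_lt (v : ℤ × ℤ) (k : Fin 6) {α β : ℝ} (hα : 0 ≤ α) (hβ : 0 ≤ β)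
    (h : α + β ≤ 1) : ∃ v' k', ∃ α' β' : ℝ, 0 ≤ α' ∧ 0 ≤ β' ∧ α' + β' < 1 ∧
      ∀ φ, tri φ v' k' α' β' = tri φ v k α β := by
  rcases h.lt_or_eq with h | h
  · exact ⟨v, k, α, β, hα, hβ, h, fun φ => rfl⟩
  rcases hα.lt_or_eq with h1 | h1
  · exact ⟨v + latticeDir k, k + 2, β, 1 - α - β, hβ, by linarith, by linarith,
      fun φ => tri_rotate φ v k α β⟩
  · refine ⟨v + latticeDir k + latticeDir (k + 2), k + 2 + 2, 1 - α - β, 1 - β - (1 - α - β),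
      by linarith, by linarith, by linarith, fun φ => ?_⟩
    rw [tri_rotate, tri_rotate]

/-- Every point of the plane lies in some triangle of the lattice. -/
theorem exists_tri_latticePt (x : ℂ) : ∃ v k, ∃ α β : ℝ, 0 ≤ α ∧ 0 ≤ β ∧ α + β < 1 ∧
    (k = 0 ∨ k = 1) ∧ x = tri latticePt v k α β := by
  have h1 := Int.self_sub_floor x.re
  have h2 := Int.self_sub_floor x.im
  have h3 := Int.fract_nonneg x.re
  have h4 := Int.fract_nonneg x.im
  have h5 := Int.fract_lt_one x.re
  have h6 := Int.fract_lt_one x.im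
  rcases le_total (Int.fract x.im) (Int.fract x.re) with h | h
  · refine ⟨(⌊x.re⌋, ⌊x.im⌋), 0, Int.fract x.re - Int.fract x.im, Int.fract x.im, by linarith, h4,
      by linarith, Or.inl rfl, ?_⟩
    apply Complex.ext <;> simp [tri, latticeDir]
    linarith
  · refine ⟨(⌊x.re⌋, ⌊x.im⌋), 1, Int.fract x.re, Int.fract x.im - Int.fract x.re, h3, by linarith,
      by linarith, Or.inr rfl, ?_⟩
    apply Complex.ext <;> simp [tri, latticeDir]

/-- Signed crossing of the segment from `a` to `b` with the positive horizontal axis. -/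
noncomputable def crossing (a b : ℂ) : ℤ :=
  if a.im < 0 ∧ ¬b.im < 0 ∧ 0 < cross a b then 1
  else if b.im < 0 ∧ ¬a.im < 0 ∧ cross a b < 0 then -1 else 0

theorem crossing_swap (a b : ℂ) : crossing b a = -crossing a b := by
  have : cross b a = -cross a b := TutteMap.cross_swap b a
  simp only [crossing, this]
  grind

theorem crossing_triangle {a b c : ℂ} (hab : cross a b ≠ 0) (hbc : cross b c ≠ 0)
    (hca : cross c a ≠ 0) (hpos : 0 < cross a b + cross b c + cross c a) :
    crossing a b + crossing b c + crossing c a =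
      if 0 < cross a b ∧ 0 < cross b c ∧ 0 < cross c a then 1 else 0 := by
  have hid : a.im * cross b c + b.im * cross c a + c.im * cross a b = 0 := by
    simp only [cross]; ring
  have hz : a.im = 0 → b.im = 0 → cross a b = 0 := fun h1 h2 => by simp [cross, h1, h2]
  have hs : ∀ x A : ℝ, (x < 0 → 0 < A → x * A < 0) ∧ (x < 0 → A < 0 → 0 < x * A) ∧
      (¬x < 0 → 0 < A → 0 ≤ x * A) ∧ (¬x < 0 → A < 0 → x * A ≤ 0) ∧ (x * A = 0 → A ≠ 0 → x = 0) :=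
    fun x A => ⟨fun h1 h2 => mul_neg_of_neg_of_pos h1 h2, fun h1 h2 => mul_pos_of_neg_of_neg h1 h2,
      fun h1 h2 => mul_nonneg (not_lt.1 h1) h2.le,
      fun h1 h2 => mul_nonpos_of_nonneg_of_nonpos (not_lt.1 h1) h2.le,
      fun h1 h2 => (mul_eq_zero.1 h1).resolve_right h2⟩
  have h1 := hs a.im (cross b c)
  have h2 := hs b.im (cross c a)
  have h3 := hs c.im (cross a b)
  clear hs
  simp only [crossing]
  generalize cross a b = C at *
  generalize cross b c = A at *
  generalize cross c a = B at *
  generalize a.im = x at *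
  generalize b.im = y at *
  generalize c.im = z at *
  generalize x * A = X at *
  generalize y * B = Y at *
  generalize z * C = Z at *
  rcases hbc.lt_or_gt with hA | hA <;> rcases hca.lt_or_gt with hB | hB <;>
    rcases hab.lt_or_gt with hC | hC <;> by_cases hx : x < 0 <;> by_cases hy : y < 0 <;>
    by_cases hz' : z < 0 <;>
    simp only [hA, hB, hC, hx, hy, hz', hA.not_gt, hB.not_gt, hC.not_gt, not_true, not_false_iff,
      and_true, and_false, if_true, if_false] <;>
    grind

/-- The point `p` lies strictly to the left of the sides of an image triangle. -/
def inside (φ : ℤ × ℤ → ℂ) (p : ℂ) (v : ℤ × ℤ) (k : Fin 6) : Prop :=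
  0 < cross (φ v - p) (φ (v + latticeDir k) - p) ∧
    0 < cross (φ (v + latticeDir k) - p) (φ (v + latticeDir (k + 1)) - p) ∧
    0 < cross (φ (v + latticeDir (k + 1)) - p) (φ v - p)

open Classical in
/-- Number of image triangles of the two kinds at `v` which contain `p`. -/
noncomputable def insideCount (φ : ℤ × ℤ → ℂ) (p : ℂ) (v : ℤ × ℤ) : ℤ :=
  (if inside φ p v 0 then 1 else 0) + (if inside φ p v 1 then 1 else 0)

/-- The point `p` lies on no line through an image edge. -/
def OffLines (φ : ℤ × ℤ → ℂ) (p : ℂ) : Prop :=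
  ∀ v k, cross (φ v - p) (φ (v + latticeDir k) - p) ≠ 0

theorem OffLines.crossing_sum {φ : ℤ × ℤ → ℂ} {p : ℂ} (h : OffLines φ p) {v : ℤ × ℤ} {k : Fin 6}
    (ha : 0 < TutteMap.area φ v k) [Decidable (inside φ p v k)] :
    crossing (φ v - p) (φ (v + latticeDir k) - p) +
      crossing (φ (v + latticeDir k) - p) (φ (v + latticeDir (k + 1)) - p) +
      crossing (φ (v + latticeDir (k + 1)) - p) (φ v - p) = if inside φ p v k then 1 else 0 := by
  rw [crossing_triangle]
  · exact if_congr Iff.rfl rfl rfl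
  · exact h v k
  · have := h (v + latticeDir k) (k + 2)
    rwa [(triangle_vertices v k).1] at this
  · rw [TutteMap.cross_swap]
    exact neg_ne_zero.2 (h v (k + 1))
  · convert ha using 1
    simp only [TutteMap.area, cross, Complex.sub_re, Complex.sub_im]
    ring

theorem OffLines.insideCount_eq {φ : ℤ × ℤ → ℂ} {p : ℂ} (h : OffLines φ p)
    (ha : ∀ v k, 0 < TutteMap.area φ v k) (v : ℤ × ℤ) :
    insideCount φ p v = crossing (φ v - p) (φ (v + latticeDir 0) - p) +
      crossing (φ (v + latticeDir 0) - p) (φ (v + latticeDir 0 + latticeDir 2) - p) -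
      crossing (φ (v + latticeDir 2) - p) (φ (v + latticeDir 2 + latticeDir 0) - p) -
      crossing (φ v - p) (φ (v + latticeDir 2) - p) := by
  classical
  rw [insideCount, ← h.crossing_sum (ha v 0), ← h.crossing_sum (ha v 1)]
  have e1 : v + latticeDir 0 + latticeDir 2 = v + latticeDir 1 := (triangle_vertices v 0).1
  have e2 : v + latticeDir 2 + latticeDir 0 = v + latticeDir 1 := by
    rw [← e1]; abel
  rw [e1, e2, crossing_swap (φ v - p) (φ (v + latticeDir (0 + 1)) - p),
    crossing_swap (φ (v + latticeDir (1 + 1)) - p) (φ (v + latticeDir 1) - p),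
    crossing_swap (φ v - p) (φ (v + latticeDir (1 + 1)) - p),
    show (0 + 1 : Fin 6) = 1 by decide, show (1 + 1 : Fin 6) = 2 by decide]
  ring

theorem finsum_insideCount_sub {φ ψ : ℤ × ℤ → ℂ} {p : ℂ} (h : OffLines φ p) (h' : OffLines ψ p)
    (ha : ∀ v k, 0 < TutteMap.area φ v k) (ha' : ∀ v k, 0 < TutteMap.area ψ v k)
    {F : Set (ℤ × ℤ)} (hF : F.Finite) (hφψ : ∀ v ∉ F, φ v = ψ v) :
    ∑ᶠ v, (insideCount φ p v - insideCount ψ p v) = 0 := by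
  set X : Fin 6 → ℤ × ℤ → ℤ := fun k v => crossing (φ v - p) (φ (v + latticeDir k) - p) -
    crossing (ψ v - p) (ψ (v + latticeDir k) - p) with hX
  have hfin : ∀ k, (X k).support.Finite := by
    intro k
    refine (hF.union (hF.preimage (add_left_injective (latticeDir k)).injOn)).subset fun v hv => ?_
    by_contra hcon
    simp only [mem_union, mem_preimage, not_or] at hcon
    apply hv
    simp only [hX, hφψ _ hcon.1, hφψ _ hcon.2, sub_self]
  have hshift : ∀ (w : ℤ × ℤ) (k : Fin 6), ∑ᶠ v, X k (v + w) = ∑ᶠ v, X k v := fun w k =>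
    finsum_comp_equiv (Equiv.addRight w) (f := X k)
  have hfin' : ∀ (w : ℤ × ℤ) (k : Fin 6), (fun v => X k (v + w)).support.Finite := fun w k =>
    (hfin k).preimage (add_left_injective w).injOn
  have hsum : ∀ v, insideCount φ p v - insideCount ψ p v =
      (X 0 v - X 0 (v + latticeDir 2)) + (X 2 (v + latticeDir 0) - X 2 v) := by
    intro v
    rw [h.insideCount_eq ha, h'.insideCount_eq ha']
    simp only [hX]
    ring
  rw [finsum_congr hsum, finsum_add_distrib, finsum_sub_distrib (hfin 0) (hfin' _ _),
    finsum_sub_distrib (hfin' _ _) (hfin 2), hshift, hshift, sub_self, sub_self, add_zero]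
  · exact ((hfin 0).union (hfin' (latticeDir 2) 0)).subset (Function.support_sub _ _)
  · exact ((hfin' (latticeDir 0) 2).union (hfin 2)).subset (Function.support_sub _ _)

theorem inside_latticePt_zero {p : ℂ} {v : ℤ × ℤ} : inside latticePt p v 0 ↔
    0 < p.im - v.2 ∧ p.re - v.1 < 1 ∧ p.im - v.2 < p.re - v.1 := by
  rw [inside, show (0 + 1 : Fin 6) = 1 by decide]
  simp only [cross, latticePt_add, Complex.sub_re, Complex.sub_im, Complex.add_re, Complex.add_im,
    latticePt_re, latticePt_im]
  simp only [latticeDir, Fin.isValue, Matrix.cons_val_zero, Matrix.cons_val_one, Int.cast_one,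
    Int.cast_zero]
  refine and_congr ?_ (and_congr ?_ ?_)
  · ring_nf
  · rw [← sub_pos (a := (1 : ℝ))]; ring_nf
  · rw [← sub_pos (a := p.re - v.1)]; ring_nf

theorem inside_latticePt_one {p : ℂ} {v : ℤ × ℤ} : inside latticePt p v 1 ↔
    p.re - v.1 < p.im - v.2 ∧ p.im - v.2 < 1 ∧ 0 < p.re - v.1 := by
  rw [inside, show (1 + 1 : Fin 6) = 2 by decide]
  simp only [cross, latticePt_add, Complex.sub_re, Complex.sub_im, Complex.add_re, Complex.add_im,
    latticePt_re, latticePt_im]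
  simp only [latticeDir, Fin.isValue, Matrix.cons_val, Matrix.cons_val_one, Int.cast_one,
    Int.cast_zero]
  refine and_congr ?_ (and_congr ?_ ?_)
  · rw [← sub_pos (a := p.im - v.2)]; ring_nf
  · rw [← sub_pos (a := (1 : ℝ))]; ring_nf
  · ring_nf

theorem insideCount_latticePt_of_ne {p : ℂ} {v : ℤ × ℤ} (hv : v ≠ (⌊p.re⌋, ⌊p.im⌋)) :
    insideCount latticePt p v = 0 := by
  have h : ∀ v : ℤ × ℤ, 0 < p.re - v.1 → p.re - v.1 < 1 → 0 < p.im - v.2 → p.im - v.2 < 1 →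
      v = (⌊p.re⌋, ⌊p.im⌋) := by
    intro v h1 h2 h3 h4
    refine Prod.ext ?_ ?_
    · exact (Int.floor_eq_iff.2 ⟨by linarith, by linarith⟩).symm
    · exact (Int.floor_eq_iff.2 ⟨by linarith, by linarith⟩).symm
  rw [insideCount, if_neg, if_neg, add_zero]
  · rw [inside_latticePt_one]
    exact fun hc => hv (h v (by linarith) (by linarith) (by linarith) (by linarith))
  · rw [inside_latticePt_zero]
    exact fun hc => hv (h v (by linarith) (by linarith) (by linarith) (by linarith))

theorem insideCount_latticePt_floor {p : ℂ} (hp : OffLines latticePt p) :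
    insideCount latticePt p (⌊p.re⌋, ⌊p.im⌋) = 1 := by
  have h0 := hp (⌊p.re⌋, ⌊p.im⌋) 0
  have h1 := hp (⌊p.re⌋, ⌊p.im⌋) 1
  have h2 := hp (⌊p.re⌋, ⌊p.im⌋) 2
  simp only [cross, latticePt_add, Complex.sub_re, Complex.sub_im, Complex.add_re, Complex.add_im,
    latticePt_re, latticePt_im] at h0 h1 h2
  simp only [latticeDir, Fin.isValue, Matrix.cons_val, Matrix.cons_val_zero, Matrix.cons_val_one,
    Int.cast_one, Int.cast_zero] at h0 h1 h2
  have e0 : p.im - ⌊p.im⌋ ≠ 0 := fun h => h0 (by linear_combination h)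
  have e1 : p.im - ⌊p.im⌋ ≠ p.re - ⌊p.re⌋ := fun h => h1 (by linear_combination h)
  have e2 : p.re - ⌊p.re⌋ ≠ 0 := fun h => h2 (by linear_combination -h)
  have f1 := Int.floor_le p.re
  have f2 := Int.floor_le p.im
  have f3 := Int.lt_floor_add_one p.re
  have f4 := Int.lt_floor_add_one p.im
  have g1 : 0 < p.re - ⌊p.re⌋ := lt_of_le_of_ne (by linarith) e2.symm
  have g2 : 0 < p.im - ⌊p.im⌋ := lt_of_le_of_ne (by linarith) e0.symm
  rw [insideCount]
  simp only [inside_latticePt_zero, inside_latticePt_one]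
  rcases e1.lt_or_gt with h | h
  · rw [if_pos ⟨g2, by linarith, h⟩, if_neg fun h' => h.not_gt h'.1]
    rfl
  · rw [if_neg fun h' => h.not_gt h'.2.2, if_pos ⟨h, by linarith, g1⟩]
    rfl

theorem area_latticePt (v : ℤ × ℤ) (k : Fin 6) : TutteMap.area latticePt v k = 1 := by
  rw [TutteMap.area, latticePt_add, latticePt_add, add_sub_cancel_left, add_sub_cancel_left]
  fin_cases k <;> simp [cross, latticeDir]

/-- A point off all lines lies in exactly one image triangle. -/
theorem TutteMap.exists_unique_inside {N : ℕ} {φ : ℤ × ℤ → ℂ} (hφ : TutteMap N φ) {p : ℂ}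
    (h : OffLines φ p) (h' : OffLines latticePt p) :
    ∃ v₀ k₀, (k₀ = 0 ∨ k₀ = 1) ∧ inside φ p v₀ k₀ ∧
      ∀ v k, (k = 0 ∨ k = 1) → inside φ p v k → v = v₀ ∧ k = k₀ := by
  classical
  have hs := finsum_insideCount_sub h h' hφ.area_pos (fun v k => by rw [area_latticePt]; simp)
    (finite_latticeBox N) hφ.outside
  have hsupp' : (insideCount latticePt p).support ⊆ {(⌊p.re⌋, ⌊p.im⌋)} := by
    intro v hv
    by_contra hne
    exact hv (insideCount_latticePt_of_ne hne)
  have hfin' := (finite_singleton (⌊p.re⌋, ⌊p.im⌋)).subset hsupp'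
  have hfin : (insideCount φ p).support.Finite := by
    have hfd : (fun v => insideCount φ p v - insideCount latticePt p v).support.Finite := by
      have hb : ∀ w : ℤ × ℤ, ((fun v => v + w) ⁻¹' latticeBox N).Finite := fun w =>
        (finite_latticeBox N).preimage (add_left_injective w).injOn
      refine ((((finite_latticeBox N).union (hb (latticeDir 0))).union (hb (latticeDir 1))).union
        (hb (latticeDir 2))).subset fun v hv => ?_
      by_contra hcon
      simp only [mem_union, mem_preimage, not_or] at hcon
      apply hv
      simp only [insideCount, inside, show (0 + 1 : Fin 6) = 1 by decide,
        show (1 + 1 : Fin 6) = 2 by decide, hφ.outside _ hcon.1.1.1, hφ.outside _ hcon.1.1.2,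
        hφ.outside _ hcon.1.2, hφ.outside _ hcon.2, sub_self]
    refine (hfd.union hfin').subset fun v hv => ?_
    by_contra hcon
    simp only [mem_union, Function.mem_support, not_or, not_not] at hcon
    apply hv
    linarith [hcon.1, hcon.2]
  rw [finsum_sub_distrib hfin hfin', finsum_eq_single (insideCount latticePt p) _
    (fun v hv => insideCount_latticePt_of_ne hv), insideCount_latticePt_floor h',
    finsum_eq_sum _ hfin] at hs
  have hnn : ∀ v, 0 ≤ insideCount φ p v := fun v => by
    rw [insideCount]; split_ifs <;> norm_num
  have hmem : ∀ v k, (k = 0 ∨ k = 1) → inside φ p v k → 1 ≤ insideCount φ p v := by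
    rintro v k (rfl | rfl) hk
    · rw [insideCount, if_pos hk]; split_ifs <;> norm_num
    · rw [insideCount, if_pos hk]; split_ifs <;> norm_num
  obtain ⟨v₀, hv₀, hne⟩ := Finset.exists_ne_zero_of_sum_ne_zero
    (s := hfin.toFinset) (f := insideCount φ p) (by intro h; rw [h] at hs; simp at hs)
  have hle : insideCount φ p v₀ ≤ 1 := by
    have := Finset.single_le_sum (fun v _ => hnn v) hv₀
    linarith
  have huniq : ∀ v k, (k = 0 ∨ k = 1) → inside φ p v k → v = v₀ := by
    intro v k hk hin
    by_contra hv
    have h1 := hmem v k hk hin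
    have h2 : 1 ≤ insideCount φ p v₀ := by have := hnn v₀; omega
    have hv' : v ∈ hfin.toFinset := by
      rw [Finite.mem_toFinset, Function.mem_support]; omega
    have := Finset.add_le_sum (fun v _ => hnn v) hv' hv₀ hv
    linarith
  by_cases h0 : inside φ p v₀ 0
  · refine ⟨v₀, 0, Or.inl rfl, h0, fun v k hk hin => ?_⟩
    obtain rfl := huniq v k hk hin
    refine ⟨rfl, hk.resolve_right ?_⟩
    rintro rfl
    rw [insideCount, if_pos h0, if_pos hin] at hle
    norm_num at hle
  · have h1 : inside φ p v₀ 1 := by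
      by_contra h1
      rw [insideCount, if_neg h0, if_neg h1] at hne
      exact hne rfl
    refine ⟨v₀, 1, Or.inr rfl, h1, fun v k hk hin => ?_⟩
    obtain rfl := huniq v k hk hin
    refine ⟨rfl, hk.resolve_left ?_⟩
    rintro rfl
    exact h0 hin

namespace TutteMap

variable {N : ℕ} {φ : ℤ × ℤ → ℂ}

theorem inside_tri {v : ℤ × ℤ} {k : Fin 6} (ha : 0 < area φ v k) {α β : ℝ} (hα : 0 < α)
    (hβ : 0 < β) (h : α + β < 1) : inside φ (tri φ v k α β) v k := by
  have h1 : cross (φ v - tri φ v k α β) (φ (v + latticeDir k) - tri φ v k α β) =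
      β * area φ v k := by
    simp only [tri, area, cross, Complex.sub_re, Complex.sub_im, Complex.add_re, Complex.add_im,
      Complex.mul_re, Complex.mul_im, Complex.ofReal_re, Complex.ofReal_im]
    ring
  have h2 : cross (φ (v + latticeDir k) - tri φ v k α β)
      (φ (v + latticeDir (k + 1)) - tri φ v k α β) = (1 - α - β) * area φ v k := by
    simp only [tri, area, cross, Complex.sub_re, Complex.sub_im, Complex.add_re, Complex.add_im,
      Complex.mul_re, Complex.mul_im, Complex.ofReal_re, Complex.ofReal_im]
    ring
  have h3 : cross (φ (v + latticeDir (k + 1)) - tri φ v k α β) (φ v - tri φ v k α β) =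
      α * area φ v k := by
    simp only [tri, area, cross, Complex.sub_re, Complex.sub_im, Complex.add_re, Complex.add_im,
      Complex.mul_re, Complex.mul_im, Complex.ofReal_re, Complex.ofReal_im]
    ring
  rw [inside, h1, h2, h3]
  exact ⟨mul_pos hβ ha, mul_pos (by linarith) ha, mul_pos hα ha⟩

/-- Affine coordinates with respect to a nondegenerate triangle. -/
theorem eq_comb {a b : ℂ} (h : cross a b ≠ 0) (d : ℂ) :
    d = (cross d b / cross a b : ℝ) * a + (cross a d / cross a b : ℝ) * b := by
  apply Complex.ext
  · rw [Complex.add_re, Complex.re_ofReal_mul, Complex.re_ofReal_mul, div_mul_eq_mul_div,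
      div_mul_eq_mul_div, ← add_div, eq_div_iff h]
    simp only [cross]
    ring
  · rw [Complex.add_im, Complex.im_ofReal_mul, Complex.im_ofReal_mul, div_mul_eq_mul_div,
      div_mul_eq_mul_div, ← add_div, eq_div_iff h]
    simp only [cross]
    ring

theorem exists_tri_of_inside {v : ℤ × ℤ} {k : Fin 6} (ha : 0 < area φ v k) {p : ℂ}
    (h : inside φ p v k) : ∃ α β : ℝ, 0 < α ∧ 0 < β ∧ α + β < 1 ∧ p = tri φ v k α β := by
  have hp := eq_comb (a := φ (v + latticeDir k) - φ v) (b := φ (v + latticeDir (k + 1)) - φ v)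
    ha.ne' (p - φ v)
  refine ⟨cross (p - φ v) (φ (v + latticeDir (k + 1)) - φ v) / area φ v k,
    cross (φ (v + latticeDir k) - φ v) (p - φ v) / area φ v k, ?_, ?_, ?_, ?_⟩
  · refine div_pos ?_ ha
    refine h.2.2.trans_eq ?_
    simp only [cross, Complex.sub_re, Complex.sub_im]
    ring
  · refine div_pos ?_ ha
    refine h.1.trans_eq ?_
    simp only [cross, Complex.sub_re, Complex.sub_im]
    ring
  · have h2 := h.2.1
    rw [← add_div, div_lt_one ha]
    rw [← sub_pos]
    refine h2.trans_eq ?_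
    simp only [area, cross, Complex.sub_re, Complex.sub_im]
    ring
  · rw [tri, add_assoc, area, ← hp]; ring

theorem tri_injective {v : ℤ × ℤ} {k : Fin 6} (ha : 0 < area φ v k) {α β α' β' : ℝ}
    (h : tri φ v k α β = tri φ v k α' β') : α = α' ∧ β = β' := by
  have h1 : ((α - α' : ℝ) : ℂ) * (φ (v + latticeDir k) - φ v) +
      ((β - β' : ℝ) : ℂ) * (φ (v + latticeDir (k + 1)) - φ v) = 0 := by
    rw [tri, tri] at h
    push_cast
    linear_combination h
  have hr := congrArg Complex.re h1
  have hi := congrArg Complex.im h1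
  simp only [Complex.add_re, Complex.add_im, Complex.mul_re, Complex.mul_im, Complex.ofReal_re,
    Complex.ofReal_im, Complex.zero_re, Complex.zero_im, zero_mul, sub_zero, add_zero] at hr hi
  have e1 : (α - α') * area φ v k = 0 := by
    simp only [area, cross]
    linear_combination (φ (v + latticeDir (k + 1)) - φ v).im * hr -
      (φ (v + latticeDir (k + 1)) - φ v).re * hi
  have e2 : (β - β') * area φ v k = 0 := by
    simp only [area, cross]
    linear_combination (φ (v + latticeDir k) - φ v).re * hi -
      (φ (v + latticeDir k) - φ v).im * hr
  exact ⟨sub_eq_zero.1 ((mul_eq_zero.1 e1).resolve_right ha.ne'),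
    sub_eq_zero.1 ((mul_eq_zero.1 e2).resolve_right ha.ne')⟩

/-- A ray leaving a point of a closed triangle towards its inside. -/
theorem eventually_mem_tri {v : ℤ × ℤ} {k : Fin 6} (ha : 0 < area φ v k) {α β : ℝ} {d : ℂ}
    (h : α + β < 1) (hα : 0 < α ∨ 0 ≤ α ∧ 0 < cross d (φ (v + latticeDir (k + 1)) - φ v))
    (hβ : 0 < β ∨ 0 ≤ β ∧ 0 < cross (φ (v + latticeDir k) - φ v) d) :
    ∀ᶠ ε : ℝ in 𝓝[>] 0, ∃ α' β' : ℝ, 0 < α' ∧ 0 < β' ∧ α' + β' < 1 ∧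
      tri φ v k α β + ε * d = tri φ v k α' β' := by
  have hd := eq_comb (a := φ (v + latticeDir k) - φ v) (b := φ (v + latticeDir (k + 1)) - φ v)
    ha.ne' d
  set a := cross d (φ (v + latticeDir (k + 1)) - φ v) /
    cross (φ (v + latticeDir k) - φ v) (φ (v + latticeDir (k + 1)) - φ v) with hadef
  set b := cross (φ (v + latticeDir k) - φ v) d /
    cross (φ (v + latticeDir k) - φ v) (φ (v + latticeDir (k + 1)) - φ v) with hbdef
  have key : ∀ α a : ℝ, (0 < α ∨ 0 ≤ α ∧ 0 < a) → ∀ᶠ ε : ℝ in 𝓝[>] 0, 0 < α + ε * a := by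
    rintro α a (h | ⟨h1, h2⟩)
    · have : ContinuousAt (fun ε : ℝ => α + ε * a) 0 := by fun_prop
      exact (this.eventually (lt_mem_nhds (by simpa using h))).filter_mono nhdsWithin_le_nhds
    · filter_upwards [self_mem_nhdsWithin] with ε hε
      have := mul_pos (mem_Ioi.1 hε) h2
      linarith
  have h1 := key α a (hα.imp_right fun h => ⟨h.1, div_pos h.2 ha⟩)
  have h2 := key β b (hβ.imp_right fun h => ⟨h.1, div_pos h.2 ha⟩)
  have h3 := key (1 - α - β) (-a - b) (Or.inl (by linarith))
  filter_upwards [h1, h2, h3] with ε h1 h2 h3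
  refine ⟨α + ε * a, β + ε * b, h1, h2, by linarith, ?_⟩
  rw [hd, tri, tri]
  push_cast
  ring

theorem exists_tri_ray (hφ : TutteMap N φ) {d : ℂ}
    (hd : ∀ v k, cross d (φ (v + latticeDir k) - φ v) ≠ 0) (v : ℤ × ℤ) (k : Fin 6) {α β : ℝ}
    (hα : 0 ≤ α) (hβ : 0 ≤ β) (h : α + β ≤ 1) :
    ∃ v' k', ∃ α' β' : ℝ, 0 ≤ α' ∧ 0 ≤ β' ∧ α' + β' ≤ 1 ∧
      (∀ ψ, tri ψ v' k' α' β' = tri ψ v k α β) ∧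
      ∀ᶠ ε : ℝ in 𝓝[>] 0, ∃ s t : ℝ, 0 < s ∧ 0 < t ∧ s + t < 1 ∧
        tri φ v k α β + ε * d = tri φ v' k' s t := by
  have hedge : ∀ v k, ∀ α : ℝ, 0 < α → α < 1 → ∃ v' k', ∃ α' β' : ℝ, 0 ≤ α' ∧ 0 ≤ β' ∧ α' + β' ≤ 1 ∧
      (∀ ψ, tri ψ v' k' α' β' = tri ψ v k α 0) ∧
      ∀ᶠ ε : ℝ in 𝓝[>] 0, ∃ s t : ℝ, 0 < s ∧ 0 < t ∧ s + t < 1 ∧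
        tri φ v k α 0 + ε * d = tri φ v' k' s t := by
    intro v k α h0 h1
    rcases (hd v k).lt_or_gt with h | h
    · refine ⟨v, k, α, 0, h0.le, le_rfl, by linarith, fun _ => rfl,
        eventually_mem_tri (hφ.area_pos v k) (by linarith) (Or.inl h0) (Or.inr ⟨le_rfl, ?_⟩)⟩
      rw [cross_swap]; linarith
    · have e : k - 1 + 1 = k := sub_add_cancel k 1
      have e' : ∀ ψ, tri ψ v (k - 1) 0 α = tri ψ v k α 0 := fun ψ => by
        rw [← tri_succ, e]
      refine ⟨v, k - 1, 0, α, le_rfl, h0.le, by linarith, e', ?_⟩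
      rw [← e']
      refine eventually_mem_tri (hφ.area_pos v (k - 1)) (by linarith) (Or.inr ⟨le_rfl, ?_⟩)
        (Or.inl h0)
      rwa [e]
  obtain ⟨v₁, k₁, α₁, β₁, hα₁, hβ₁, h₁, heq⟩ := exists_tri_lt v k hα hβ h
  rw [← heq φ]
  suffices ∃ v' k', ∃ α' β' : ℝ, 0 ≤ α' ∧ 0 ≤ β' ∧ α' + β' ≤ 1 ∧
      (∀ ψ, tri ψ v' k' α' β' = tri ψ v₁ k₁ α₁ β₁) ∧
      ∀ᶠ ε : ℝ in 𝓝[>] 0, ∃ s t : ℝ, 0 < s ∧ 0 < t ∧ s + t < 1 ∧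
        tri φ v₁ k₁ α₁ β₁ + ε * d = tri φ v' k' s t by simpa only [heq] using this
  rcases hα₁.eq_or_lt with h2 | h2 <;> rcases hβ₁.eq_or_lt with h3 | h3
  · obtain ⟨k, l, hk, hl⟩ := hφ.exists_cross_neg_pos hd v₁
    obtain ⟨m, hm, hm'⟩ := exists_rising_sign
      (fun k => decide (0 < cross d (φ (v₁ + latticeDir k) - φ v₁)))
      ⟨k, l, by simp [hk.not_gt, hl]⟩
    simp only [decide_eq_false_iff_not, not_lt, decide_eq_true_eq] at hm hm'
    have e : ∀ ψ, tri ψ v₁ m 0 0 = tri ψ v₁ k₁ α₁ β₁ := fun ψ => by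
      rw [← h2, ← h3]; simp [tri]
    refine ⟨v₁, m, 0, 0, le_rfl, le_rfl, by norm_num, e, ?_⟩
    rw [← e φ]
    refine eventually_mem_tri (hφ.area_pos v₁ m) (by norm_num) (Or.inr ⟨le_rfl, hm'⟩)
      (Or.inr ⟨le_rfl, ?_⟩)
    rw [cross_swap]
    have := hm.lt_of_ne (hd v₁ m)
    linarith
  · have := hedge v₁ (k₁ + 1) β₁ h3 (by linarith)
    rw [← h2]
    simpa only [tri_succ] using this
  · rw [← h3]
    exact hedge v₁ k₁ α₁ h2 (by linarith)
  · exact ⟨v₁, k₁, α₁, β₁, hα₁, hβ₁, h₁.le, fun _ => rfl,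
      eventually_mem_tri (hφ.area_pos v₁ k₁) h₁ (Or.inl h2) (Or.inl h3)⟩

/-- Directions parallel to no image edge and no edge of the lattice. -/
theorem exists_generic_dir (hφ : TutteMap N φ) : ∃ d : ℂ,
    (∀ v k, cross d (φ (v + latticeDir k) - φ v) ≠ 0) ∧
      ∀ k, cross d (latticePt (latticeDir k)) ≠ 0 := by
  obtain ⟨δ, -, -, h1, h2⟩ := hφ.exists_generic (w := 1) one_ne_zero 1 one_ne_zero one_pos
  exact ⟨(1 : ℝ) * 1 + δ * (Complex.I * 1), fun v k => by rw [cross_comb]; exact h1 v k,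
    fun k => by rw [cross_comb]; exact h2 k⟩

theorem exists_offLines {d : ℂ} (hd : ∀ v k, cross d (φ (v + latticeDir k) - φ v) ≠ 0)
    (hd' : ∀ k, cross d (latticePt (latticeDir k)) ≠ 0) (q : ℂ) {η : ℝ} (hη : 0 < η) :
    ∃ ε : ℝ, 0 < ε ∧ ε < η ∧ OffLines φ (q + ε * d) ∧ OffLines latticePt (q + ε * d) := by
  obtain ⟨ε, h1, h2, h3⟩ := exists_pos_lt_forall_ne_zero
    (fun i : ((ℤ × ℤ) × Fin 6) ⊕ ((ℤ × ℤ) × Fin 6) => Sum.elim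
      (fun i => cross (φ i.1 - q) (φ (i.1 + latticeDir i.2) - q))
      (fun i => cross (latticePt i.1 - q) (latticePt (i.1 + latticeDir i.2) - q)) i)
    (fun i => Sum.elim (fun i => -cross d (φ (i.1 + latticeDir i.2) - φ i.1))
      (fun i => -cross d (latticePt (latticeDir i.2))) i)
    (fun i => Or.inr (by
      rcases i with i | i
      · exact neg_ne_zero.2 (hd _ _)
      · exact neg_ne_zero.2 (hd' _))) hη
  refine ⟨ε, h1, h2, fun v k => ?_, fun v k => ?_⟩
  · convert h3 (Sum.inl (v, k)) using 1
    simp only [Sum.elim_inl, cross, Complex.sub_re, Complex.sub_im, Complex.add_re, Complex.add_im,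
      Complex.mul_re, Complex.mul_im, Complex.ofReal_re, Complex.ofReal_im]
    ring
  · convert h3 (Sum.inr (v, k)) using 1
    simp only [Sum.elim_inr, cross, latticePt_add, Complex.sub_re, Complex.sub_im, Complex.add_re,
      Complex.add_im, Complex.mul_re, Complex.mul_im, Complex.ofReal_re, Complex.ofReal_im]
    ring

/-- Points with equal images coincide. -/
theorem tri_latticePt_eq (hφ : TutteMap N φ) {v v' : ℤ × ℤ} {k k' : Fin 6} {α β α' β' : ℝ}
    (hα : 0 ≤ α) (hβ : 0 ≤ β) (h : α + β ≤ 1) (hα' : 0 ≤ α') (hβ' : 0 ≤ β') (h' : α' + β' ≤ 1)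
    (heq : tri φ v k α β = tri φ v' k' α' β') :
    tri latticePt v k α β = tri latticePt v' k' α' β' := by
  obtain ⟨d, hd, hd'⟩ := hφ.exists_generic_dir
  obtain ⟨w, l, s, t, hs, ht, hst, hψ, hray⟩ := hφ.exists_tri_ray hd v k hα hβ h
  obtain ⟨w', l', s', t', hs', ht', hst', hψ', hray'⟩ := hφ.exists_tri_ray hd v' k' hα' hβ' h'
  rw [← heq] at hray'
  obtain ⟨η, hη, hball⟩ := mem_nhdsGT_iff_exists_Ioo_subset.1 (hray.and hray')
  obtain ⟨ε, hε, hεη, ho, ho'⟩ := exists_offLines hd hd' (tri φ v k α β) (mem_Ioi.1 hη)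
  obtain ⟨⟨a, b, ha, hb, hab, e⟩, a', b', ha', hb', hab', e'⟩ := hball ⟨hε, hεη⟩
  obtain ⟨v₀, k₀, -, -, huniq⟩ := hφ.exists_unique_inside ho ho'
  obtain ⟨u, m, hm, hu⟩ := exists_tri_normal w l
  obtain ⟨u', m', hm', hu'⟩ := exists_tri_normal w' l'
  have hu1 : u = v₀ ∧ m = k₀ := by
    obtain ⟨x, y, -, -, -, hxy, hx⟩ := hu a b ha.le hb.le hab.le
    obtain ⟨h1, h2, h3⟩ := hxy ha hb hab
    refine huniq u m hm ?_
    rw [e, ← hx]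
    exact inside_tri (hφ.area_pos u m) h1 h2 h3
  have hu2 : u' = v₀ ∧ m' = k₀ := by
    obtain ⟨x, y, -, -, -, hxy, hx⟩ := hu' a' b' ha'.le hb'.le hab'.le
    obtain ⟨h1, h2, h3⟩ := hxy ha' hb' hab'
    refine huniq u' m' hm' ?_
    rw [e', ← hx]
    exact inside_tri (hφ.area_pos u' m') h1 h2 h3
  obtain ⟨rfl, rfl⟩ := hu1
  obtain ⟨rfl, rfl⟩ := hu2
  obtain ⟨x, y, -, -, -, -, hx⟩ := hu s t hs ht hst
  obtain ⟨x', y', -, -, -, -, hx'⟩ := hu' s' t' hs' ht' hst'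
  have : tri φ u' m' x y = tri φ u' m' x' y' := by rw [hx, hx', hψ, hψ', heq]
  obtain ⟨rfl, rfl⟩ := tri_injective (hφ.area_pos u' m') this
  rw [← hψ, ← hψ', ← hx, ← hx']

end TutteMap

/-- The hat function of the lattice triangulation at the origin. -/
noncomputable def hat (x : ℂ) : ℝ := max 0 (1 - max (max |x.re| |x.im|) |x.re - x.im|)

theorem hat_eq_zero {x : ℂ} (h : 1 ≤ |x.re| ∨ 1 ≤ |x.im| ∨ 1 ≤ |x.re - x.im|) : hat x = 0 := by
  rw [hat]
  apply max_eq_left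
  have h1 := le_max_left (max |x.re| |x.im|) |x.re - x.im|
  have h2 := le_max_right (max |x.re| |x.im|) |x.re - x.im|
  have h3 := le_max_left |x.re| |x.im|
  have h4 := le_max_right |x.re| |x.im|
  rcases h with h | h | h <;> linarith

theorem continuous_hat : Continuous hat := by
  unfold hat; fun_prop

theorem hat_eq {x : ℂ} {s t u : ℝ} (hs : x.re = s) (ht : x.im = t) (hu : s - t = u) :
    hat x = max 0 (1 - max (max |s| |t|) |u|) := by
  rw [hat, hs, ht, hu]

theorem hat_tri_latticePt {k : Fin 6} (hk : k = 0 ∨ k = 1) (v w : ℤ × ℤ) {α β : ℝ} (hα : 0 ≤ α)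
    (hβ : 0 ≤ β) (h : α + β ≤ 1) : hat (tri latticePt v k α β - latticePt w) =
      (if w = v then 1 - α - β else 0) + (if w = v + latticeDir k then α else 0) +
        (if w = v + latticeDir (k + 1) then β else 0) := by
  obtain ⟨⟨m, n⟩, rfl⟩ : ∃ u, w = v + u := ⟨w - v, by abel⟩
  simp only [add_eq_left, add_right_inj]
  have hre : (tri latticePt v k α β - latticePt (v + (m, n))).re =
      α * (latticeDir k).1 + β * (latticeDir (k + 1)).1 - m := by
    simp [tri]; ring
  have him : (tri latticePt v k α β - latticePt (v + (m, n))).im =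
      α * (latticeDir k).2 + β * (latticeDir (k + 1)).2 - n := by
    simp [tri]; ring
  generalize tri latticePt v k α β - latticePt (v + (m, n)) = x at *
  have hmn : (m ≤ -1 ∨ 2 ≤ m) ∨ (n ≤ -1 ∨ 2 ≤ n) ∨
      ((m = 0 ∨ m = 1) ∧ (n = 0 ∨ n = 1)) := by omega
  rcases hk with rfl | rfl
  · rw [show (0 + 1 : Fin 6) = 1 by decide] at *
    simp [latticeDir] at hre him
    simp only [latticeDir, Fin.isValue, Matrix.cons_val_zero, Matrix.cons_val_one, Prod.mk.injEq,
      Prod.mk_eq_zero]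
    rcases hmn with hm | hn | ⟨rfl | rfl, rfl | rfl⟩
    · rw [hat_eq_zero, if_neg, if_neg, if_neg] <;> try omega
      · norm_num
      · left
        rw [hre, le_abs]
        rcases hm with hm | hm
        · have : (m : ℝ) ≤ -1 := by exact_mod_cast hm
          left; linarith
        · have : (2 : ℝ) ≤ m := by exact_mod_cast hm
          right; linarith
    · rw [hat_eq_zero, if_neg, if_neg, if_neg] <;> try omega
      · norm_num
      · right; left
        rw [him, le_abs]
        rcases hn with hm | hm
        · have : (n : ℝ) ≤ -1 := by exact_mod_cast hm
          left; linarith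
        · have : (2 : ℝ) ≤ n := by exact_mod_cast hm
          right; linarith
    all_goals
      rw [hat_eq hre him rfl]
      norm_num
      grind
  · rw [show (1 + 1 : Fin 6) = 2 by decide] at *
    simp [latticeDir] at hre him
    simp only [latticeDir, Fin.isValue, Matrix.cons_val, Matrix.cons_val_one, Prod.mk.injEq,
      Prod.mk_eq_zero]
    rcases hmn with hm | hn | ⟨rfl | rfl, rfl | rfl⟩
    · rw [hat_eq_zero, if_neg, if_neg, if_neg] <;> try omega
      · norm_num
      · left
        rw [hre, le_abs]
        rcases hm with hm | hm
        · have : (m : ℝ) ≤ -1 := by exact_mod_cast hm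
          left; linarith
        · have : (2 : ℝ) ≤ m := by exact_mod_cast hm
          right; linarith
    · rw [hat_eq_zero, if_neg, if_neg, if_neg] <;> try omega
      · norm_num
      · right; left
        rw [him, le_abs]
        rcases hn with hm | hm
        · have : (n : ℝ) ≤ -1 := by exact_mod_cast hm
          left; linarith
        · have : (2 : ℝ) ≤ n := by exact_mod_cast hm
          right; linarith
    all_goals
      rw [hat_eq hre him rfl]
      norm_num
      grind

/-- The piecewise linear extension of a map of the lattice. -/
noncomputable def plMap (N : ℕ) (φ : ℤ × ℤ → ℂ) (x : ℂ) : ℂ :=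
  x + ∑ w ∈ (finite_latticeBox N).toFinset, (hat (x - latticePt w) : ℂ) * (φ w - latticePt w)

theorem continuous_plMap (N : ℕ) (φ : ℤ × ℤ → ℂ) : Continuous (plMap N φ) := by
  have := continuous_hat
  unfold plMap
  fun_prop

theorem plMap_of_notMem (N : ℕ) (φ : ℤ × ℤ → ℂ) {x : ℂ} (hx : ¬(|x.re| < N ∧ |x.im| < N)) :
    plMap N φ x = x := by
  rw [plMap, Finset.sum_eq_zero, add_zero]
  intro w hw
  rw [Finite.mem_toFinset, mem_latticeBox] at hw
  have key : ∀ (r : ℝ) (m : ℤ), |m| < N → ¬|r| < N → 1 ≤ |r - m| := by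
    intro r m hm hr
    have h1 : |(m : ℝ)| ≤ N - 1 := by
      have h2 : |m| ≤ N - 1 := by omega
      have : ((|m| : ℤ) : ℝ) ≤ ((N - 1 : ℤ) : ℝ) := by exact_mod_cast h2
      push_cast at this
      exact this
    have h3 := abs_sub_abs_le_abs_sub r m
    linarith [not_lt.1 hr]
  rw [not_and_or] at hx
  rw [hat_eq_zero, Complex.ofReal_zero, zero_mul]
  rcases hx with h | h
  · exact Or.inl (key _ _ hw.1 h)
  · exact Or.inr (Or.inl (key _ _ hw.2 h))

namespace TutteMap

variable {N : ℕ} {φ : ℤ × ℤ → ℂ}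

theorem plMap_tri (hφ : TutteMap N φ) (v : ℤ × ℤ) (k : Fin 6) {α β : ℝ}
    (hα : 0 ≤ α) (hβ : 0 ≤ β) (h : α + β ≤ 1) :
    plMap N φ (tri latticePt v k α β) = tri φ v k α β := by
  wlog hk : k = 0 ∨ k = 1 generalizing v k α β
  · obtain ⟨v', k', hk', h'⟩ := exists_tri_normal v k
    obtain ⟨α', β', h1, h2, h3, -, h4⟩ := h' α β hα hβ h
    rw [← h4, ← h4]
    exact this v' k' h1 h2 h3 hk'
  have hsum : ∀ (u : ℤ × ℤ) (c : ℝ), ∑ w ∈ (finite_latticeBox N).toFinset,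
      ((if w = u then c else 0 : ℝ) : ℂ) * (φ w - latticePt w) = c * (φ u - latticePt u) := by
    intro u c
    by_cases hu : u ∈ latticeBox N
    · rw [Finset.sum_eq_single u]
      · simp
      · intro w _ hw
        simp [hw]
      · intro h
        simp [hu] at h
    · rw [hφ.outside u hu, sub_self, mul_zero]
      refine Finset.sum_eq_zero fun w hw => ?_
      rw [Finite.mem_toFinset] at hw
      have : w ≠ u := fun h => hu (h ▸ hw)
      simp [this]
  rw [plMap]
  simp only [hat_tri_latticePt hk _ _ hα hβ h, Complex.ofReal_add, add_mul,
    Finset.sum_add_distrib, hsum]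
  rw [tri, tri]
  push_cast
  ring

theorem tendsto_cocompact_plMap (N : ℕ) (φ : ℤ × ℤ → ℂ) :
    Tendsto (plMap N φ) (cocompact ℂ) (cocompact ℂ) := by
  refine tendsto_id.congr' ?_
  rw [← Metric.cobounded_eq_cocompact, ← comap_norm_atTop]
  filter_upwards [(eventually_ge_atTop (N + N : ℝ)).comap norm] with x hx
  refine (plMap_of_notMem N φ fun h => ?_).symm
  have := Complex.norm_le_abs_re_add_abs_im x
  have h1 : |x.re| < N := h.1
  have h2 : |x.im| < N := h.2
  linarith

/-- A Tutte map extends to a homeomorphism of the plane which is affine on edges. -/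
theorem exists_homeomorph (hφ : TutteMap N φ) : ∃ Φ : ℂ ≃ₜ ℂ,
    (∀ x : ℂ, ¬(|x.re| < N ∧ |x.im| < N) → Φ x = x) ∧
    ∀ (v : ℤ × ℤ) (k : Fin 6) (α : ℝ), 0 ≤ α → α ≤ 1 →
      Φ (latticePt v + α * (latticePt (v + latticeDir k) - latticePt v)) =
        φ v + α * (φ (v + latticeDir k) - φ v) := by
  have hcont := continuous_plMap N φ
  have hclosed : IsClosedMap (plMap N φ) :=
    (isProperMap_iff_tendsto_cocompact.2 ⟨hcont, tendsto_cocompact_plMap N φ⟩).isClosedMap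
  have hinj : Function.Injective (plMap N φ) := by
    intro x y hxy
    obtain ⟨v, k, α, β, h1, h2, h3, -, rfl⟩ := exists_tri_latticePt x
    obtain ⟨v', k', α', β', h1', h2', h3', -, rfl⟩ := exists_tri_latticePt y
    rw [hφ.plMap_tri v k h1 h2 h3.le, hφ.plMap_tri v' k' h1' h2' h3'.le] at hxy
    exact hφ.tri_latticePt_eq h1 h2 h3.le h1' h2' h3'.le hxy
  have hsurj : Function.Surjective (plMap N φ) := by
    rw [← range_eq_univ, ← hclosed.isClosed_range.closure_eq, ← dense_iff_closure_eq]
    intro q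
    rw [Metric.mem_closure_iff]
    intro r hr
    obtain ⟨d, hd, hd'⟩ := hφ.exists_generic_dir
    have hd0 : 0 < ‖d‖ := norm_pos_iff.2 fun h => hd' 0 (by simp [h, cross])
    obtain ⟨ε, hε, hεr, ho, ho'⟩ := exists_offLines hd hd' q (div_pos hr hd0)
    obtain ⟨v, k, -, hin, -⟩ := hφ.exists_unique_inside ho ho'
    obtain ⟨α, β, h1, h2, h3, h4⟩ := exists_tri_of_inside (hφ.area_pos v k) hin
    refine ⟨_, ⟨_, hφ.plMap_tri v k h1.le h2.le h3.le⟩, ?_⟩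
    rw [← h4, dist_eq_norm, sub_add_cancel_left, norm_neg, norm_mul, Complex.norm_real,
      Real.norm_of_nonneg hε.le]
    exact (lt_div_iff₀ hd0).1 hεr
  refine ⟨IsHomeomorph.homeomorph (plMap N φ)
    (isHomeomorph_iff_continuous_isClosedMap_bijective.2 ⟨hcont, hclosed, hinj, hsurj⟩),
    fun x hx => plMap_of_notMem N φ hx, fun v k α h0 h1 => ?_⟩
  have := hφ.plMap_tri v k h0 le_rfl (by linarith : α + 0 ≤ 1)
  simpa [tri] using this

end TutteMap

/-! ### Weighted harmonic functions on the lattice box -/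

/-- From `v` one can leave the box along edges of positive weight. -/
inductive Reach (N : ℕ) (c : ℤ × ℤ → Fin 6 → ℝ) : ℤ × ℤ → Prop
  | outside {v : ℤ × ℤ} : v ∉ latticeBox N → Reach N c v
  | step {v : ℤ × ℤ} (k : Fin 6) : 0 < c v k → Reach N c (v + latticeDir k) → Reach N c v

/-- Transition weights on the box: nonnegative, of total mass one, and leading out of the box. -/
structure IsWeight (N : ℕ) (c : ℤ × ℤ → Fin 6 → ℝ) : Prop where
  nonneg : ∀ v ∈ latticeBox N, ∀ k, 0 ≤ c v k
  sum_eq_one : ∀ v ∈ latticeBox N, ∑ k, c v k = 1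
  reach : ∀ v ∈ latticeBox N, Reach N c v

theorem reach_of_pos {N : ℕ} {c : ℤ × ℤ → Fin 6 → ℝ}
    (hc : ∀ v ∈ latticeBox N, 0 < c v 0 ∨ Reach N c v) :
    ∀ (n : ℕ) (v : ℤ × ℤ), (N : ℤ) ≤ v.1 + n → Reach N c v := by
  intro n
  induction n with
  | zero =>
    intro v hv
    refine Reach.outside fun h => ?_
    have := (abs_lt.1 (mem_latticeBox.1 h).1).2
    simp at hv
    omega
  | succ n ih =>
    intro v hv
    by_cases h : v ∈ latticeBox N
    · rcases hc v h with h' | h'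
      swap
      · exact h'
      refine Reach.step 0 h' (ih _ ?_)
      push_cast at hv
      simp [latticeDir]
      omega
    · exact Reach.outside h

theorem abs_add_latticeDir_le {N : ℕ} {v : ℤ × ℤ} (hv : v ∈ latticeBox N) (k : Fin 6) :
    |(v + latticeDir k).1| ≤ N ∧ |(v + latticeDir k).2| ≤ N := by
  have h : ∀ k, |(latticeDir k).1| ≤ 1 ∧ |(latticeDir k).2| ≤ 1 := by decide
  have h1 := abs_add_le v.1 (latticeDir k).1
  have h2 := abs_add_le v.2 (latticeDir k).2
  have h3 := h k
  rw [mem_latticeBox] at hv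
  rw [Prod.fst_add, Prod.snd_add]
  omega

namespace IsWeight

variable {N : ℕ} {c : ℤ × ℤ → Fin 6 → ℝ}

theorem le_of_subharmonic (hc : IsWeight N c) {f : ℤ × ℤ → ℝ} {M : ℝ}
    (hout : ∀ v ∉ latticeBox N, |v.1| ≤ N → |v.2| ≤ N → f v ≤ M)
    (hin : ∀ v ∈ latticeBox N, f v ≤ ∑ k, c v k * f (v + latticeDir k)) :
    ∀ v ∈ latticeBox N, f v ≤ M := by
  intro v hv
  obtain ⟨u, hu, hmax⟩ := (finite_latticeBox N).exists_maximalFor f _ ⟨v, hv⟩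
  have hmax' : ∀ w ∈ latticeBox N, f w ≤ f u := fun w hw => by
    rcases le_total (f w) (f u) with h | h
    · exact h
    · exact hmax hw h
  by_contra hcon
  have hM : M < f u := (not_le.1 hcon).trans_le (hmax' v hv)
  have hle : ∀ w : ℤ × ℤ, |w.1| ≤ N → |w.2| ≤ N → f w ≤ f u := fun w h1 h2 => by
    by_cases hw : w ∈ latticeBox N
    · exact hmax' w hw
    · exact (hout w hw h1 h2).trans hM.le
  have key : ∀ w : ℤ × ℤ, Reach N c w → |w.1| ≤ N → |w.2| ≤ N → f w < f u := by
    intro w hw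
    induction hw with
    | outside h => exact fun h1 h2 => (hout _ h h1 h2).trans_lt hM
    | @step w k hk _ ih =>
      intro h1 h2
      by_cases hw : w ∈ latticeBox N
      · have hn := abs_add_latticeDir_le hw
        calc f w ≤ ∑ k, c w k * f (w + latticeDir k) := hin w hw
          _ < ∑ k, c w k * f u := by
            refine Finset.sum_lt_sum (fun l _ => mul_le_mul_of_nonneg_left
              (hle _ (hn l).1 (hn l).2) (hc.nonneg w hw l)) ⟨k, Finset.mem_univ k, ?_⟩
            exact mul_lt_mul_of_pos_left (ih (hn k).1 (hn k).2) hk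
          _ = f u := by rw [← Finset.sum_mul, hc.sum_eq_one w hw, one_mul]
      · exact (hout w hw h1 h2).trans_lt hM
  have hu' := mem_latticeBox.1 hu
  exact lt_irrefl _ (key u (hc.reach u hu) hu'.1.le hu'.2.le)

theorem eq_of_harmonic (hc : IsWeight N c) {f g : ℤ × ℤ → ℝ}
    (hout : ∀ v ∉ latticeBox N, f v = g v)
    (hf : ∀ v ∈ latticeBox N, f v = ∑ k, c v k * f (v + latticeDir k))
    (hg : ∀ v ∈ latticeBox N, g v = ∑ k, c v k * g (v + latticeDir k)) (v : ℤ × ℤ) :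
    f v = g v := by
  by_cases hv : v ∈ latticeBox N
  · have key : ∀ f g : ℤ × ℤ → ℝ, (∀ v ∉ latticeBox N, f v = g v) →
        (∀ v ∈ latticeBox N, f v = ∑ k, c v k * f (v + latticeDir k)) →
        (∀ v ∈ latticeBox N, g v = ∑ k, c v k * g (v + latticeDir k)) → f v ≤ g v := by
      intro f g hout hf hg
      have := hc.le_of_subharmonic (f := fun v => f v - g v) (M := 0)
        (fun v hv _ _ => by rw [hout v hv, sub_self]) (fun v hv => by
          simp only [mul_sub, Finset.sum_sub_distrib, ← hf v hv, ← hg v hv, le_refl]) v hv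
      linarith
    exact le_antisymm (key f g hout hf hg) (key g f (fun v hv => (hout v hv).symm) hg hf)
  · exact hout v hv

end IsWeight

/-- The weights `c` blended with the uniform ones. -/
noncomputable def blendWeight (c : ℤ × ℤ → Fin 6 → ℝ) (ε : ℝ) (v : ℤ × ℤ) (k : Fin 6) : ℝ :=
  c v k * (1 - ε) + 1 / 6 * ε

theorem IsWeight.blend {N : ℕ} {c : ℤ × ℤ → Fin 6 → ℝ} (hc : IsWeight N c) {ε : ℝ} (h0 : 0 ≤ ε)
    (h1 : ε ≤ 1) : IsWeight N (blendWeight c ε) := by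
  refine ⟨fun v hv k => ?_, fun v hv => ?_, fun v hv => ?_⟩
  · have := mul_nonneg (hc.nonneg v hv k) (sub_nonneg.2 h1)
    rw [blendWeight]; linarith
  · simp only [blendWeight, Finset.sum_add_distrib, ← Finset.sum_mul, hc.sum_eq_one v hv]
    simp
  · rcases h0.eq_or_lt with rfl | h0
    · have : blendWeight c 0 = c := by
        funext v k; simp [blendWeight]
      rw [this]; exact hc.reach v hv
    · refine reach_of_pos (fun v hv => Or.inl ?_) (N - v.1).toNat v (by omega)
      have := mul_nonneg (hc.nonneg v hv 0) (sub_nonneg.2 h1)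
      rw [blendWeight]; linarith

open Polynomial in
/-- The harmonic extensions for blended weights depend rationally on the blending parameter. -/
theorem IsWeight.exists_polynomial {N : ℕ} {c : ℤ × ℤ → Fin 6 → ℝ} (hc : IsWeight N c) :
    ∃ P : ℝ[X], (∀ ε, 0 ≤ ε → ε ≤ 1 → P.eval ε ≠ 0) ∧ ∀ g : ℤ × ℤ → ℝ, ∃ Q : ℤ × ℤ → ℝ[X],
      (∀ v ∉ latticeBox N, Q v = C (g v) * P) ∧ ∀ v ∈ latticeBox N, ∀ ε,
        (Q v).eval ε = ∑ k, blendWeight c ε v k * (Q (v + latticeDir k)).eval ε := by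
  classical
  have : Fintype (latticeBox N) := (finite_latticeBox N).fintype
  set l : ℤ × ℤ → Fin 6 → ℝ[X] := fun v k => C (c v k) * (1 - X) + C (1 / 6) * X with hl
  have hlev : ∀ ε v k, (l v k).eval ε = blendWeight c ε v k := fun ε v k => by
    simp [hl, blendWeight]
  set A : Matrix (latticeBox N) (latticeBox N) ℝ[X] := Matrix.of fun v w =>
    (if v = w then 1 else 0) - ∑ k, if (v : ℤ × ℤ) + latticeDir k = w then l v k else 0 with hA
  have hmul : ∀ (F : ℤ × ℤ → ℝ[X]) (v : latticeBox N), (A.mulVec fun w => F w) v =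
      F v - ∑ k, if (v : ℤ × ℤ) + latticeDir k ∈ latticeBox N then
        l v k * F (v + latticeDir k) else 0 := by
    intro F v
    simp only [hA, Matrix.mulVec, dotProduct, Matrix.of_apply, sub_mul, Finset.sum_sub_distrib,
      Finset.sum_mul]
    congr 1
    · simp
    · rw [Finset.sum_comm]
      refine Finset.sum_congr rfl fun k _ => ?_
      split_ifs with h
      · rw [Finset.sum_eq_single ⟨_, h⟩]
        · simp
        · intro w _ hw
          rw [if_neg, zero_mul]
          rintro h'
          exact hw (Subtype.ext h'.symm)
        · simp
      · refine Finset.sum_eq_zero fun w _ => ?_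
        rw [if_neg, zero_mul]
        rintro h'
        exact h (h' ▸ w.2)
  refine ⟨A.det, fun ε h0 h1 hdet => ?_, fun g => ?_⟩
  · have hdet' : (A.map (evalRingHom ε)).det = 0 := by
      rw [← RingHom.mapMatrix_apply, ← RingHom.map_det]; exact hdet
    obtain ⟨x, hx, hx0⟩ := Matrix.exists_mulVec_eq_zero_iff.2 hdet'
    apply hx
    set f : ℤ × ℤ → ℝ := fun v => if h : v ∈ latticeBox N then x ⟨v, h⟩ else 0 with hf
    have hfx : ∀ v : latticeBox N, f v = x v := fun v => by simp [hf]
    have hfo : ∀ v ∉ latticeBox N, f v = 0 := fun v hv => by simp [hf, hv]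
    have hharm : ∀ v ∈ latticeBox N, f v = ∑ k, blendWeight c ε v k * f (v + latticeDir k) := by
      intro v hv
      have h2 := congrArg (Polynomial.eval ε) (hmul (fun w => C (f w)) ⟨v, hv⟩)
      have h3 : eval ε ((A.mulVec fun w : latticeBox N => C (f w)) ⟨v, hv⟩) = 0 := by
        have := congrFun hx0 ⟨v, hv⟩
        rw [← Polynomial.coe_evalRingHom, Matrix.mulVec, dotProduct, map_sum]
        rw [Matrix.mulVec, dotProduct] at this
        rw [Pi.zero_apply] at this
        rw [← this]
        refine Finset.sum_congr rfl fun w _ => ?_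
        simp [hfx]
      rw [h3] at h2
      simp only [eval_sub, eval_finsetSum, eval_C] at h2
      have h4 : f v = ∑ k, eval ε (if v + latticeDir k ∈ latticeBox N then
          l v k * C (f (v + latticeDir k)) else 0) := by linarith
      rw [h4]
      refine Finset.sum_congr rfl fun k _ => ?_
      split_ifs with h
      · rw [eval_mul, eval_C, hlev]
      · rw [hfo _ h, eval_zero, mul_zero]
    funext v
    rw [← hfx v, Pi.zero_apply]
    exact (hc.blend h0 h1).eq_of_harmonic (g := fun _ => 0) hfo hharm (by simp) v
  · set b : latticeBox N → ℝ[X] := fun v => ∑ k,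
      if (v : ℤ × ℤ) + latticeDir k ∈ latticeBox N then 0 else l v k * C (g (v + latticeDir k))
      with hb
    set x : latticeBox N → ℝ[X] := A.adjugate.mulVec b with hx
    have hAx : A.mulVec x = A.det • b := by
      rw [hx, Matrix.mulVec_mulVec, Matrix.mul_adjugate, Matrix.smul_mulVec, Matrix.one_mulVec]
    set Q : ℤ × ℤ → ℝ[X] := fun v => if h : v ∈ latticeBox N then x ⟨v, h⟩ else C (g v) * A.det
      with hQ
    have hQx : (fun w : latticeBox N => Q w) = x := by
      funext v; simp [hQ]
    have hQo : ∀ v ∉ latticeBox N, Q v = C (g v) * A.det := fun v hv => by simp [hQ, hv]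
    refine ⟨Q, hQo, fun v hv ε => ?_⟩
    have h2 := hmul Q ⟨v, hv⟩
    rw [hQx, hAx] at h2
    have h3 : Q v = ∑ k, l v k * Q (v + latticeDir k) := by
      have h4 : Q v = A.det * b ⟨v, hv⟩ + ∑ k, if v + latticeDir k ∈ latticeBox N then
          l v k * Q (v + latticeDir k) else 0 := by
        rw [Pi.smul_apply, smul_eq_mul] at h2
        rw [h2]; ring
      rw [h4, hb, Finset.mul_sum, ← Finset.sum_add_distrib]
      refine Finset.sum_congr rfl fun k _ => ?_
      split_ifs with h
      · ring
      · rw [hQo _ h]; ring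
    rw [h3, eval_finsetSum]
    exact Finset.sum_congr rfl fun k _ => by rw [eval_mul, hlev]

open Polynomial in
/-- The harmonic extension of the lattice embedding is a limit of Tutte maps. -/
theorem IsWeight.exists_tutteMap {N : ℕ} {c : ℤ × ℤ → Fin 6 → ℝ} (hc : IsWeight N c) :
    ∃ φ₀ : ℤ × ℤ → ℂ, (∀ v ∉ latticeBox N, φ₀ v = latticePt v) ∧
      (∀ v ∈ latticeBox N, (φ₀ v).re = ∑ k, c v k * (φ₀ (v + latticeDir k)).re) ∧
      (∀ v ∈ latticeBox N, (φ₀ v).im = ∑ k, c v k * (φ₀ (v + latticeDir k)).im) ∧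
      ∀ r > 0, ∃ φ, TutteMap N φ ∧ ∀ v, dist (φ v) (φ₀ v) < r := by
  obtain ⟨P, hP, hQ⟩ := hc.exists_polynomial
  obtain ⟨Q, hQo, hQi⟩ := hQ fun v => v.1
  obtain ⟨R, hRo, hRi⟩ := hQ fun v => v.2
  set φ : ℝ → ℤ × ℤ → ℂ := fun ε v =>
    ⟨(Q v).eval ε / P.eval ε, (R v).eval ε / P.eval ε⟩ with hφ
  have hout : ∀ ε, 0 ≤ ε → ε ≤ 1 → ∀ v ∉ latticeBox N, φ ε v = latticePt v := by
    intro ε h0 h1 v hv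
    have := hP ε h0 h1
    apply Complex.ext
    · simp [hφ, hQo v hv, this]
    · simp [hφ, hRo v hv, this]
  have hre : ∀ ε, ∀ v ∈ latticeBox N,
      (φ ε v).re = ∑ k, blendWeight c ε v k * (φ ε (v + latticeDir k)).re := by
    intro ε v hv
    simp only [hφ, hQi v hv ε, Finset.sum_div, mul_div_assoc]
  have him : ∀ ε, ∀ v ∈ latticeBox N,
      (φ ε v).im = ∑ k, blendWeight c ε v k * (φ ε (v + latticeDir k)).im := by
    intro ε v hv
    simp only [hφ, hRi v hv ε, Finset.sum_div, mul_div_assoc]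
  have hb0 : blendWeight c 0 = c := by funext v k; simp [blendWeight]
  have hφ1 : ∀ v, φ 1 v = latticePt v := by
    have hw := hc.blend zero_le_one le_rfl
    have h6 : ∀ v k, blendWeight c 1 v k = 1 / 6 := fun v k => by simp [blendWeight]
    intro v
    apply Complex.ext
    · refine hw.eq_of_harmonic (f := fun v => (φ 1 v).re) (g := fun v => (latticePt v).re)
        (fun v hv => by rw [hout 1 zero_le_one le_rfl v hv]) (hre 1) (fun v _ => ?_) v
      simp [Fin.sum_univ_six, h6, latticeDir]
      ring
    · refine hw.eq_of_harmonic (f := fun v => (φ 1 v).im) (g := fun v => (latticePt v).im)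
        (fun v hv => by rw [hout 1 zero_le_one le_rfl v hv]) (him 1) (fun v _ => ?_) v
      simp [Fin.sum_univ_six, h6, latticeDir]
      ring
  set D : (ℤ × ℤ) × Fin 6 → ℝ[X] := fun i =>
    (Q (i.1 + latticeDir i.2) - Q i.1) * (R (i.1 + latticeDir (i.2 + 1)) - R i.1) -
    (R (i.1 + latticeDir i.2) - R i.1) * (Q (i.1 + latticeDir (i.2 + 1)) - Q i.1) with hD
  have hDarea : ∀ ε, 0 ≤ ε → ε ≤ 1 → ∀ v k,
      (D (v, k)).eval ε = TutteMap.area (φ ε) v k * (P.eval ε) ^ 2 := by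
    intro ε h0 h1 v k
    have := hP ε h0 h1
    simp only [hD, TutteMap.area, cross, hφ, Complex.sub_re, Complex.sub_im, eval_sub, eval_mul]
    field_simp
  have hD0 : ∀ i, D i ≠ 0 := by
    rintro ⟨v, k⟩ h
    have h1 := hDarea 1 zero_le_one le_rfl v k
    rw [h, eval_zero, show φ 1 = latticePt from funext hφ1, area_latticePt, one_mul] at h1
    exact pow_ne_zero 2 (hP 1 zero_le_one le_rfl) h1.symm
  have hcount : (⋃ i, {ε | (D i).IsRoot ε}).Countable :=
    countable_iUnion fun i => (finite_setOfPred_isRoot (hD0 i)).countable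
  refine ⟨φ 0, hout 0 le_rfl zero_le_one, by simpa only [hb0] using hre 0,
    by simpa only [hb0] using him 0, fun r hr => ?_⟩
  have hclose : ∀ᶠ ε in 𝓝 (0 : ℝ), ∀ v ∈ latticeBox N, dist (φ ε v) (φ 0 v) < r := by
    rw [eventually_all_finite (finite_latticeBox N)]
    intro v _
    have hcont : ContinuousAt (fun ε => φ ε v) 0 := by
      have h1 : ContinuousAt (fun ε => (Q v).eval ε / P.eval ε) 0 :=
        (Polynomial.continuous _).continuousAt.div (Polynomial.continuous _).continuousAt
          (hP 0 le_rfl zero_le_one)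
      have h2 : ContinuousAt (fun ε => (R v).eval ε / P.eval ε) 0 :=
        (Polynomial.continuous _).continuousAt.div (Polynomial.continuous _).continuousAt
          (hP 0 le_rfl zero_le_one)
      have h3 : (fun ε => φ ε v) = fun ε => Complex.equivRealProdCLM.symm
          ((Q v).eval ε / P.eval ε, (R v).eval ε / P.eval ε) := by
        funext ε
        apply Complex.ext <;> simp [hφ]
      rw [h3]
      exact Complex.equivRealProdCLM.symm.continuous.continuousAt.comp (h1.prodMk h2)
    exact hcont.eventually (Metric.ball_mem_nhds _ hr)
  obtain ⟨δ, hδ, hball⟩ := Metric.eventually_nhds_iff.1 hclose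
  obtain ⟨ε, hε, hε'⟩ := (hcount.dense_compl ℝ).exists_between (lt_min hδ one_pos)
  have h0 : 0 < ε := hε'.1
  have hεδ : ε < δ := hε'.2.trans_le (min_le_left _ _)
  have h1 : ε ≤ 1 := (hε'.2.trans_le (min_le_right _ _)).le
  have hw := hc.blend h0.le h1
  refine ⟨φ ε, ⟨hout ε h0.le h1, fun v hv => ⟨blendWeight c ε v, fun k => ?_, ?_⟩, fun v k h => ?_,
    fun v hv => ?_⟩, fun v => ?_⟩
  · have := mul_nonneg (hc.nonneg v hv k) (sub_nonneg.2 h1)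
    rw [blendWeight]; linarith
  · have hs := hw.sum_eq_one v hv
    apply Complex.ext
    · simp only [Complex.re_sum, Complex.re_ofReal_mul, Complex.sub_re]
      simp only [mul_sub, Finset.sum_sub_distrib, ← Finset.sum_mul, hs, ← hre ε v hv, one_mul,
        sub_self, Complex.zero_re]
    · simp only [Complex.im_sum, Complex.im_ofReal_mul, Complex.sub_im]
      simp only [mul_sub, Finset.sum_sub_distrib, ← Finset.sum_mul, hs, ← him ε v hv, one_mul,
        sub_self, Complex.zero_im]
  · refine hε (mem_iUnion.2 ⟨(v, k), ?_⟩)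
    rw [mem_ofPred_eq, IsRoot, hDarea ε h0.le h1, TutteMap.area, h, zero_mul]
  · have := hw.le_of_subharmonic (f := fun v => -(φ ε v).im) (M := N) (fun v hv _ h2 => ?_)
      (fun v hv => ?_) v hv
    · linarith
    · rw [hout ε h0.le h1 v hv, latticePt_im]
      have h3 : -v.2 ≤ (N : ℤ) := (neg_le_abs _).trans h2
      exact_mod_cast h3
    · simp only [mul_neg, Finset.sum_neg_distrib, ← him ε v hv, le_refl]
  · by_cases hv : v ∈ latticeBox N
    · exact hball (by rw [Real.dist_eq, sub_zero, abs_of_pos h0]; exact hεδ) v hv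
    · rw [hout ε h0.le h1 v hv, hout 0 le_rfl zero_le_one v hv, dist_self]
      exact hr

/-! ### Lattice chains along preimages of segments -/

/-- Two lattice points are joined by a lattice path staying near a connected set
containing nearby points. -/
theorem IsPreconnected.reflTransGen_floor {X : Set ℂ} (hX : IsPreconnected X)
    {G : ℤ × ℤ → Prop} (hG : ∀ x ∈ X, ∀ v, dist (latticePt v) x ≤ 3 → G v) {x y : ℂ}
    (hx : x ∈ X) (hy : y ∈ X) :
    Relation.ReflTransGen (fun v w => (∃ k, w = v + latticeDir k) ∧ G v ∧ G w)
      (⌊x.re⌋, ⌊x.im⌋) (⌊y.re⌋, ⌊y.im⌋) := by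
  set R : ℤ × ℤ → ℤ × ℤ → Prop := fun v w => (∃ k, w = v + latticeDir k) ∧ G v ∧ G w with hR
  have hsymm : Std.Symm R := by
    refine ⟨?_⟩
    rintro v w ⟨⟨k, rfl⟩, h1, h2⟩
    refine ⟨⟨k + 3, ?_⟩, h2, h1⟩
    rw [latticeDir_add_three, add_neg_cancel_right]
  have hhor : ∀ a b c : ℤ, |b - a| ≤ 1 → G (a, c) → G (b, c) →
      Relation.ReflTransGen R (a, c) (b, c) := by
    intro a b c hab h1 h2
    rw [abs_le] at hab
    obtain h | h | h : b = a ∨ b = a + 1 ∨ b = a + -1 := by omega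
    · rw [h]
    · exact .single ⟨⟨0, by simp [latticeDir, h]⟩, h1, h2⟩
    · exact .single ⟨⟨3, by simp [latticeDir, h]⟩, h1, h2⟩
  have hver : ∀ a b c : ℤ, |b - a| ≤ 1 → G (c, a) → G (c, b) →
      Relation.ReflTransGen R (c, a) (c, b) := by
    intro a b c hab h1 h2
    rw [abs_le] at hab
    obtain h | h | h : b = a ∨ b = a + 1 ∨ b = a + -1 := by omega
    · rw [h]
    · exact .single ⟨⟨2, by simp [latticeDir, h]⟩, h1, h2⟩
    · exact .single ⟨⟨5, by simp [latticeDir, h]⟩, h1, h2⟩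
  have hfl : ∀ a b : ℝ, |b - a| < 1 → |⌊b⌋ - ⌊a⌋| ≤ 1 := by
    intro a b h
    rw [abs_lt] at h
    have h1 : ⌊b⌋ < ⌊a⌋ + 2 := by
      rw [Int.floor_lt]; push_cast; linarith [Int.lt_floor_add_one a]
    have h2 : ⌊a⌋ < ⌊b⌋ + 2 := by
      rw [Int.floor_lt]; push_cast; linarith [Int.lt_floor_add_one b]
    rw [abs_le]; omega
  refine hX.induction₂ (fun x y => Relation.ReflTransGen R (⌊x.re⌋, ⌊x.im⌋) (⌊y.re⌋, ⌊y.im⌋))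
    (fun x hx => ?_) (fun _ _ _ _ _ _ h1 h2 => h1.trans h2)
    (fun _ _ _ _ h => Relation.ReflTransGen.stdSymm.symm _ _ h) hx hy
  have hnear : ∀ x ∈ X, ∀ a b : ℤ, |(a : ℝ) - x.re| ≤ 2 → |(b : ℝ) - x.im| ≤ 1 → G (a, b) := by
    intro x hx a b h1 h2
    refine hG x hx (a, b) ?_
    rw [dist_eq_norm]
    have := Complex.norm_le_abs_re_add_abs_im (latticePt (a, b) - x)
    simp only [Complex.sub_re, Complex.sub_im, latticePt_re, latticePt_im] at this
    linarith
  have hfl' : ∀ a : ℝ, |(⌊a⌋ : ℝ) - a| ≤ 1 := fun a => by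
    rw [abs_le]; constructor <;> linarith [Int.floor_le a, Int.lt_floor_add_one a]
  filter_upwards [self_mem_nhdsWithin, mem_nhdsWithin_of_mem_nhds (Metric.ball_mem_nhds x one_pos)]
    with y hy hyx
  rw [Metric.mem_ball, dist_eq_norm] at hyx
  have hre : |y.re - x.re| < 1 := (Complex.abs_re_le_norm (y - x)).trans_lt hyx
  have him : |y.im - x.im| < 1 := (Complex.abs_im_le_norm (y - x)).trans_lt hyx
  have h1 : G (⌊x.re⌋, ⌊x.im⌋) := hnear x hx _ _ ((hfl' _).trans one_le_two) (hfl' _)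
  have h2 : G (⌊y.re⌋, ⌊x.im⌋) := by
    refine hnear x hx _ _ ?_ (hfl' _)
    have := abs_sub_le (⌊y.re⌋ : ℝ) y.re x.re
    linarith [hfl' y.re]
  have h3 : G (⌊y.re⌋, ⌊y.im⌋) := hnear y hy _ _ ((hfl' _).trans one_le_two) (hfl' _)
  exact (hhor _ _ _ (hfl _ _ hre) h1 h2).trans (hver _ _ _ (hfl _ _ him) h2 h3)

/-- A chain of ranked vertices leading from `p` to `q` can be made injective,
with only its ends in `p` and `q`. -/
theorem exists_simple_chain {V : Type*} {A : V → V → Prop} {G : V × ℤ → Prop} {p q : V → Prop}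
    {a b : V × ℤ}
    (h : Relation.ReflTransGen
      (fun s t : V × ℤ => (s.1 = t.1 ∨ A s.1 t.1) ∧ s.2 ≤ t.2 ∧ G s ∧ G t) a b)
    (ha : p a.1) (hb : q b.1) (hpq : ∀ v, p v → ¬q v) :
    ∃ (L : ℕ) (u : ℕ → V) (r : ℕ → ℤ), 0 < L ∧ p (u 0) ∧ q (u L) ∧
      (∀ k, 0 < k → k < L → ¬p (u k) ∧ ¬q (u k)) ∧
      (∀ k ≤ L, ∀ k' ≤ L, u k = u k' → k = k') ∧
      (∀ k < L, A (u k) (u (k + 1)) ∧ r k ≤ r (k + 1)) ∧ ∀ k ≤ L, G (u k, r k) := by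
  classical
  set R : V × ℤ → V × ℤ → Prop :=
    fun s t => (s.1 = t.1 ∨ A s.1 t.1) ∧ s.2 ≤ t.2 ∧ G s ∧ G t with hR
  have hex : ∃ L : ℕ, ∃ σ : ℕ → V × ℤ, (∀ k < L, R (σ k) (σ (k + 1))) ∧ p (σ 0).1 ∧
      q (σ L).1 := by
    have : ∃ L : ℕ, ∃ σ : ℕ → V × ℤ, (∀ k < L, R (σ k) (σ (k + 1))) ∧ σ 0 = a ∧ σ L = b := by
      clear hb
      induction h with
      | refl => exact ⟨0, fun _ => a, by simp, rfl, rfl⟩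
      | @tail b c _ hbc ih =>
        obtain ⟨L, σ, h1, h2, h3⟩ := ih
        refine ⟨L + 1, fun k => if k ≤ L then σ k else c, fun k hk => ?_, by simp [h2], by simp⟩
        rcases Nat.lt_succ_iff_lt_or_eq.1 hk with h | h
        · simpa [h.le, Nat.succ_le_of_lt h] using h1 k h
        · subst h
          simpa [h3] using hbc
    obtain ⟨L, σ, h1, h2, h3⟩ := this
    exact ⟨L, σ, h1, by rwa [h2], by rwa [h3]⟩
  obtain ⟨σ, hσ, hp, hq⟩ := Nat.find_spec hex
  have hmin : ∀ M < Nat.find hex, ∀ σ : ℕ → V × ℤ, (∀ k < M, R (σ k) (σ (k + 1))) →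
      p (σ 0).1 → ¬q (σ M).1 := fun M hM σ h1 h2 h3 => Nat.find_min hex hM ⟨σ, h1, h2, h3⟩
  set L := Nat.find hex with hL
  clear_value L
  have hL0 : 0 < L := by
    rcases Nat.eq_zero_or_pos L with h | h
    · subst h; exact absurd hq (hpq _ hp)
    · exact h
  have hmono : ∀ i j, i ≤ j → j ≤ L → (σ i).2 ≤ (σ j).2 := by
    intro i j hij
    induction j, hij using Nat.le_induction with
    | base => exact fun _ => le_rfl
    | succ j _ ih => exact fun hj => (ih (by omega)).trans (hσ j (by omega)).2.1
  have hq' : ∀ k < L, ¬q (σ k).1 := fun k hk =>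
    hmin k hk σ (fun i hi => hσ i (by omega)) hp
  have hp' : ∀ k, 0 < k → k ≤ L → ¬p (σ k).1 := fun k hk hkL h =>
    hmin (L - k) (by omega) (fun i => σ (i + k))
      (fun i hi => by
        have := hσ (i + k) (by omega)
        rwa [add_right_comm] at this)
      (by simpa using h) (by simpa [Nat.sub_add_cancel hkL] using hq)
  have hinj : ∀ i j, i < j → j ≤ L → (σ i).1 ≠ (σ j).1 := by
    intro i j hij hjL h
    rcases hjL.lt_or_eq with hj | hj
    · refine hmin (L - (j - i)) (by omega) (fun k => if k ≤ i then σ k else σ (k + (j - i)))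
        (fun k hk => ?_) (by simpa using hp) ?_
      · rcases lt_trichotomy k i with h1 | h1 | h1
        · simpa [h1.le, Nat.succ_le_of_lt h1] using hσ k (by omega)
        · subst h1
          have h2 := hσ j hj
          have h3 := hσ k (by omega)
          have h4 : k + 1 + (j - k) = j + 1 := by omega
          simp only [le_refl, if_true, Nat.not_succ_le_self, if_false, h4]
          exact ⟨by rw [h]; exact h2.1, (hmono k j hij.le hjL).trans h2.2.1, h3.2.2.1, h2.2.2.2⟩
        · have h2 := hσ (k + (j - i)) (by omega)
          rw [add_right_comm] at h2
          simpa [not_le.2 h1, not_le.2 (h1.trans (Nat.lt_succ_self k))] using h2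
      · have h1 : ¬(L - (j - i) ≤ i) := by omega
        have h2 : L - (j - i) + (j - i) = L := by omega
        simpa only [h1, if_false, h2] using hq
    · subst hj
      exact hq' i hij (h ▸ hq)
  refine ⟨L, fun k => (σ k).1, fun k => (σ k).2, hL0, hp, hq,
    fun k h1 h2 => ⟨hp' k h1 h2.le, hq' k h2⟩, fun k hk k' hk' h => ?_,
    fun k hk => ⟨(hσ k hk).1.resolve_left (hinj k (k + 1) (Nat.lt_succ_self k) hk), (hσ k hk).2.1⟩,
    fun k hk => ?_⟩
  · by_contra hne
    rcases lt_or_gt_of_ne hne with h1 | h1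
    · exact hinj k k' h1 hk' h
    · exact hinj k' k h1 hk h.symm
  · rcases hk.lt_or_eq with h | h
    · exact (hσ k h).2.2.1
    · have := (hσ (k - 1) (by omega)).2.2.2
      rwa [Nat.sub_add_cancel (by omega)] at this

/-! ### Rows and columns -/

/-- A continuous self-map of the plane with connected fibres, equal to the identity off a box. -/
structure BoxMonotone (N : ℝ) (H : ℂ → ℂ) : Prop where
  continuous : Continuous H
  eq_self : ∀ x : ℂ, ¬(|x.re| < N ∧ |x.im| < N) → H x = x
  fiber : ∀ b, IsConnected (H ⁻¹' ({b} : Set ℂ))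

/-- A lattice path crossing the box from left to right near the preimage of the line at height
`j * ℓ`, along which the real part of `H` is close to the nondecreasing function `r * ℓ`. -/
structure IsRow (H : ℂ → ℂ) (n ℓ : ℕ) (η : ℝ) (j : ℤ) (L : ℕ) (u : ℕ → ℤ × ℤ) (r : ℕ → ℤ) :
    Prop where
  pos : 0 < L
  left : (u 0).1 ≤ -(n * ℓ : ℕ)
  right : (n * ℓ : ℕ) ≤ (u L).1
  inner : ∀ k, 0 < k → k < L → u k ∈ latticeBox (n * ℓ)
  inj : ∀ k ≤ L, ∀ k' ≤ L, u k = u k' → k = k'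
  adj : ∀ k < L, ∃ d, u (k + 1) = u k + latticeDir d
  mono : ∀ k < L, r k ≤ r (k + 1)
  near_im : ∀ k ≤ L, |(H (latticePt (u k))).im - j * ℓ| ≤ η
  near_re : ∀ k ≤ L, |(H (latticePt (u k))).re - r k * ℓ| ≤ ℓ + η

/-- A lattice path crossing the box from bottom to top near the preimage of the vertical line at
abscissa `i * ℓ`. -/
structure IsColumn (H : ℂ → ℂ) (n ℓ : ℕ) (η : ℝ) (i : ℤ) (L : ℕ) (u : ℕ → ℤ × ℤ) : Prop where
  bottom : (u 0).2 ≤ -(n * ℓ : ℕ)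
  top : (n * ℓ : ℕ) ≤ (u L).2
  inner : ∀ k, 0 < k → k < L → u k ∈ latticeBox (n * ℓ)
  inj : ∀ k ≤ L, ∀ k' ≤ L, u k = u k' → k = k'
  adj : ∀ k < L, ∃ d, u (k + 1) = u k + latticeDir d
  near_re : ∀ k ≤ L, |(H (latticePt (u k))).re - i * ℓ| ≤ η

namespace BoxMonotone

variable {N : ℝ} {H : ℂ → ℂ}

theorem isClosedMap (hH : BoxMonotone N H) : IsClosedMap H := by
  refine (isProperMap_iff_tendsto_cocompact.2 ⟨hH.continuous, tendsto_id.congr' ?_⟩).isClosedMap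
  rw [← Metric.cobounded_eq_cocompact, ← comap_norm_atTop]
  filter_upwards [(eventually_ge_atTop (N + N : ℝ)).comap norm] with x hx
  refine (hH.eq_self x fun h => ?_).symm
  have := Complex.norm_le_abs_re_add_abs_im x
  linarith [h.1, h.2]

theorem isPreconnected_preimage (hH : BoxMonotone N H) {C : Set ℂ} (hC : IsPreconnected C) :
    IsPreconnected (H ⁻¹' C) := by
  have := hC.inter_preimage_of_fibers (f := H) (K := univ)
    (fun F hF => by simpa using hH.isClosedMap F hF) (fun y _ => by simpa using hH.fiber y)
  simpa using this

theorem exists_row {n ℓ : ℕ} (hH : BoxMonotone (n * ℓ : ℕ) H) (hℓ : 0 < ℓ) {η : ℝ}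
    (hη : η < ℓ) (hmod : ∀ x y, dist x y ≤ 4 → dist (H x) (H y) ≤ η) {j : ℤ} (hj : |j| < n) :
    ∃ L u r, IsRow H n ℓ η j L u r := by
  have hℓ' : (0 : ℝ) < ℓ := by exact_mod_cast hℓ
  have hn : (0 : ℤ) < n := (abs_nonneg j).trans_lt hj
  have hchoose : ∀ m : ℤ, ∃ x : ℂ, H x = ⟨m * ℓ, j * ℓ⟩ ∧ (|m| = n → x = ⟨m * ℓ, j * ℓ⟩) := by
    intro m
    by_cases hm : |m| = n
    · refine ⟨⟨m * ℓ, j * ℓ⟩, hH.eq_self _ fun h => ?_, fun _ => rfl⟩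
      have h1 : |(m : ℝ) * ℓ| < (n * ℓ : ℕ) := h.1
      rw [abs_mul, abs_of_pos hℓ', ← Int.cast_abs, hm] at h1
      simp at h1
    · obtain ⟨x, hx⟩ := (hH.fiber ⟨m * ℓ, j * ℓ⟩).nonempty
      exact ⟨x, hx, fun h => absurd h hm⟩
  choose x hx hx' using hchoose
  set fl : ℂ → ℤ × ℤ := fun x => (⌊x.re⌋, ⌊x.im⌋) with hfl
  set G : (ℤ × ℤ) × ℤ → Prop := fun s => |(H (latticePt s.1)).im - j * ℓ| ≤ η ∧
    |(H (latticePt s.1)).re - s.2 * ℓ| ≤ ℓ + η with hG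
  have hseg : ∀ m : ℤ, ∀ y, (H y).im = j * ℓ → m * ℓ ≤ (H y).re → (H y).re ≤ (m + 1) * ℓ →
      ∀ v, dist (latticePt v) y ≤ 3 → G (v, m) := by
    intro m y h1 h2 h3 v hv
    have h4 := hmod _ _ (hv.trans (by norm_num))
    rw [dist_eq_norm] at h4
    have h5 := (Complex.abs_im_le_norm _).trans h4
    have h6 := (Complex.abs_re_le_norm _).trans h4
    rw [Complex.sub_im, h1] at h5
    rw [Complex.sub_re] at h6
    refine ⟨h5, ?_⟩
    show |(H (latticePt v)).re - m * ℓ| ≤ ℓ + η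
    rw [abs_le] at h6 ⊢
    constructor <;> linarith
  have hstep : ∀ m : ℤ, Relation.ReflTransGen
      (fun s t : (ℤ × ℤ) × ℤ => (s.1 = t.1 ∨ ∃ d, t.1 = s.1 + latticeDir d) ∧ s.2 ≤ t.2 ∧ G s ∧ G t)
      (fl (x m), m) (fl (x (m + 1)), m) := by
    intro m
    have hconv : Convex ℝ {z : ℂ | z.im = j * ℓ ∧ m * ℓ ≤ z.re ∧ z.re ≤ (m + 1) * ℓ} := by
      have h1 := (convex_singleton (𝕜 := ℝ) ((j : ℝ) * ℓ)).linear_preimage Complex.imLm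
      have h2 := (convex_Icc ((m : ℝ) * ℓ) ((m + 1) * ℓ)).linear_preimage Complex.reLm
      exact h1.inter h2
    have h1 := (hH.isPreconnected_preimage hconv.isPreconnected).reflTransGen_floor
      (G := fun v => G (v, m)) (fun y hy v hv => hseg m y hy.1 hy.2.1 hy.2.2 v hv)
      (x := x m) (y := x (m + 1)) (by simp [hx]; nlinarith) (by simp [hx]; nlinarith)
    exact h1.lift (fun v => (v, m)) fun v w h => ⟨Or.inr h.1, le_rfl, h.2.1, h.2.2⟩
  have hfloor : ∀ y : ℂ, dist (latticePt (fl y)) y ≤ 3 := by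
    intro y
    rw [dist_eq_norm]
    refine (Complex.norm_le_abs_re_add_abs_im _).trans ?_
    have h : ∀ a : ℝ, |(⌊a⌋ : ℝ) - a| ≤ 1 := fun a => by
      rw [abs_le]; constructor <;> linarith [Int.floor_le a, Int.lt_floor_add_one a]
    simp only [hfl, Complex.sub_re, Complex.sub_im, latticePt_re, latticePt_im]
    linarith [h y.re, h y.im]
  have hchain : ∀ t : ℕ, Relation.ReflTransGen
      (fun s t : (ℤ × ℤ) × ℤ => (s.1 = t.1 ∨ ∃ d, t.1 = s.1 + latticeDir d) ∧ s.2 ≤ t.2 ∧ G s ∧ G t)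
      (fl (x (-n)), -(n : ℤ)) (fl (x (-n + t)), -n + t) := by
    intro t
    induction t with
    | zero => simp only [Nat.cast_zero, add_zero]; exact .refl
    | succ t ih =>
      rw [Nat.cast_succ, ← add_assoc]
      generalize (-n + t : ℤ) = m at ih
      refine (ih.trans (hstep m)).tail ⟨Or.inl rfl, ?_, hseg _ (x (m + 1)) ?_ ?_ ?_ _ (hfloor _),
        hseg _ (x (m + 1)) ?_ ?_ ?_ _ (hfloor _)⟩
      all_goals simp [hx]
      all_goals nlinarith
  have hend := hchain (2 * n)
  rw [show (-n + (2 * n : ℕ) : ℤ) = n by push_cast; ring] at hend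
  have hfl1 : (fl (x (-n))).1 = -(n * ℓ : ℕ) := by
    rw [hx' (-n) (by simp), hfl]
    show ⌊((-(n : ℤ) : ℤ) : ℝ) * ℓ⌋ = _
    rw [show ((-(n : ℤ) : ℤ) : ℝ) * ℓ = ((-(n * ℓ : ℕ) : ℤ) : ℝ) by push_cast; ring,
      Int.floor_intCast]
  have hfl2 : (fl (x n)).1 = (n * ℓ : ℕ) := by
    rw [hx' n (by simp), hfl]
    show ⌊((n : ℤ) : ℝ) * ℓ⌋ = _
    rw [show ((n : ℤ) : ℝ) * ℓ = (((n * ℓ : ℕ) : ℤ) : ℝ) by push_cast; ring, Int.floor_intCast]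
  have hpos : 0 < n * ℓ := Nat.mul_pos (by exact_mod_cast hn) hℓ
  obtain ⟨L, u, r, h1, h2, h3, h4, h5, h6, h7⟩ := exists_simple_chain hend
    (A := fun v w => ∃ d, w = v + latticeDir d)
    (p := fun v : ℤ × ℤ => v.1 ≤ -(n * ℓ : ℕ)) (q := fun v : ℤ × ℤ => (n * ℓ : ℕ) ≤ v.1)
    hfl1.le hfl2.ge
    (fun v hv hv' => by omega)
  refine ⟨L, u, r, h1, h2, h3, fun k hk hkL => ?_, h5, fun k hk => (h6 k hk).1,
    fun k hk => (h6 k hk).2, fun k hk => (h7 k hk).1, fun k hk => (h7 k hk).2⟩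
  have h8 := h4 k hk hkL
  refine mem_latticeBox.2 ⟨by rw [abs_lt]; omega, ?_⟩
  by_contra hcon
  have h9 : |(H (latticePt (u k))).im - j * ℓ| ≤ η := (h7 k hkL.le).1
  rw [hH.eq_self _ fun h => hcon ?_, latticePt_im] at h9
  swap
  · have h' : |((u k).2 : ℝ)| < (n * ℓ : ℕ) := h.2
    exact_mod_cast h'
  have h10 : (n * ℓ : ℝ) ≤ |((u k).2 : ℝ)| := by exact_mod_cast not_lt.1 hcon
  have h11 : |(j : ℝ)| ≤ n - 1 := by
    have : |j| ≤ (n : ℤ) - 1 := by omega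
    exact_mod_cast this
  have h12 := abs_sub_abs_le_abs_sub ((u k).2 : ℝ) (j * ℓ)
  rw [abs_mul, abs_of_pos hℓ'] at h12
  nlinarith

open ComplexConjugate in
/-- Conjugation by the reflection exchanging the coordinates. -/
theorem swap (hH : BoxMonotone N H) :
    BoxMonotone N fun z => Complex.I * conj (H (Complex.I * conj z)) := by
  have hinv : ∀ z : ℂ, Complex.I * conj (Complex.I * conj z) = z := fun z => by
    apply Complex.ext <;> simp
  refine ⟨?_, fun x hx => ?_, fun b => ?_⟩
  · exact continuous_const.mul (Complex.continuous_conj.comp (hH.continuous.comp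
      (continuous_const.mul Complex.continuous_conj)))
  · rw [hH.eq_self _ fun h => hx ?_, hinv]
    simpa [and_comm] using h
  · have h := (hH.fiber (Complex.I * conj b)).image (fun z => Complex.I * conj z)
      (continuous_const.mul Complex.continuous_conj).continuousOn
    convert h using 1
    ext z
    constructor
    · intro hz
      have hz' : Complex.I * conj (H (Complex.I * conj z)) = b := hz
      exact ⟨Complex.I * conj z, by rw [mem_preimage, mem_singleton_iff, ← hz', hinv], hinv z⟩
    · rintro ⟨y, hy, rfl⟩
      have hy' : H y = Complex.I * conj b := hy
      show Complex.I * conj (H (Complex.I * conj (Complex.I * conj y))) = b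
      rw [hinv, hy', hinv]

open ComplexConjugate in
theorem exists_column {n ℓ : ℕ} (hH : BoxMonotone (n * ℓ : ℕ) H) (hℓ : 0 < ℓ) {η : ℝ}
    (hη : η < ℓ) (hmod : ∀ x y, dist x y ≤ 4 → dist (H x) (H y) ≤ η) {i : ℤ} (hi : |i| < n) :
    ∃ L u, IsColumn H n ℓ η i L u := by
  have hdist : ∀ x y : ℂ, dist (Complex.I * conj x) (Complex.I * conj y) = dist x y := by
    intro x y
    rw [dist_eq_norm, dist_eq_norm, ← mul_sub, ← map_sub, norm_mul, Complex.norm_I, one_mul,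
      Complex.norm_conj]
  obtain ⟨L, u, r, h⟩ := hH.swap.exists_row hℓ hη
    (fun x y hxy => by rw [hdist]; exact hmod _ _ (by rwa [hdist])) hi
  have hdir : ∀ d, ∃ d', (latticeDir d).swap = latticeDir d' := by decide
  refine ⟨L, fun k => (u k).swap, h.left, h.right,
    fun k h1 h2 => (mem_latticeBox.1 (h.inner k h1 h2)).symm,
    fun k hk k' hk' he => h.inj k hk k' hk' (Prod.swap_injective he), fun k hk => ?_,
    fun k hk => ?_⟩
  · obtain ⟨d, hd⟩ := h.adj k hk
    obtain ⟨d', hd'⟩ := hdir d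
    exact ⟨d', by rw [hd, Prod.swap_add, hd']⟩
  · have h1 := h.near_im k hk
    have h2 : Complex.I * conj (latticePt (u k)) = latticePt (u k).swap := by
      apply Complex.ext <;> simp
    rw [h2] at h1
    simpa using h1

end BoxMonotone

/-! ### The weights attached to rows and columns -/

/-- Maximum principle along a chain. -/
theorem le_of_avg_chain {L : ℕ} {g : ℕ → ℝ} {M : ℝ}
    (h : ∀ k ≤ L, g k ≤ M ∨ ∃ i a b, k = i + 1 ∧ i + 1 < L ∧ 0 < a ∧ 0 < b ∧ a + b = 1 ∧
      g (i + 1) ≤ a * g i + b * g (i + 2)) : ∀ k ≤ L, g k ≤ M := by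
  classical
  intro k hk
  by_contra! hcon
  obtain ⟨m, hm, hmax⟩ := Finset.exists_max_image (Finset.range (L + 1)) g ⟨0, by simp⟩
  have hmax' : ∀ k ≤ L, g k ≤ g m := fun k hk => hmax k (by simpa using Nat.lt_succ_of_le hk)
  have hex : ∃ k, k ≤ L ∧ g m ≤ g k := ⟨m, by simpa using Nat.le_of_lt_succ (by simpa using hm),
    le_rfl⟩
  obtain ⟨h1, h2⟩ := Nat.find_spec hex
  have hmin : ∀ i < Nat.find hex, i ≤ L → g i < g m := fun i hi hiL =>
    not_le.1 fun h => Nat.find_min hex hi ⟨hiL, h⟩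
  rcases h _ h1 with h3 | ⟨i, a, b, h3, h4, ha, hb, hab, h5⟩
  · linarith [hmax' k hk]
  · rw [h3] at h2
    have h6 := hmin i (by omega) (by omega)
    have h7 := hmax' (i + 2) (by omega)
    have h8 := mul_lt_mul_of_pos_left h6 ha
    have h9 := mul_le_mul_of_nonneg_left h7 hb.le
    have h10 : a * g m + b * g m = g m := by rw [← add_mul, hab, one_mul]
    linarith

theorem exists_avg_weight {v p q : ℤ × ℤ} (hp : ∃ d, v = p + latticeDir d)
    (hq : ∃ d, q = v + latticeDir d) {a b : ℝ} (ha : 0 < a) (hb : 0 < b) (hab : a + b = 1) :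
    ∃ w : Fin 6 → ℝ, (∀ k, 0 ≤ w k) ∧ ∑ k, w k = 1 ∧
      ∀ f : ℤ × ℤ → ℝ, ∑ k, w k * f (v + latticeDir k) = a * f p + b * f q := by
  obtain ⟨d, rfl⟩ := hp
  obtain ⟨d', rfl⟩ := hq
  refine ⟨fun k => (if k = d + 3 then a else 0) + if k = d' then b else 0, fun k => ?_, ?_,
    fun f => ?_⟩
  · positivity
  · simp [Finset.sum_add_distrib, hab]
  · simp [add_mul, Finset.sum_add_distrib, ite_mul, latticeDir_add_three]

theorem Reach.of_avg {N : ℕ} {c : ℤ × ℤ → Fin 6 → ℝ} {v p q : ℤ × ℤ} {a b : ℝ} (ha : 0 < a)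
    (hb : 0 < b)
    (h : ∀ f : ℤ × ℤ → ℝ, ∑ k, c v k * f (v + latticeDir k) = a * f p + b * f q)
    (hq : Reach N c q) : Reach N c v := by
  classical
  have h1 := h fun w => if w = q then 1 else 0
  have h2 : 0 < ∑ k, c v k * if v + latticeDir k = q then (1 : ℝ) else 0 := by
    rw [h1, if_pos rfl]
    split_ifs <;> linarith
  obtain ⟨k, -, hk⟩ := Finset.exists_lt_of_sum_lt (s := Finset.univ)
    (f := fun _ : Fin 6 => (0 : ℝ)) (by simpa using h2)
  split_ifs at hk with h3
  · exact Reach.step k (by simpa using hk) (h3 ▸ hq)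
  · simp at hk

theorem Reach.of_chain {N : ℕ} {c : ℤ × ℤ → Fin 6 → ℝ} {L : ℕ} {u : ℕ → ℤ × ℤ}
    (hL : Reach N c (u L)) (h : ∀ k < L, Reach N c (u (k + 1)) → Reach N c (u k)) :
    ∀ k ≤ L, Reach N c (u k) := fun _ hk =>
  Nat.decreasingInduction (motive := fun k _ => Reach N c (u k)) h hL hk

theorem int_eq_of_abs_sub_le {x η : ℝ} {ℓ : ℕ} (hη : 2 * η < ℓ) {i j : ℤ} (hi : |x - i * ℓ| ≤ η)
    (hj : |x - j * ℓ| ≤ η) : i = j := by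
  by_contra hne
  have h1 : (1 : ℝ) ≤ |(i : ℝ) - j| := by
    have : 1 ≤ |i - j| := Int.one_le_abs (sub_ne_zero.2 hne)
    exact_mod_cast this
  have h2 := abs_sub_le (i * ℓ : ℝ) x (j * ℓ)
  rw [abs_sub_comm _ x, ← sub_mul, abs_mul, Nat.abs_cast] at h2
  nlinarith [Nat.cast_nonneg (α := ℝ) ℓ]

theorem exists_convex_combo {x y z : ℝ} (hxy : x < y) (hyz : y < z) :
    ∃ a b : ℝ, 0 < a ∧ 0 < b ∧ a + b = 1 ∧ a * x + b * z = y := by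
  have : y ∈ openSegment ℝ x z := by
    rw [openSegment_eq_Ioo (hxy.trans hyz)]; exact ⟨hxy, hyz⟩
  simpa [openSegment] using this

theorem abs_combo_sub_le {a b x y z J J₁ J₂ : ℝ} (ha : 0 < a) (hb : 0 < b)
    (hx : x = a * y + b * z) (hJ : a * J₁ + b * J₂ = J) :
    |x - J| ≤ a * |y - J₁| + b * |z - J₂| := by
  have h := abs_add_le (a * (y - J₁)) (b * (z - J₂))
  rw [abs_mul, abs_mul, abs_of_pos ha, abs_of_pos hb] at h
  rw [hx, ← hJ]
  refine le_trans (le_of_eq ?_) h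
  congr 1; ring

namespace BoxMonotone

variable {H : ℂ → ℂ}

/-- A lattice embedding which roughly straightens all rows and columns. -/
theorem exists_tutteMap {n ℓ : ℕ} (hH : BoxMonotone (n * ℓ : ℕ) H) (hℓ : 0 < ℓ) {η : ℝ}
    (hη0 : 0 < η) (hη : 2 * η < ℓ) (hmod : ∀ x y, dist x y ≤ 4 → dist (H x) (H y) ≤ η) :
    ∃ φ, TutteMap (n * ℓ) φ ∧
      (∀ j : ℤ, |j| < n → ∃ L u r, IsRow H n ℓ η j L u r ∧
        ∀ k ≤ L, |(φ (u k)).im - j * ℓ| ≤ 2 * ℓ + 6 * η) ∧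
      ∀ i : ℤ, |i| < n → ∃ L u, IsColumn H n ℓ η i L u ∧
        ∀ k ≤ L, |(φ (u k)).re - i * ℓ| ≤ 2 * ℓ + 6 * η := by
  classical
  have hR : ∀ j : ℤ, ∃ L u r, |j| < n → IsRow H n ℓ η j L u r := by
    intro j
    by_cases hj : |j| < n
    · obtain ⟨L, u, r, h⟩ := hH.exists_row hℓ (by linarith) hmod hj
      exact ⟨L, u, r, fun _ => h⟩
    · exact ⟨0, fun _ => 0, fun _ => 0, fun h => absurd h hj⟩
  have hC : ∀ i : ℤ, ∃ L u, |i| < n → IsColumn H n ℓ η i L u := by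
    intro i
    by_cases hi : |i| < n
    · obtain ⟨L, u, h⟩ := hH.exists_column hℓ (by linarith) hmod hi
      exact ⟨L, u, fun _ => h⟩
    · exact ⟨0, fun _ => 0, fun h => absurd h hi⟩
  choose L u r hrow using hR
  choose K w hcol using hC
  set s : ℤ → ℕ → ℝ := fun j k => r j k * ℓ + η / L j * k with hs
  have hs_lt : ∀ j : ℤ, |j| < n → ∀ k < L j, s j k < s j (k + 1) := by
    intro j hj k hk
    have h1 : (r j k : ℝ) ≤ r j (k + 1) := by exact_mod_cast (hrow j hj).mono k hk
    have h2 : 0 < η / L j := div_pos hη0 (by exact_mod_cast (hrow j hj).pos)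
    have h3 := mul_le_mul_of_nonneg_right h1 (Nat.cast_nonneg (α := ℝ) ℓ)
    simp only [hs]
    push_cast
    linarith
  set RI : ℤ × ℤ → Prop := fun v => ∃ j k, |j| < (n : ℤ) ∧ k + 1 < L j ∧ v = u j (k + 1) with hRI
  set CI : ℤ × ℤ → Prop := fun v => ∃ i k, |i| < (n : ℤ) ∧ k + 1 < K i ∧ v = w i (k + 1) with hCI
  have hweight : ∀ v, ∃ c : Fin 6 → ℝ, (∀ k, 0 ≤ c k) ∧ ∑ k, c k = 1 ∧
      (∀ j k, |j| < (n : ℤ) → k + 1 < L j → v = u j (k + 1) → ∃ a b, 0 < a ∧ 0 < b ∧ a + b = 1 ∧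
        a * s j k + b * s j (k + 2) = s j (k + 1) ∧
        ∀ f : ℤ × ℤ → ℝ, ∑ d, c d * f (v + latticeDir d) = a * f (u j k) + b * f (u j (k + 2))) ∧
      (¬RI v → ∀ i k, |i| < (n : ℤ) → k + 1 < K i → v = w i (k + 1) →
        ∃ a b, 0 < a ∧ 0 < b ∧ a + b = 1 ∧
        ∀ f : ℤ × ℤ → ℝ, ∑ d, c d * f (v + latticeDir d) = a * f (w i k) + b * f (w i (k + 2))) ∧
      (¬RI v → ¬CI v → 0 < c 0) := by
    intro v
    by_cases hv : RI v
    · obtain ⟨j, k, hj, hk, rfl⟩ := id hv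
      obtain ⟨a, b, ha, hb, hab, hsab⟩ := exists_convex_combo (hs_lt j hj k (by omega))
        (hs_lt j hj (k + 1) hk)
      obtain ⟨c, hc0, hc1, hc⟩ := exists_avg_weight ((hrow j hj).adj k (by omega))
        ((hrow j hj).adj (k + 1) hk) ha hb hab
      refine ⟨c, hc0, hc1, fun j' k' hj' hk' he => ?_, fun h => absurd hv h, fun h => absurd hv h⟩
      have h1 := (hrow j hj).near_im (k + 1) hk.le
      have h2 := (hrow j' hj').near_im (k' + 1) hk'.le
      rw [← he] at h2
      obtain rfl := int_eq_of_abs_sub_le hη h1 h2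
      obtain rfl : k = k' := by have := (hrow j hj).inj _ hk.le _ hk'.le he; omega
      exact ⟨a, b, ha, hb, hab, hsab, hc⟩
    · by_cases hv' : CI v
      · obtain ⟨i, k, hi, hk, rfl⟩ := id hv'
        obtain ⟨c, hc0, hc1, hc⟩ := exists_avg_weight ((hcol i hi).adj k (by omega))
          ((hcol i hi).adj (k + 1) hk) (one_half_pos (α := ℝ)) one_half_pos (add_halves 1)
        refine ⟨c, hc0, hc1, fun j' k' hj' hk' he => absurd ⟨j', k', hj', hk', he⟩ hv,
          fun _ i' k' hi' hk' he => ?_, fun _ h => absurd hv' h⟩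
        have h1 := (hcol i hi).near_re (k + 1) hk.le
        have h2 := (hcol i' hi').near_re (k' + 1) hk'.le
        rw [← he] at h2
        obtain rfl := int_eq_of_abs_sub_le hη h1 h2
        obtain rfl : k = k' := by have := (hcol i hi).inj _ hk.le _ hk'.le he; omega
        exact ⟨1 / 2, 1 / 2, one_half_pos, one_half_pos, add_halves 1, hc⟩
      · exact ⟨fun _ => 1 / 6, fun _ => by norm_num, by norm_num,
          fun j' k' hj' hk' he => absurd ⟨j', k', hj', hk', he⟩ hv,
          fun _ i' k' hi' hk' he => absurd ⟨i', k', hi', hk', he⟩ hv', fun _ _ => by norm_num⟩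
  choose c hc0 hc1 hcrow hccol hcelse using hweight
  have hout : ∀ v : ℤ × ℤ, (n * ℓ : ℕ) ≤ |v.1| ∨ (n * ℓ : ℕ) ≤ |v.2| → v ∉ latticeBox (n * ℓ) := by
    intro v hv h
    have := mem_latticeBox.1 h
    omega
  have hrow0 : ∀ j : ℤ, |j| < n → u j 0 ∉ latticeBox (n * ℓ) := fun j hj =>
    hout _ (Or.inl ((le_neg.1 (hrow j hj).left).trans (neg_le_abs _)))
  have hrowL : ∀ j : ℤ, |j| < n → u j (L j) ∉ latticeBox (n * ℓ) := fun j hj =>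
    hout _ (Or.inl ((hrow j hj).right.trans (le_abs_self _)))
  have hcol0 : ∀ i : ℤ, |i| < n → w i 0 ∉ latticeBox (n * ℓ) := fun i hi =>
    hout _ (Or.inr ((le_neg.1 (hcol i hi).bottom).trans (neg_le_abs _)))
  have hcolK : ∀ i : ℤ, |i| < n → w i (K i) ∉ latticeBox (n * ℓ) := fun i hi =>
    hout _ (Or.inr ((hcol i hi).top.trans (le_abs_self _)))
  have hreach_row : ∀ v, RI v → Reach (n * ℓ) c v := by
    rintro v ⟨j, k, hj, hk, rfl⟩
    refine Reach.of_chain (Reach.outside (hrowL j hj)) (fun k hk h => ?_) (k + 1) hk.le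
    cases k with
    | zero => exact Reach.outside (hrow0 j hj)
    | succ k =>
      obtain ⟨a, b, ha, hb, -, -, h1⟩ := hcrow _ j k hj hk rfl
      exact Reach.of_avg ha hb h1 h
  have hreach_col : ∀ v, CI v → Reach (n * ℓ) c v := by
    rintro v ⟨i, k, hi, hk, rfl⟩
    refine Reach.of_chain (Reach.outside (hcolK i hi)) (fun k hk h => ?_) (k + 1) hk.le
    cases k with
    | zero => exact Reach.outside (hcol0 i hi)
    | succ k =>
      by_cases hv : RI (w i (k + 1))
      · exact hreach_row _ hv
      · obtain ⟨a, b, ha, hb, -, h1⟩ := hccol _ hv i k hi hk rfl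
        exact Reach.of_avg ha hb h1 h
  have hW : IsWeight (n * ℓ) c := by
    refine ⟨fun v _ => hc0 v, fun v _ => hc1 v, fun v _ => ?_⟩
    refine reach_of_pos (fun v _ => ?_) ((n * ℓ : ℕ) - v.1).toNat v (by omega)
    by_cases h1 : RI v
    · exact Or.inr (hreach_row v h1)
    by_cases h2 : CI v
    · exact Or.inr (hreach_col v h2)
    exact Or.inl (hcelse v h1 h2)
  obtain ⟨φ₀, hφo, hφre, hφim, hφ⟩ := hW.exists_tutteMap
  have hφH : ∀ v ∉ latticeBox (n * ℓ), φ₀ v = H (latticePt v) := by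
    intro v hv
    rw [hφo v hv, hH.eq_self]
    intro h
    have h1 : |(v.1 : ℝ)| < (n * ℓ : ℕ) := h.1
    have h2 : |(v.2 : ℝ)| < (n * ℓ : ℕ) := h.2
    exact hv (mem_latticeBox.2 ⟨by exact_mod_cast h1, by exact_mod_cast h2⟩)
  have hends : ∀ M k : ℕ, k ≤ M → k = 0 ∨ k = M ∨ ∃ i, k = i + 1 ∧ i + 1 < M := by
    intro M k hk
    rcases Nat.eq_zero_or_pos k with h | h
    · exact Or.inl h
    · rcases hk.lt_or_eq with h' | h'
      · exact Or.inr (Or.inr ⟨k - 1, by omega, by omega⟩)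
      · exact Or.inr (Or.inl h')
  have hrow_im : ∀ j : ℤ, |j| < n → ∀ k ≤ L j, |(φ₀ (u j k)).im - j * ℓ| ≤ η := by
    intro j hj
    refine le_of_avg_chain fun k hk => ?_
    rcases hends _ k hk with rfl | rfl | ⟨i, rfl, hi⟩
    · rw [hφH _ (hrow0 j hj)]
      exact Or.inl ((hrow j hj).near_im 0 hk)
    · rw [hφH _ (hrowL j hj)]
      exact Or.inl ((hrow j hj).near_im _ hk)
    · obtain ⟨a, b, ha, hb, hab, -, hf⟩ := hcrow _ j i hj hi rfl
      refine Or.inr ⟨i, a, b, rfl, hi, ha, hb, hab, abs_combo_sub_le ha hb ?_ ?_⟩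
      · rw [hφim _ ((hrow j hj).inner _ i.succ_pos hi)]
        exact hf fun v => (φ₀ v).im
      · rw [← add_mul, hab, one_mul]
  have hs_near : ∀ j : ℤ, |j| < n → ∀ k ≤ L j,
      |(H (latticePt (u j k))).re - s j k| ≤ ℓ + 2 * η := by
    intro j hj k hk
    have h1 := (hrow j hj).near_re k hk
    have hL : (0 : ℝ) < L j := by exact_mod_cast (hrow j hj).pos
    have hk' : (k : ℝ) ≤ L j := by exact_mod_cast hk
    have h2 : η / L j * k ≤ η := by
      rw [div_mul_eq_mul_div, div_le_iff₀ hL]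
      exact mul_le_mul_of_nonneg_left hk' hη0.le
    have h3 : 0 ≤ η / L j * k := by positivity
    simp only [hs]
    rw [abs_le] at h1 ⊢
    constructor <;> linarith
  have hrow_re : ∀ j : ℤ, |j| < n → ∀ k ≤ L j, |(φ₀ (u j k)).re - s j k| ≤ ℓ + 2 * η := by
    intro j hj
    refine le_of_avg_chain fun k hk => ?_
    rcases hends _ k hk with rfl | rfl | ⟨i, rfl, hi⟩
    · rw [hφH _ (hrow0 j hj)]
      exact Or.inl (hs_near j hj 0 hk)
    · rw [hφH _ (hrowL j hj)]
      exact Or.inl (hs_near j hj _ hk)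
    · obtain ⟨a, b, ha, hb, hab, hsab, hf⟩ := hcrow _ j i hj hi rfl
      refine Or.inr ⟨i, a, b, rfl, hi, ha, hb, hab, abs_combo_sub_le ha hb ?_ hsab⟩
      rw [hφre _ ((hrow j hj).inner _ i.succ_pos hi)]
      exact hf fun v => (φ₀ v).re
  have hcol_re : ∀ i : ℤ, |i| < n → ∀ k ≤ K i, |(φ₀ (w i k)).re - i * ℓ| ≤ 2 * ℓ + 5 * η := by
    intro i hi
    refine le_of_avg_chain fun k hk => ?_
    have hnear := (hcol i hi).near_re k hk
    rcases hends _ k hk with rfl | rfl | ⟨k, rfl, hk'⟩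
    · rw [hφH _ (hcol0 i hi)]
      exact Or.inl (by linarith)
    · rw [hφH _ (hcolK i hi)]
      exact Or.inl (by linarith)
    · by_cases hv : RI (w i (k + 1))
      · left
        obtain ⟨j, k', hj, hk', he⟩ := hv
        have h1 := hrow_re j hj (k' + 1) hk'.le
        have h2 := hs_near j hj (k' + 1) hk'.le
        rw [← he] at h1 h2
        rw [abs_le] at h1 h2 hnear ⊢
        constructor <;> linarith
      · obtain ⟨a, b, ha, hb, hab, hf⟩ := hccol _ hv i k hi hk' rfl
        refine Or.inr ⟨k, a, b, rfl, hk', ha, hb, hab, abs_combo_sub_le ha hb ?_ ?_⟩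
        · rw [hφre _ ((hcol i hi).inner _ k.succ_pos hk')]
          exact hf fun v => (φ₀ v).re
        · rw [← add_mul, hab, one_mul]
  obtain ⟨φ, hT, hclose⟩ := hφ η hη0
  refine ⟨φ, hT, fun j hj => ⟨_, _, _, hrow j hj, fun k hk => ?_⟩,
    fun i hi => ⟨_, _, hcol i hi, fun k hk => ?_⟩⟩
  · have h1 := (Complex.abs_im_le_norm _).trans
      ((dist_eq_norm _ _).symm.trans_le (hclose (u j k)).le)
    have h2 := hrow_im j hj k hk
    rw [Complex.sub_im] at h1
    have h3 := abs_sub_le (φ (u j k)).im (φ₀ (u j k)).im (j * ℓ)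
    linarith
  · have h1 := (Complex.abs_re_le_norm _).trans
      ((dist_eq_norm _ _).symm.trans_le (hclose (w i k)).le)
    have h2 := hcol_re i hi k hk
    rw [Complex.sub_re] at h1
    have h3 := abs_sub_le (φ (w i k)).re (φ₀ (w i k)).re (i * ℓ)
    linarith

end BoxMonotone

/-! ### Straightened strands control the homeomorphism -/

theorem not_mem_box_of_norm_le {N : ℝ} {x : ℂ} (hx : N + N ≤ ‖x‖) :
    ¬(|x.re| < N ∧ |x.im| < N) := fun h => by
  have := Complex.norm_le_abs_re_add_abs_im x
  linarith [h.1, h.2]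

/-- A strand separating the plane, lying in the half-plane `a ≤ Re (c * H)` and mapped by `Φ` into
a strip, bounds `Re (c * Φ)` where `Re (c * H) < a`. -/
theorem BoxMonotone.re_le_of_strand {N : ℝ} {H : ℂ → ℂ} (hH : BoxMonotone N H) (Φ : ℂ ≃ₜ ℂ)
    (hΦ : ∀ x : ℂ, ¬(|x.re| < N ∧ |x.im| < N) → Φ x = x) {c : ℂ} (hc : ‖c‖ = 1) {C : Set ℂ}
    (hC : ∀ M : ℝ, ∃ p q, JoinedIn C p q ∧ (c * p).im ≤ -M ∧ M ≤ (c * q).im) {a b B : ℝ}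
    (hCa : ∀ x ∈ C, a ≤ (c * H x).re) (hCb : ∀ x ∈ C, (c * Φ x).re ≤ b)
    (hCB : ∀ x ∈ C, B ≤ (c * Φ x).re) {x : ℂ} (hx : (c * H x).re < a) : (c * Φ x).re ≤ b := by
  by_contra! hcon
  have hc0 : c ≠ 0 := norm_ne_zero_iff.1 (by rw [hc]; exact one_ne_zero)
  set S : Set ℂ := H ⁻¹' {z | (c * z).re < a} with hS
  have hconv : Convex ℝ {z : ℂ | (c * z).re < a} :=
    (convex_Iio a).linear_preimage (Complex.reLm ∘ₗ LinearMap.mulLeft ℝ c)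
  have hopen : IsOpen S := by
    refine IsOpen.preimage hH.continuous ?_
    exact isOpen_lt (Complex.continuous_re.comp (continuous_const.mul continuous_id))
      continuous_const
  have hSc : IsConnected S := ⟨⟨x, hx⟩, hH.isPreconnected_preimage hconv.isPreconnected⟩
  obtain ⟨T, hTN, hTa, hTB⟩ : ∃ T : ℝ, |N + N| ≤ T ∧ -a < T ∧ -B < T :=
    ⟨max |N + N| (max (-a) (-B) + 1), le_max_left _ _,
      lt_max_of_lt_right (by linarith [le_max_left (-a) (-B)]),
      lt_max_of_lt_right (by linarith [le_max_right (-a) (-B)])⟩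
  set y : ℂ := c⁻¹ * (-T : ℝ) with hy
  have hcy : c * y = (-T : ℝ) := by rw [hy, mul_inv_cancel_left₀ hc0]
  have hynorm : N + N ≤ ‖y‖ := by
    rw [hy, norm_mul, norm_inv, hc, inv_one, one_mul, Complex.norm_real, norm_neg]
    exact (le_abs_self _).trans (hTN.trans (le_abs_self T))
  have hyS : y ∈ S := by
    show (c * H y).re < a
    rw [hH.eq_self y (not_mem_box_of_norm_le hynorm), hcy, Complex.ofReal_re]
    linarith
  obtain ⟨p, hp⟩ := (hopen.isConnected_iff_isPathConnected.1 hSc).joinedIn y hyS x hx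
  obtain ⟨M, hM⟩ : ∃ M : ℝ, ∀ s, |(c * Φ (p.extend s)).im| ≤ M := by
    obtain ⟨M, hM⟩ := (isCompact_range (show Continuous fun t => |(c * Φ (p t)).im| from
      (Complex.continuous_im.comp (continuous_const.mul
        (Φ.continuous.comp p.continuous))).abs)).bddAbove
    exact ⟨M, fun s => hM ⟨projIcc 0 1 zero_le_one s, rfl⟩⟩
  obtain ⟨q₀, q₁, ⟨γ, hγ⟩, h0, h1⟩ := hC (max (M + 1) |N + N|)
  have hq : ∀ q : ℂ, max (M + 1) |N + N| ≤ |(c * q).im| → Φ q = q := by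
    intro q hq
    refine hΦ q (not_mem_box_of_norm_le ?_)
    have h2 := (le_max_right (M + 1) |N + N|).trans (hq.trans (Complex.abs_im_le_norm _))
    rw [norm_mul, hc, one_mul] at h2
    exact (le_abs_self _).trans h2
  have hM1 := le_max_left (M + 1) |N + N|
  obtain ⟨s, t, hst⟩ := exists_eq_of_crossing_box (α := fun s => c * Φ (p.extend s))
    (β := fun t => c * Φ (γ.extend t))
    (continuous_const.mul (Φ.continuous.comp p.continuous_extend))
    (continuous_const.mul (Φ.continuous.comp γ.continuous_extend))
    (fun t _ => by
      have := hCB _ (hγ (projIcc 0 1 zero_le_one t))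
      rw [p.extend_zero, hΦ y (not_mem_box_of_norm_le hynorm), hcy, Complex.ofReal_re]
      exact lt_of_lt_of_le (by linarith) this)
    (fun t _ => by
      have := hCb _ (hγ (projIcc 0 1 zero_le_one t))
      rw [p.extend_one]
      exact lt_of_le_of_lt this hcon)
    (fun s _ => by
      rw [γ.extend_zero, hq q₀ ((le_neg.1 h0).trans (neg_le_abs _))]
      linarith [(abs_le.1 (hM s)).1])
    (fun s _ => by
      rw [γ.extend_one, hq q₁ (h1.trans (le_abs_self _))]
      linarith [(abs_le.1 (hM s)).2])
  have heq : p.extend s = γ.extend t := Φ.injective (mul_left_cancel₀ hc0 hst)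
  have h2 : (c * H (p.extend s)).re < a := hp (projIcc 0 1 zero_le_one s)
  have h3 : a ≤ (c * H (γ.extend t)).re := hCa _ (hγ (projIcc 0 1 zero_le_one t))
  rw [heq] at h2
  linarith

/-- A lattice path together with two rays in the directions `-e` and `e` at its ends. -/
def strandSet (u : ℕ → ℤ × ℤ) (L : ℕ) (e : ℂ) : Set ℂ :=
  {x | (∃ k < L, ∃ α : ℝ, 0 ≤ α ∧ α ≤ 1 ∧
      x = latticePt (u k) + α * (latticePt (u (k + 1)) - latticePt (u k))) ∨
    ∃ t : ℝ, 0 ≤ t ∧ (x = latticePt (u 0) - t * e ∨ x = latticePt (u L) + t * e)}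

theorem joinedIn_of_affine {C : Set ℂ} {p d : ℂ}
    (h : ∀ t : ℝ, 0 ≤ t → t ≤ 1 → p + t * d ∈ C) : JoinedIn C p (p + d) := by
  refine JoinedIn.ofLine (f := fun t : ℝ => p + t * d) (by fun_prop) (by simp) (by simp) ?_
  rintro _ ⟨t, ht, rfl⟩
  exact h t ht.1 ht.2

theorem joinedIn_strandSet (u : ℕ → ℤ × ℤ) (L : ℕ) (e : ℂ) {t : ℝ} (ht : 0 ≤ t) :
    JoinedIn (strandSet u L e) (latticePt (u 0) - t * e) (latticePt (u L) + t * e) := by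
  have h1 : JoinedIn (strandSet u L e) (latticePt (u 0)) (latticePt (u 0) + -(t * e)) :=
    joinedIn_of_affine fun s hs _ => Or.inr ⟨s * t, by positivity, Or.inl (by push_cast; ring)⟩
  have h2 : JoinedIn (strandSet u L e) (latticePt (u L)) (latticePt (u L) + t * e) :=
    joinedIn_of_affine fun s hs _ => Or.inr ⟨s * t, by positivity, Or.inr (by push_cast; ring)⟩
  have h3 : ∀ k ≤ L, JoinedIn (strandSet u L e) (latticePt (u 0)) (latticePt (u k)) := by
    intro k
    induction k with
    | zero => exact fun _ => JoinedIn.refl h1.source_mem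
    | succ k ih =>
      intro hk
      have h4 := joinedIn_of_affine (C := strandSet u L e) (p := latticePt (u k))
        (d := latticePt (u (k + 1)) - latticePt (u k))
        fun s hs hs' => Or.inl ⟨k, hk, s, hs, hs', rfl⟩
      rw [add_sub_cancel] at h4
      exact (ih (by omega)).trans h4
  exact (h1.symm.trans (h3 L le_rfl)).trans h2

/-- The values of `H` and `Φ` along a strand are controlled by those at its vertices. -/
theorem BoxMonotone.abs_sub_le_of_mem_strandSet {N η κ θ : ℝ} {H : ℂ → ℂ} (hH : BoxMonotone N H)
    (hmod : ∀ x y, dist x y ≤ 4 → dist (H x) (H y) ≤ η) {Φ : ℂ → ℂ} {φ : ℤ × ℤ → ℂ}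
    (hΦ : ∀ x : ℂ, ¬(|x.re| < N ∧ |x.im| < N) → Φ x = x)
    (hΦφ : ∀ (v : ℤ × ℤ) (k : Fin 6) (α : ℝ), 0 ≤ α → α ≤ 1 →
      Φ (latticePt v + α * (latticePt (v + latticeDir k) - latticePt v)) =
        φ v + α * (φ (v + latticeDir k) - φ v))
    {c e : ℂ} (hc : ‖c‖ = 1) (he : (c * e).re = 0) {L : ℕ} {u : ℕ → ℤ × ℤ}
    (hadj : ∀ k < L, ∃ d, u (k + 1) = u k + latticeDir d)
    (hray : ∀ t : ℝ, 0 ≤ t → ∀ x : ℂ, x = latticePt (u 0) - t * e ∨ x = latticePt (u L) + t * e →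
      ¬(|x.re| < N ∧ |x.im| < N))
    (hHu : ∀ k ≤ L, |(c * H (latticePt (u k))).re - θ| ≤ η)
    (hφu : ∀ k ≤ L, |(c * φ (u k)).re - θ| ≤ κ) (hηκ : η ≤ κ) {x : ℂ}
    (hx : x ∈ strandSet u L e) :
    |(c * H x).re - θ| ≤ 2 * η ∧ |(c * Φ x).re - θ| ≤ κ := by
  have hη : 0 ≤ η := dist_nonneg.trans (hmod 0 0 (by simp))
  rcases hx with ⟨k, hk, α, h0, h1, rfl⟩ | ⟨t, ht, hx⟩
  · obtain ⟨d, hd⟩ := hadj k hk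
    constructor
    · have h2 : dist (latticePt (u k) + α * (latticePt (u (k + 1)) - latticePt (u k)))
          (latticePt (u k)) ≤ 4 := by
        have hdir : ∀ d : Fin 6, |(latticeDir d).1| ≤ 1 ∧ |(latticeDir d).2| ≤ 1 := by decide
        have h3 : ‖latticePt (latticeDir d)‖ ≤ 2 := by
          refine (Complex.norm_le_abs_re_add_abs_im _).trans ?_
          have h4 : |((latticeDir d).1 : ℝ)| ≤ 1 := by exact_mod_cast (hdir d).1
          have h5 : |((latticeDir d).2 : ℝ)| ≤ 1 := by exact_mod_cast (hdir d).2
          rw [latticePt_re, latticePt_im]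
          linarith
        rw [dist_eq_norm, add_sub_cancel_left, norm_mul, hd, latticePt_add, add_sub_cancel_left,
          Complex.norm_real, Real.norm_of_nonneg h0]
        nlinarith [norm_nonneg (latticePt (latticeDir d))]
      have h3 := hmod _ _ h2
      rw [dist_eq_norm] at h3
      generalize latticePt (u k) + α * (latticePt (u (k + 1)) - latticePt (u k)) = x at h3
      have h4 := Complex.abs_re_le_norm (c * (H x - H (latticePt (u k))))
      rw [norm_mul, hc, one_mul, mul_sub, Complex.sub_re] at h4
      have h5 := abs_sub_le (c * H x).re (c * H (latticePt (u k))).re θ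
      linarith [hHu k hk.le]
    · rw [hd, hΦφ _ _ _ h0 h1, ← hd]
      have h2 := abs_le.1 (hφu k hk.le)
      have h3 := abs_le.1 (hφu (k + 1) hk)
      have h4 : (c * (φ (u k) + α * (φ (u (k + 1)) - φ (u k)))).re =
          (1 - α) * (c * φ (u k)).re + α * (c * φ (u (k + 1))).re := by
        simp; ring
      rw [h4, abs_le]
      constructor <;> nlinarith
  · have h1 := hray t ht x hx
    have h2 : |(c * x).re - θ| ≤ η := by
      have h3 : ∀ k, ¬(|(latticePt (u k)).re| < N ∧ |(latticePt (u k)).im| < N) → k ≤ L →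
          |(c * latticePt (u k)).re - θ| ≤ η := by
        intro k hk hkL
        have := hHu k hkL
        rwa [hH.eq_self _ hk] at this
      have h4 : (c * (t * e)).re = 0 := by
        rw [mul_left_comm, Complex.re_ofReal_mul, he, mul_zero]
      rcases hx with rfl | rfl
      · rw [mul_sub, Complex.sub_re, h4, sub_zero]
        exact h3 0 (hray 0 le_rfl _ (Or.inl (by simp))) (Nat.zero_le _)
      · rw [mul_add, Complex.add_re, h4, add_zero]
        exact h3 L (hray 0 le_rfl _ (Or.inr (by simp))) le_rfl
    rw [hH.eq_self x h1, hΦ x h1]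
    exact ⟨h2.trans (by linarith), h2.trans hηκ⟩

/-- A family of strands bounds `Re (c * Φ)` in terms of `Re (c * H)`. -/
theorem BoxMonotone.re_le_of_strands {n ℓ : ℕ} {η κ : ℝ} {H : ℂ → ℂ}
    (hH : BoxMonotone (n * ℓ : ℕ) H) (hℓ : 0 < ℓ) (hη : 0 < η) (hκ : 0 ≤ κ) (Φ : ℂ ≃ₜ ℂ)
    (hΦ : ∀ x : ℂ, ¬(|x.re| < (n * ℓ : ℕ) ∧ |x.im| < (n * ℓ : ℕ)) → Φ x = x)
    {c : ℂ} (hc : ‖c‖ = 1)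
    (hC : ∀ i : ℤ, |i| < n → ∃ C : Set ℂ,
      (∀ M : ℝ, ∃ p q, JoinedIn C p q ∧ (c * p).im ≤ -M ∧ M ≤ (c * q).im) ∧
      ∀ x ∈ C, |(c * H x).re - i * ℓ| ≤ 2 * η ∧ |(c * Φ x).re - i * ℓ| ≤ κ) {x : ℂ}
    (hHx : |(c * H x).re| ≤ (n * ℓ : ℕ)) (hΦx : |(c * Φ x).re| ≤ (n * ℓ : ℕ)) :
    (c * Φ x).re ≤ (c * H x).re + (κ + ℓ + 4 * η) := by
  have hℓ' : (0 : ℝ) < ℓ := by exact_mod_cast hℓ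
  have h1 := Int.floor_le (((c * H x).re + 2 * η) / ℓ)
  have h2 := Int.lt_floor_add_one (((c * H x).re + 2 * η) / ℓ)
  obtain ⟨i, hi⟩ : ∃ i, i = ⌊((c * H x).re + 2 * η) / ℓ⌋ + 1 := ⟨_, rfl⟩
  rw [← sub_eq_iff_eq_add] at hi
  rw [← hi, le_div_iff₀ hℓ'] at h1
  rw [← hi, div_lt_iff₀ hℓ'] at h2
  push_cast at h1 h2 hHx hΦx
  rw [sub_add_cancel] at h2
  rw [abs_le] at hHx hΦx
  have hin : -(n : ℤ) < i := by
    have h3 : (-(n : ℝ)) * ℓ < i * ℓ := by linarith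
    have h4 := lt_of_mul_lt_mul_right h3 hℓ'.le
    exact_mod_cast h4
  rcases lt_or_ge i n with h | h
  · obtain ⟨C, hC1, hC2⟩ := hC i (abs_lt.2 ⟨hin, h⟩)
    have h5 := hH.re_le_of_strand Φ hΦ hc hC1 (a := i * ℓ - 2 * η) (b := i * ℓ + κ)
      (B := i * ℓ - κ) (x := x) (fun x hx => by linarith [(abs_le.1 (hC2 x hx).1).1])
      (fun x hx => by linarith [(abs_le.1 (hC2 x hx).2).2])
      (fun x hx => by linarith [(abs_le.1 (hC2 x hx).2).1]) (by linarith)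
    linarith
  · have h3 : (n : ℝ) * ℓ ≤ i * ℓ := by
      refine mul_le_mul_of_nonneg_right ?_ hℓ'.le
      exact_mod_cast h
    linarith

/-- A family of straightened lattice paths forces `Re (c * Φ)` to be close to `Re (c * H)`. -/
theorem BoxMonotone.abs_re_sub_le_of_paths {n ℓ : ℕ} {η κ : ℝ} {H : ℂ → ℂ}
    (hH : BoxMonotone (n * ℓ : ℕ) H) (hℓ : 0 < ℓ) (hη : 0 < η) (hηκ : η ≤ κ)
    (hmod : ∀ x y, dist x y ≤ 4 → dist (H x) (H y) ≤ η) (Φ : ℂ ≃ₜ ℂ) {φ : ℤ × ℤ → ℂ}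
    (hΦ : ∀ x : ℂ, ¬(|x.re| < (n * ℓ : ℕ) ∧ |x.im| < (n * ℓ : ℕ)) → Φ x = x)
    (hΦφ : ∀ (v : ℤ × ℤ) (k : Fin 6) (α : ℝ), 0 ≤ α → α ≤ 1 →
      Φ (latticePt v + α * (latticePt (v + latticeDir k) - latticePt v)) =
        φ v + α * (φ (v + latticeDir k) - φ v))
    {c e : ℂ} (hc : ‖c‖ = 1) (he : (c * e).re = 0) (he' : |(c * e).im| = 1)
    (hpath : ∀ i : ℤ, |i| < n → ∃ (L : ℕ) (u : ℕ → ℤ × ℤ),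
      (∀ k < L, ∃ d, u (k + 1) = u k + latticeDir d) ∧
      (∀ t : ℝ, 0 ≤ t → ∀ x : ℂ, x = latticePt (u 0) - t * e ∨ x = latticePt (u L) + t * e →
        ¬(|x.re| < (n * ℓ : ℕ) ∧ |x.im| < (n * ℓ : ℕ))) ∧
      (∀ k ≤ L, |(c * H (latticePt (u k))).re - i * ℓ| ≤ η) ∧
      ∀ k ≤ L, |(c * φ (u k)).re - i * ℓ| ≤ κ) {x : ℂ}
    (hHx : |(c * H x).re| ≤ (n * ℓ : ℕ)) (hΦx : |(c * Φ x).re| ≤ (n * ℓ : ℕ)) :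
    |(c * Φ x).re - (c * H x).re| ≤ κ + ℓ + 4 * η := by
  have hfar : ∀ c' : ℂ, |(c' * e).im| = 1 → ∀ (L : ℕ) (u : ℕ → ℤ × ℤ), ∀ M : ℝ, ∃ p q,
      JoinedIn (strandSet u L e) p q ∧ (c' * p).im ≤ -M ∧ M ≤ (c' * q).im := by
    intro c' hc' L u M
    obtain ⟨T, hT0, hT1, hT2⟩ : ∃ T : ℝ, 0 ≤ T ∧ |M| + |(c' * latticePt (u 0)).im| ≤ T ∧
        |M| + |(c' * latticePt (u L)).im| ≤ T :=
      ⟨|M| + |(c' * latticePt (u 0)).im| + |(c' * latticePt (u L)).im|, by positivity,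
        by linarith [abs_nonneg (c' * latticePt (u L)).im],
        by linarith [abs_nonneg (c' * latticePt (u 0)).im]⟩
    have hj := joinedIn_strandSet u L e hT0
    have him : (c' * (T * e)).im = T * (c' * e).im := by
      rw [mul_left_comm, Complex.im_ofReal_mul]
    have h1 := le_abs_self M
    have h2 := abs_le.1 (le_refl |(c' * latticePt (u 0)).im|)
    have h3 := abs_le.1 (le_refl |(c' * latticePt (u L)).im|)
    rcases (abs_eq zero_le_one).1 hc' with h | h
    · refine ⟨_, _, hj, ?_, ?_⟩
      · rw [mul_sub, Complex.sub_im, him, h]; linarith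
      · rw [mul_add, Complex.add_im, him, h]; linarith
    · refine ⟨_, _, hj.symm, ?_, ?_⟩
      · rw [mul_add, Complex.add_im, him, h]; linarith
      · rw [mul_sub, Complex.sub_im, him, h]; linarith
  have hκ : 0 ≤ κ := hη.le.trans hηκ
  have hup := hH.re_le_of_strands hℓ hη hκ Φ hΦ hc (fun i hi => by
    obtain ⟨L, u, h1, h2, h3, h4⟩ := hpath i hi
    exact ⟨strandSet u L e, hfar c he' L u, fun x hx =>
      hH.abs_sub_le_of_mem_strandSet hmod hΦ hΦφ hc he h1 h2 h3 h4 hηκ hx⟩) hHx hΦx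
  have hdown := hH.re_le_of_strands hℓ hη hκ Φ hΦ (c := -c) (by rwa [norm_neg]) (fun i hi => by
    obtain ⟨L, u, h1, h2, h3, h4⟩ := hpath (-i) (by rwa [abs_neg])
    refine ⟨strandSet u L e, hfar (-c) (by rwa [neg_mul, Complex.neg_im, abs_neg]) L u,
      fun x hx => ?_⟩
    have h5 := hH.abs_sub_le_of_mem_strandSet hmod hΦ hΦφ hc he h1 h2 h3 h4 hηκ hx
    rw [← abs_neg, ← abs_neg ((c * Φ x).re - _)] at h5
    push_cast at h5
    refine ⟨?_, ?_⟩
    · refine le_trans (le_of_eq ?_) h5.1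
      rw [neg_mul, Complex.neg_re]; congr 1; ring
    · refine le_trans (le_of_eq ?_) h5.2
      rw [neg_mul, Complex.neg_re]; congr 1; ring)
    (x := x) (by rwa [neg_mul, Complex.neg_re, abs_neg]) (by rwa [neg_mul, Complex.neg_re, abs_neg])
  rw [neg_mul, Complex.neg_re, neg_mul, Complex.neg_re] at hdown
  rw [abs_le]
  constructor <;> linarith

/-- Approximation of a monotone map of a lattice box, up to a bounded number of mesh sizes. -/
theorem BoxMonotone.exists_homeomorph {n ℓ : ℕ} {η : ℝ} {H : ℂ → ℂ}
    (hH : BoxMonotone (n * ℓ : ℕ) H)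
    (hbox : ∀ x : ℂ, |x.re| ≤ (n * ℓ : ℕ) → |x.im| ≤ (n * ℓ : ℕ) →
      |(H x).re| ≤ (n * ℓ : ℕ) ∧ |(H x).im| ≤ (n * ℓ : ℕ))
    (hℓ : 0 < ℓ) (hη : 0 < η) (hηℓ : 10 * η ≤ ℓ)
    (hmod : ∀ x y, dist x y ≤ 4 → dist (H x) (H y) ≤ η) :
    ∃ Φ : ℂ ≃ₜ ℂ, (∀ x : ℂ, ¬(|x.re| < (n * ℓ : ℕ) ∧ |x.im| < (n * ℓ : ℕ)) → Φ x = x) ∧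
      ∀ x, dist (Φ x) (H x) ≤ 8 * ℓ := by
  have hℓ' : (0 : ℝ) < ℓ := by exact_mod_cast hℓ
  obtain ⟨φ, hφ, hrow, hcol⟩ := hH.exists_tutteMap hℓ hη (by linarith) hmod
  obtain ⟨Φ, hΦ, hΦφ⟩ := hφ.exists_homeomorph
  refine ⟨Φ, hΦ, fun x => ?_⟩
  by_cases hx : |x.re| < (n * ℓ : ℕ) ∧ |x.im| < (n * ℓ : ℕ)
  swap
  · rw [hΦ x hx, hH.eq_self x hx, dist_self]; positivity
  have hΦx : |(Φ x).re| < (n * ℓ : ℕ) ∧ |(Φ x).im| < (n * ℓ : ℕ) := by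
    by_contra hcon
    rw [← Φ.injective (hΦ _ hcon)] at hx
    exact hcon hx
  obtain ⟨hH1, hH2⟩ := hbox x hx.1.le hx.2.le
  have hre := hH.abs_re_sub_le_of_paths hℓ hη (κ := 2 * ℓ + 6 * η) (by linarith) hmod Φ hΦ hΦφ
    (c := 1) (e := Complex.I) (by simp) (by simp) (by simp) (fun i hi => by
      obtain ⟨L, u, h1, h2⟩ := hcol i hi
      refine ⟨L, u, h1.adj, fun t ht x hx h => ?_, by simpa using h1.near_re, by simpa using h2⟩
      have h3 : ((u 0).2 : ℝ) ≤ -(n * ℓ : ℕ) := by exact_mod_cast h1.bottom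
      have h4 : ((n * ℓ : ℕ) : ℝ) ≤ (u L).2 := by exact_mod_cast h1.top
      have h5 := abs_lt.1 h.2
      rcases hx with rfl | rfl
      · simp only [Complex.sub_im, latticePt_im, Complex.im_ofReal_mul, Complex.I_im] at h5
        linarith
      · simp only [Complex.add_im, latticePt_im, Complex.im_ofReal_mul, Complex.I_im] at h5
        linarith)
    (x := x) (by simpa using hH1) (by simpa using hΦx.1.le)
  have him := hH.abs_re_sub_le_of_paths hℓ hη (κ := 2 * ℓ + 6 * η) (by linarith) hmod Φ hΦ hΦφ
    (c := -Complex.I) (e := 1) (by simp) (by simp) (by simp) (fun j hj => by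
      obtain ⟨L, u, r, h1, h2⟩ := hrow j hj
      refine ⟨L, u, h1.adj, fun t ht x hx h => ?_, by simpa using h1.near_im, by simpa using h2⟩
      have h3 : ((u 0).1 : ℝ) ≤ -(n * ℓ : ℕ) := by exact_mod_cast h1.left
      have h4 : ((n * ℓ : ℕ) : ℝ) ≤ (u L).1 := by exact_mod_cast h1.right
      have h5 := abs_lt.1 h.1
      rcases hx with rfl | rfl
      · simp only [Complex.sub_re, latticePt_re, Complex.re_ofReal_mul, Complex.one_re] at h5
        linarith
      · simp only [Complex.add_re, latticePt_re, Complex.re_ofReal_mul, Complex.one_re] at h5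
        linarith)
    (x := x) (by simpa using hH2) (by simpa using hΦx.2.le)
  simp only [one_mul] at hre
  simp only [neg_mul, Complex.neg_re, Complex.I_mul_re, neg_neg] at him
  rw [dist_eq_norm]
  refine (Complex.norm_le_abs_re_add_abs_im _).trans ?_
  rw [Complex.sub_re, Complex.sub_im]
  linarith

/-- Approximation by homeomorphisms for monotone self-maps of the square fixing its boundary. -/
theorem exists_homeomorph_dist_lt_of_box {H : ℂ → ℂ} (hH : Continuous H)
    (hout : ∀ x : ℂ, ¬(|x.re| < 1 ∧ |x.im| < 1) → H x = x)
    (hbox : ∀ x : ℂ, |x.re| ≤ 1 → |x.im| ≤ 1 → |(H x).re| ≤ 1 ∧ |(H x).im| ≤ 1)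
    (hfib : ∀ b, IsConnected (H ⁻¹' {b})) {ε : ℝ} (hε : 0 < ε) :
    ∃ Φ : ℂ ≃ₜ ℂ, (∀ x : ℂ, ¬(|x.re| < 1 ∧ |x.im| < 1) → Φ x = x) ∧
      ∀ x, dist (Φ x) (H x) < ε := by
  have hsupp : HasCompactSupport fun x => H x - x := by
    refine HasCompactSupport.intro (isCompact_closedBall (0 : ℂ) 2) fun x hx => ?_
    rw [hout x fun h => hx ?_, sub_self]
    rw [mem_closedBall_zero_iff]
    exact (Complex.norm_le_abs_re_add_abs_im x).trans (by linarith [h.1, h.2])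
  have huc : UniformContinuous H := by
    have h1 : UniformContinuous fun x => H x - x :=
      hsupp.uniformContinuous_of_continuous (hH.sub continuous_id)
    simpa using h1.add uniformContinuous_id
  obtain ⟨n, hn⟩ := exists_nat_gt (8 / ε)
  have hn0 : (0 : ℝ) < n := (by positivity : 0 < 8 / ε).trans hn
  obtain ⟨δ, hδ, hδH⟩ := Metric.uniformContinuous_iff.1 huc (1 / (10 * n)) (by positivity)
  obtain ⟨ℓ, hℓ⟩ := exists_nat_gt (4 / (n * δ))
  have hℓ0 : (0 : ℝ) < ℓ := (by positivity : 0 < 4 / (n * δ)).trans hℓ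
  set N : ℝ := ((n * ℓ : ℕ) : ℝ) with hN
  have hNeq : N = n * ℓ := by rw [hN]; push_cast; rfl
  have hN0 : 0 < N := by rw [hNeq]; positivity
  have hNC : (N : ℂ) ≠ 0 := by exact_mod_cast hN0.ne'
  set s : ℂ ≃ₜ ℂ := Homeomorph.mulLeft₀ (N : ℂ) hNC with hs
  have hs_re : ∀ x, (s x).re = N * x.re := fun x => Complex.re_ofReal_mul _ _
  have hs_im : ∀ x, (s x).im = N * x.im := fun x => Complex.im_ofReal_mul _ _
  have hs_dist : ∀ x y, dist (s x) (s y) = N * dist x y := fun x y => by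
    change dist ((N : ℂ) * x) (N * y) = _
    rw [dist_eq_norm, dist_eq_norm, ← mul_sub, norm_mul, Complex.norm_real, Real.norm_eq_abs,
      abs_of_pos hN0]
  have hlt : ∀ t : ℝ, |N * t| < N ↔ |t| < 1 := fun t => by
    rw [abs_mul, abs_of_pos hN0, mul_lt_iff_lt_one_right hN0]
  have hle : ∀ t : ℝ, |N * t| ≤ N ↔ |t| ≤ 1 := fun t => by
    rw [abs_mul, abs_of_pos hN0, mul_le_iff_le_one_right hN0]
  have hmono : BoxMonotone N fun x => s (H (s.symm x)) := by
    refine ⟨by fun_prop, fun x hx => ?_, fun b => ?_⟩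
    · obtain ⟨x, rfl⟩ := s.surjective x
      rw [hs_re, hs_im, hlt, hlt] at hx
      rw [s.symm_apply_apply, hout x hx]
    · have heq : (fun x => s (H (s.symm x))) ⁻¹' {b} = s '' (H ⁻¹' {s.symm b}) := by
        rw [s.image_eq_preimage_symm]
        ext x
        simp only [mem_preimage, mem_singleton_iff]
        exact s.toEquiv.eq_symm_apply.symm
      rw [heq]
      exact (hfib _).image _ s.continuous.continuousOn
  obtain ⟨Φ, hΦ, hΦH⟩ := hmono.exists_homeomorph (n := n) (ℓ := ℓ) (η := ℓ / 10)
    (fun x hx1 hx2 => by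
      obtain ⟨x, rfl⟩ := s.surjective x
      rw [← hN] at hx1 hx2 ⊢
      rw [hs_re, hle] at hx1
      rw [hs_im, hle] at hx2
      rw [s.symm_apply_apply, hs_re, hs_im, hle, hle]
      exact hbox x hx1 hx2) (by exact_mod_cast hℓ0) (by positivity) (by linarith)
    (fun x y hxy => by
      obtain ⟨x, rfl⟩ := s.surjective x
      obtain ⟨y, rfl⟩ := s.surjective y
      rw [hs_dist] at hxy
      rw [s.symm_apply_apply, s.symm_apply_apply, hs_dist]
      have h1 : dist x y < δ := by
        rw [div_lt_iff₀ (by positivity)] at hℓ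
        refine lt_of_mul_lt_mul_left (hxy.trans_lt ?_) hN0.le
        rw [hNeq]
        linarith
      refine (mul_le_mul_of_nonneg_left (hδH h1).le hN0.le).trans (le_of_eq ?_)
      rw [hNeq]
      field_simp)
  refine ⟨(s.trans Φ).trans s.symm, fun x hx => ?_, fun x => ?_⟩
  · have h1 : Φ (s x) = s x := hΦ _ (by rwa [← hN, hs_re, hs_im, hlt, hlt])
    change s.symm (Φ (s x)) = x
    rw [h1, s.symm_apply_apply]
  · have h1 := hΦH (s x)
    rw [s.symm_apply_apply, ← s.apply_symm_apply (Φ (s x)), hs_dist, hNeq] at h1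
    change dist (s.symm (Φ (s x))) (H x) < ε
    rw [div_lt_iff₀ hε] at hn
    have h2 : n * dist (s.symm (Φ (s x))) (H x) ≤ 8 := by
      refine le_of_mul_le_mul_right ?_ hℓ0
      linarith
    refine lt_of_mul_lt_mul_left (h2.trans_lt hn) hn0.le

/-! ### Straightening the boundary map -/

/-- The angular displacement of a circle map with lift `ψ`, as a function on the plane. -/
noncomputable def angularShift (ψ : ℝ → ℝ) (x : ℂ) : ℝ := ψ x.arg - x.arg

section Circle

variable {ψ : ℝ → ℝ}

theorem map_add_int_mul_two_pi (hper : ∀ θ, ψ (θ + 2 * Real.pi) = ψ θ + 2 * Real.pi) (n : ℤ)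
    (θ : ℝ) : ψ (θ + n * (2 * Real.pi)) = ψ θ + n * (2 * Real.pi) := by
  have h : Function.Periodic (fun θ => ψ θ - θ) (2 * Real.pi) := fun θ => by
    simp only [hper]; ring
  have := h.int_mul n θ
  linarith

theorem exists_int_of_exp_eq {a b : ℝ}
    (h : Complex.exp (a * Complex.I) = Complex.exp (b * Complex.I)) :
    ∃ n : ℤ, a = b + n * (2 * Real.pi) := by
  obtain ⟨n, hn⟩ := Complex.exp_eq_exp_iff_exists_int.1 h
  refine ⟨n, ?_⟩
  have := congrArg Complex.im hn
  simpa using this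

theorem exp_add_int_mul_two_pi (a : ℝ) (n : ℤ) :
    Complex.exp (((a + n * (2 * Real.pi) : ℝ) : ℂ) * Complex.I) = Complex.exp (a * Complex.I) := by
  rw [Complex.exp_eq_exp_iff_exists_int]
  exact ⟨n, by push_cast; ring⟩

theorem angularShift_polar (hper : ∀ θ, ψ (θ + 2 * Real.pi) = ψ θ + 2 * Real.pi) {ρ : ℝ}
    (hρ : 0 < ρ) (θ : ℝ) : angularShift ψ (ρ * Complex.exp (θ * Complex.I)) = ψ θ - θ := by
  set x : ℂ := ρ * Complex.exp (θ * Complex.I) with hx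
  have hn : ‖x‖ = ρ := by
    rw [hx, norm_mul, Complex.norm_exp_ofReal_mul_I, mul_one, Complex.norm_of_nonneg hρ.le]
  have h1 := Complex.norm_mul_exp_arg_mul_I x
  rw [hn] at h1
  have hρ' : (ρ : ℂ) ≠ 0 := by exact_mod_cast hρ.ne'
  obtain ⟨n, hn'⟩ := exists_int_of_exp_eq (mul_left_cancel₀ hρ' (h1.trans hx))
  rw [angularShift, hn', map_add_int_mul_two_pi hper]
  ring

theorem continuousAt_angularShift (hψ : Continuous ψ)
    (hper : ∀ θ, ψ (θ + 2 * Real.pi) = ψ θ + 2 * Real.pi) {x : ℂ} (hx : x ≠ 0) :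
    ContinuousAt (angularShift ψ) x := by
  have heq : angularShift ψ =ᶠ[𝓝 x]
      fun y => ψ ((y / x).arg + x.arg) - ((y / x).arg + x.arg) := by
    filter_upwards [isOpen_ne.mem_nhds hx] with y hy
    have h1 := Complex.norm_mul_exp_arg_mul_I (y / x)
    have h2 := Complex.norm_mul_exp_arg_mul_I x
    have h3 : y = (‖y‖ : ℝ) * Complex.exp ((((y / x).arg + x.arg : ℝ) : ℂ) * Complex.I) := by
      have : ‖y‖ = ‖y / x‖ * ‖x‖ := by
        rw [← norm_mul, div_mul_cancel₀ _ hx]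
      rw [this]
      push_cast
      rw [add_mul, Complex.exp_add]
      calc y = (y / x) * x := (div_mul_cancel₀ _ hx).symm
        _ = (‖y / x‖ * Complex.exp ((y / x).arg * Complex.I)) *
            (‖x‖ * Complex.exp (x.arg * Complex.I)) := by rw [h1, h2]
        _ = _ := by ring
    have := angularShift_polar hper (norm_pos_iff.2 hy) ((y / x).arg + x.arg)
    rwa [← h3] at this
  refine ContinuousAt.congr ?_ heq.symm
  have harg : ContinuousAt (fun y : ℂ => (y / x).arg) x := by
    refine ContinuousAt.comp (g := Complex.arg) (f := fun y => y / x) ?_ (by fun_prop)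
    simp only [div_self hx]
    exact Complex.continuousAt_arg Complex.one_mem_slitPlane
  exact (hψ.continuousAt.comp (harg.add continuousAt_const)).sub (harg.add continuousAt_const)

/-- A strictly monotone lift of degree one gives a bijection of every circle. -/
theorem exp_eq_of_strictMono_lift {τ : ℝ → ℝ} (hτ : StrictMono τ)
    (hper : ∀ θ, τ (θ + 2 * Real.pi) = τ θ + 2 * Real.pi) {a b : ℝ}
    (h : Complex.exp (τ a * Complex.I) = Complex.exp (τ b * Complex.I)) :
    Complex.exp (a * Complex.I) = Complex.exp (b * Complex.I) := by
  obtain ⟨n, hn⟩ := exists_int_of_exp_eq h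
  rw [← map_add_int_mul_two_pi hper] at hn
  rw [hτ.injective hn, exp_add_int_mul_two_pi]

theorem surjective_of_lift {τ : ℝ → ℝ} (hτ : Continuous τ)
    (hper : ∀ θ, τ (θ + 2 * Real.pi) = τ θ + 2 * Real.pi) : Function.Surjective τ := by
  intro y
  have hπ := Real.pi_pos
  obtain ⟨n, hn⟩ := exists_int_gt ((y - τ 0) / (2 * Real.pi))
  obtain ⟨m, hm⟩ := exists_int_lt ((y - τ 0) / (2 * Real.pi))
  have h1 := map_add_int_mul_two_pi hper n 0
  have h2 := map_add_int_mul_two_pi hper m 0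
  rw [div_lt_iff₀ (by positivity)] at hn
  rw [lt_div_iff₀ (by positivity)] at hm
  exact mem_range_of_exists_le_of_exists_ge hτ ⟨_, (by rw [h2]; linarith)⟩
    ⟨_, (by rw [h1]; linarith)⟩

theorem exists_polar (x : ℂ) : ∃ θ : ℝ, x = (‖x‖ : ℝ) * Complex.exp (θ * Complex.I) :=
  ⟨x.arg, (Complex.norm_mul_exp_arg_mul_I x).symm⟩

/-- Averaging a monotone degree-one lift with the identity. -/
theorem lift_average (hψ : Continuous ψ) (hm : Monotone ψ)
    (hper : ∀ θ, ψ (θ + 2 * Real.pi) = ψ θ + 2 * Real.pi) {σ : ℝ} (hσ0 : 0 < σ) (hσ1 : σ ≤ 1) :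
    Continuous (fun θ => θ + (1 - σ) * (ψ θ - θ)) ∧ StrictMono (fun θ => θ + (1 - σ) * (ψ θ - θ)) ∧
      ∀ θ, (θ + 2 * Real.pi) + (1 - σ) * (ψ (θ + 2 * Real.pi) - (θ + 2 * Real.pi)) =
        θ + (1 - σ) * (ψ θ - θ) + 2 * Real.pi := by
  refine ⟨by fun_prop, fun a b hab => ?_, fun θ => by rw [hper]; ring⟩
  have := hm hab.le
  have e : ∀ θ, θ + (1 - σ) * (ψ θ - θ) = (1 - σ) * ψ θ + σ * θ := fun θ => by ring
  simp only [e]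
  nlinarith

end Circle

section Twist

/-- Rotating every point `x` of the plane by the angle `a x`. -/
noncomputable def twist (a : ℂ → ℝ) (x : ℂ) : ℂ := x * Complex.exp (a x * Complex.I)

theorem norm_twist (a : ℂ → ℝ) (x : ℂ) : ‖twist a x‖ = ‖x‖ := by
  rw [twist, norm_mul, Complex.norm_exp_ofReal_mul_I, mul_one]

theorem twist_polar (a : ℂ → ℝ) (ρ θ : ℝ) : twist a (ρ * Complex.exp (θ * Complex.I)) =
    ρ * Complex.exp (((θ + a (ρ * Complex.exp (θ * Complex.I)) : ℝ) : ℂ) * Complex.I) := by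
  rw [twist]
  push_cast
  rw [add_mul, Complex.exp_add, mul_assoc]

theorem continuous_twist {a : ℂ → ℝ} (ha : ∀ x ≠ 0, ContinuousAt a x) : Continuous (twist a) := by
  rw [continuous_iff_continuousAt]
  intro x
  by_cases hx : x = 0
  · subst hx
    have h0 : twist a 0 = 0 := by simp [twist]
    rw [ContinuousAt, h0, tendsto_zero_iff_norm_tendsto_zero]
    simp only [norm_twist]
    simpa using (continuous_norm (E := ℂ)).tendsto 0
  · have := ha x hx
    unfold twist
    fun_prop

/-- If `θ ↦ θ + a (ρ e^{iθ})` is the function `τ ρ`, strictly monotone of degree one, then the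
twist by `a` is injective on norm `ρ`. -/
theorem twist_injOn {a : ℂ → ℝ} {ρ : ℝ} {τ : ℝ → ℝ} (hτ : StrictMono τ)
    (hper : ∀ θ, τ (θ + 2 * Real.pi) = τ θ + 2 * Real.pi) (hρ : 0 < ρ)
    (ha : ∀ θ : ℝ, θ + a (ρ * Complex.exp (θ * Complex.I)) = τ θ) {x y : ℂ} (hx : ‖x‖ = ρ)
    (hy : ‖y‖ = ρ) (h : twist a x = twist a y) : x = y := by
  obtain ⟨θ, hθ⟩ := exists_polar x
  obtain ⟨θ', hθ'⟩ := exists_polar y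
  rw [hx] at hθ
  rw [hy] at hθ'
  have hρ' : (ρ : ℂ) ≠ 0 := by exact_mod_cast hρ.ne'
  rw [hθ, hθ', twist_polar, twist_polar, ha, ha] at h
  rw [hθ, hθ', exp_eq_of_strictMono_lift hτ hper (mul_left_cancel₀ hρ' h)]

theorem twist_surjOn {a : ℂ → ℝ} {ρ : ℝ} {τ : ℝ → ℝ} (hτ : Continuous τ)
    (hper : ∀ θ, τ (θ + 2 * Real.pi) = τ θ + 2 * Real.pi) (hρ : 0 ≤ ρ)
    (ha : ∀ θ : ℝ, θ + a (ρ * Complex.exp (θ * Complex.I)) = τ θ) {y : ℂ} (hy : ‖y‖ = ρ) :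
    ∃ x, ‖x‖ = ρ ∧ twist a x = y := by
  obtain ⟨θ', hpolar⟩ := exists_polar y
  obtain ⟨θ, hθ⟩ := surjective_of_lift hτ hper θ'
  refine ⟨ρ * Complex.exp (θ * Complex.I), ?_, ?_⟩
  · rw [norm_mul, Complex.norm_exp_ofReal_mul_I, mul_one, Complex.norm_of_nonneg hρ]
  · rw [twist_polar, ha, hθ, ← hy, ← hpolar]

/-- A norm preserving continuous bijection of the plane is a homeomorphism. -/
theorem isHomeomorph_of_norm_eq {B : ℂ → ℂ} (hB : Continuous B) (hn : ∀ x, ‖B x‖ = ‖x‖)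
    (hbij : Function.Bijective B) : IsHomeomorph B := by
  rw [isHomeomorph_iff_continuous_isClosedMap_bijective]
  refine ⟨hB, ?_, hbij⟩
  have : IsProperMap B := by
    rw [isProperMap_iff_tendsto_cocompact]
    refine ⟨hB, ?_⟩
    rw [← Metric.cobounded_eq_cocompact, ← comap_norm_atTop, tendsto_comap_iff]
    have : norm ∘ B = norm := funext hn
    rw [this]
    exact tendsto_comap
  exact this.isClosedMap

end Twist

/-- A homeomorphism of the plane taking the square to the unit disk. -/
theorem exists_homeomorph_square_disk : ∃ Q : ℂ ≃ₜ ℂ,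
    (∀ x, (|(Q x).re| < 1 ∧ |(Q x).im| < 1) ↔ ‖x‖ < 1) ∧
      ∀ x, (|(Q x).re| ≤ 1 ∧ |(Q x).im| ≤ 1) ↔ ‖x‖ ≤ 1 := by
  set s : Set ℂ := Icc (-1 : ℝ) 1 ×ℂ Icc (-1 : ℝ) 1 with hs
  have hclosed : IsClosed s := isClosed_Icc.reProdIm isClosed_Icc
  have hinterior : interior s = Ioo (-1 : ℝ) 1 ×ℂ Ioo (-1 : ℝ) 1 := by
    rw [hs, Complex.interior_reProdIm, interior_Icc]
  have hconv : Convex ℝ s :=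
    ((convex_Icc (-1 : ℝ) 1).linear_preimage Complex.reLm).inter
      ((convex_Icc (-1 : ℝ) 1).linear_preimage Complex.imLm)
  have hbdd : Bornology.IsBounded s :=
    (Metric.isBounded_Icc (-1 : ℝ) 1).reProdIm (Metric.isBounded_Icc (-1 : ℝ) 1)
  obtain ⟨h, h1, h2, -⟩ := exists_homeomorph_image_interior_closure_frontier_eq_unitBall hconv
    ⟨0, by rw [hinterior]; simp [Complex.mem_reProdIm]⟩ hbdd
  rw [hclosed.closure_eq] at h2
  refine ⟨h.symm, fun x => ?_, fun x => ?_⟩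
  · have : h.symm x ∈ interior s ↔ x ∈ Metric.ball (0 : ℂ) 1 := by
      rw [← h1, ← Homeomorph.preimage_symm, mem_preimage]
    rw [hinterior, Complex.mem_reProdIm, mem_ball_zero_iff] at this
    rw [← this]
    simp only [abs_lt, mem_Ioo]
  · have : h.symm x ∈ s ↔ x ∈ Metric.closedBall (0 : ℂ) 1 := by
      rw [← h2, ← Homeomorph.preimage_symm, mem_preimage]
    rw [hs, Complex.mem_reProdIm, mem_closedBall_zero_iff] at this
    rw [← this]
    simp only [abs_le, mem_Icc]

/-- The square version of the approximation theorem transported to the unit disk. -/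
theorem exists_homeomorph_dist_lt_of_disk {G : ℂ → ℂ} (hG : Continuous G)
    (hout : ∀ x, 1 ≤ ‖x‖ → G x = x) (hdisk : ∀ x, ‖x‖ ≤ 1 → ‖G x‖ ≤ 1)
    (hfib : ∀ b, IsConnected (G ⁻¹' {b})) {ε : ℝ} (hε : 0 < ε) :
    ∃ Φ : ℂ ≃ₜ ℂ, (∀ x, ‖Φ x‖ ≤ 1 ↔ ‖x‖ ≤ 1) ∧ ∀ x, ‖x‖ ≤ 1 → ‖Φ x - G x‖ < ε := by
  obtain ⟨Q, hQ1, hQ2⟩ := exists_homeomorph_square_disk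
  have hcomp : IsCompact (Q '' Metric.closedBall 0 1) :=
    (isCompact_closedBall (0 : ℂ) 1).image Q.continuous
  have huc := hcomp.uniformContinuousOn_of_continuous Q.symm.continuous.continuousOn
  obtain ⟨δ, hδ, hδ'⟩ := Metric.uniformContinuousOn_iff.1 huc ε hε
  obtain ⟨Φ, hΦ1, hΦ2⟩ := exists_homeomorph_dist_lt_of_box (H := fun y => Q (G (Q.symm y)))
    (by fun_prop) (fun y hy => by
      have := (hQ1 (Q.symm y)).not.1 (by simpa using hy)
      rw [hout _ (not_lt.1 this), Q.apply_symm_apply])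
    (fun y h1 h2 => (hQ2 _).2 (hdisk _ ((hQ2 _).1 (by simpa using ⟨h1, h2⟩))))
    (fun b => by
      have : (fun y => Q (G (Q.symm y))) ⁻¹' {b} = Q '' (G ⁻¹' {Q.symm b}) := by
        ext y
        rw [← Homeomorph.preimage_symm]
        simp only [mem_preimage, mem_singleton_iff]
        exact Q.toEquiv.eq_symm_apply.symm
      rw [this]
      exact (hfib _).image _ Q.continuous.continuousOn) hδ
  have hiff : ∀ y, ‖Q.symm (Φ y)‖ ≤ 1 ↔ ‖Q.symm y‖ ≤ 1 := by
    intro y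
    by_cases hy : |y.re| < 1 ∧ |y.im| < 1
    · have h1 : ‖Q.symm y‖ < 1 := (hQ1 _).1 (by simpa using hy)
      have h2 : |(Φ y).re| < 1 ∧ |(Φ y).im| < 1 := by
        by_contra hcon
        have := Φ.injective (hΦ1 _ hcon)
        rw [this] at hcon
        exact hcon hy
      have h3 : ‖Q.symm (Φ y)‖ < 1 := (hQ1 _).1 (by simpa using h2)
      simp [h1.le, h3.le]
    · rw [hΦ1 y hy]
  refine ⟨(Q.trans Φ).trans Q.symm, fun x => ?_, fun x hx => ?_⟩
  · simpa using hiff (Q x)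
  · have h1 := hδ' (Φ (Q x)) ⟨Q.symm (Φ (Q x)), by
        rw [mem_closedBall_zero_iff, hiff]; simpa using hx, by simp⟩
      (Q (G x)) ⟨G x, by rw [mem_closedBall_zero_iff]; exact hdisk x hx, rfl⟩
      (by simpa using hΦ2 (Q x))
    simpa [dist_eq_norm] using h1

namespace DiskMonotone

variable {g : ℂ → ℂ} {ψ : ℝ → ℝ} {κ : ℝ}

/-- The radial parameter, rising from `0` to `κ` as the norm rises from `1 - κ` to `1`. -/
noncomputable def collarParam (κ : ℝ) (x : ℂ) : ℝ := min κ (max 0 (‖x‖ - (1 - κ)))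

/-- The collared version of a disk map. -/
noncomputable def collarMap (g : ℂ → ℂ) (ψ : ℝ → ℝ) (κ : ℝ) (x : ℂ) : ℂ :=
  (max ‖x‖ (1 - κ) : ℝ) * g (x / ((1 - κ : ℝ) : ℂ)) *
    Complex.exp (((-(collarParam κ x * angularShift ψ x) : ℝ) : ℂ) * Complex.I)

theorem collarParam_eq_zero {x : ℂ} (hκ : 0 < κ) (hx : ‖x‖ ≤ 1 - κ) : collarParam κ x = 0 := by
  rw [collarParam, max_eq_left (by linarith), min_eq_right hκ.le]

theorem collarParam_nonneg {x : ℂ} (hκ : 0 < κ) : 0 ≤ collarParam κ x :=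
  le_min hκ.le (le_max_left _ _)

theorem collarParam_le (x : ℂ) : collarParam κ x ≤ κ := min_le_left _ _

theorem collarParam_pos {x : ℂ} (hκ : 0 < κ) (hx : 1 - κ < ‖x‖) : 0 < collarParam κ x :=
  lt_min hκ (lt_max_of_lt_right (by linarith))

theorem collarParam_of_one_le {x : ℂ} (hκ : 0 < κ) (hx : 1 ≤ ‖x‖) : collarParam κ x = κ := by
  rw [collarParam, max_eq_right (by linarith), min_eq_left (by linarith)]

theorem continuous_collarMap (hg : DiskMonotone g) (hψ : MonotoneLift g ψ) (hκ : 0 < κ)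
    (hκ' : κ < 1) : Continuous (collarMap g ψ κ) := by
  have hs : Continuous (collarParam κ) := by unfold collarParam; fun_prop
  have h1 : Continuous fun x => collarParam κ x * angularShift ψ x := by
    rw [continuous_iff_continuousAt]
    intro x
    by_cases hx : x = 0
    · subst hx
      have : (fun x => collarParam κ x * angularShift ψ x) =ᶠ[𝓝 (0 : ℂ)] fun _ => 0 := by
        filter_upwards [Metric.ball_mem_nhds (0 : ℂ) (by linarith : 0 < 1 - κ)] with y hy
        rw [mem_ball_zero_iff] at hy
        rw [collarParam_eq_zero hκ hy.le, zero_mul]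
      exact continuousAt_const.congr this.symm
    · exact hs.continuousAt.mul (continuousAt_angularShift hψ.1 hψ.2.2.1 hx)
  have h2 := hg.continuous
  unfold collarMap
  have h3 : Continuous fun x : ℂ => g (x / ((1 - κ : ℝ) : ℂ)) := h2.comp (continuous_id.div_const _)
  fun_prop

theorem collarMap_eq_twist (hg : DiskMonotone g) (hψ : MonotoneLift g ψ)
    (hκ' : κ < 1) {x : ℂ} (hx : 1 - κ ≤ ‖x‖) :
    collarMap g ψ κ x = twist (fun y => (1 - collarParam κ y) * angularShift ψ y) x := by
  have hpos : 0 < 1 - κ := by linarith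
  have hx0 : 0 < ‖x‖ := hpos.trans_le hx
  obtain ⟨θ, hθ⟩ := exists_polar x
  have h1 : angularShift ψ x = ψ θ - θ := by
    rw [hθ]
    exact angularShift_polar hψ.2.2.1 (by simpa using hx0) θ
  have h2 : g (x / ((1 - κ : ℝ) : ℂ)) = Complex.exp (ψ θ * Complex.I) := by
    rw [← hψ.2.2.2, ← hg.retract]
    congr 1
    have : x / ((1 - κ : ℝ) : ℂ) = ((‖x‖ / (1 - κ) : ℝ) : ℂ) * Complex.exp (θ * Complex.I) := by
      nth_rw 1 [hθ]
      push_cast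
      ring
    rw [this, diskRetract_mul (Complex.norm_exp_ofReal_mul_I θ) (by rwa [one_le_div hpos])]
  rw [collarMap, twist, h2, h1, max_eq_left hx]
  have h3 : ∀ z : ℂ, x * z = ‖x‖ * (Complex.exp (θ * Complex.I) * z) := fun z => by
    nth_rw 1 [hθ]
    ring
  rw [h3, mul_assoc, ← Complex.exp_add, ← Complex.exp_add]
  congr 2
  push_cast
  ring

theorem norm_collarMap_of_le (hg : DiskMonotone g) (hψ : MonotoneLift g ψ)
    (hκ' : κ < 1) {x : ℂ} (hx : 1 - κ ≤ ‖x‖) : ‖collarMap g ψ κ x‖ = ‖x‖ := by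
  rw [collarMap_eq_twist hg hψ hκ' hx, norm_twist]

theorem norm_collarMap_le (hg : DiskMonotone g) (x : ℂ) :
    ‖collarMap g ψ κ x‖ ≤ max ‖x‖ (1 - κ) := by
  have h0 : 0 ≤ max ‖x‖ (1 - κ) := le_max_of_le_left (norm_nonneg _)
  rw [collarMap, norm_mul, norm_mul, Complex.norm_exp_ofReal_mul_I, mul_one,
    Complex.norm_of_nonneg h0]
  exact mul_le_of_le_one_right h0 (hg.norm_le _)

theorem isConnected_collarMap_fiber (hg : DiskMonotone g) (hψ : MonotoneLift g ψ) (hκ : 0 < κ)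
    (hκ' : κ < 1) (w : ℂ) : IsConnected (collarMap g ψ κ ⁻¹' {w}) := by
  have hpos : 0 < 1 - κ := by linarith
  by_cases hw : ‖w‖ ≤ 1 - κ
  · have hne : ((1 - κ : ℝ) : ℂ) ≠ 0 := by exact_mod_cast hpos.ne'
    have : collarMap g ψ κ ⁻¹' {w} = (fun y => ((1 - κ : ℝ) : ℂ) * y) ''
        (Metric.closedBall 0 1 ∩ g ⁻¹' {w / ((1 - κ : ℝ) : ℂ)}) := by
      have key : ∀ x, ‖x‖ ≤ 1 - κ →
          collarMap g ψ κ x = ((1 - κ : ℝ) : ℂ) * g (x / ((1 - κ : ℝ) : ℂ)) := by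
        intro x hx
        rw [collarMap, collarParam_eq_zero hκ hx, max_eq_right hx]
        simp
      ext x
      simp only [mem_preimage, mem_singleton_iff, mem_image, mem_inter_iff,
        mem_closedBall_zero_iff]
      constructor
      · intro h
        have hx : ‖x‖ ≤ 1 - κ := by
          by_contra hcon
          push Not at hcon
          have := norm_collarMap_of_le hg hψ hκ' hcon.le
          rw [h] at this
          linarith
        refine ⟨x / ((1 - κ : ℝ) : ℂ), ⟨?_, ?_⟩, by field_simp⟩
        · rw [norm_div, Complex.norm_of_nonneg hpos.le, div_le_one hpos]
          exact hx
        · rw [eq_div_iff hne, mul_comm, ← key x hx, h]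
      · rintro ⟨y, ⟨h1, h2⟩, rfl⟩
        have : ‖((1 - κ : ℝ) : ℂ) * y‖ ≤ 1 - κ := by
          rw [norm_mul, Complex.norm_of_nonneg hpos.le]
          exact mul_le_of_le_one_right hpos.le h1
        rw [key _ this, mul_div_cancel_left₀ _ hne, h2, mul_div_cancel₀ _ hne]
    rw [this]
    refine (hg.fiber _ ?_).image _ (by fun_prop)
    rw [norm_div, Complex.norm_of_nonneg hpos.le, div_le_one hpos]
    exact hw
  · push Not at hw
    have hfix : ∀ θ : ℝ, θ + (1 - collarParam κ (‖w‖ * Complex.exp (θ * Complex.I))) *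
        angularShift ψ (‖w‖ * Complex.exp (θ * Complex.I)) =
        θ + (1 - collarParam κ w) * (ψ θ - θ) := by
      intro θ
      rw [angularShift_polar hψ.2.2.1 (by linarith)]
      have : collarParam κ (‖w‖ * Complex.exp (θ * Complex.I)) = collarParam κ w := by
        unfold collarParam
        rw [norm_mul, Complex.norm_exp_ofReal_mul_I, mul_one,
          Complex.norm_of_nonneg (norm_nonneg _)]
      rw [this]
    obtain ⟨hc, hm, hp⟩ := lift_average hψ.1 hψ.2.1 hψ.2.2.1 (collarParam_pos hκ hw)
      ((collarParam_le w).trans hκ'.le)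
    obtain ⟨x, hx, hxw⟩ := twist_surjOn
      (a := fun y => (1 - collarParam κ y) * angularShift ψ y) hc hp (norm_nonneg w) hfix rfl
    have : collarMap g ψ κ ⁻¹' {w} = {x} := by
      ext y
      simp only [mem_preimage, mem_singleton_iff]
      constructor
      · intro hy
        have hy1 : 1 - κ < ‖y‖ := by
          by_contra hcon
          push Not at hcon
          have := norm_collarMap_le (ψ := ψ) (κ := κ) hg y
          rw [hy, max_eq_right hcon] at this
          linarith
        have hy2 := norm_collarMap_of_le hg hψ hκ' hy1.le
        rw [hy] at hy2
        refine twist_injOn (a := fun y => (1 - collarParam κ y) * angularShift ψ y) hm hp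
          (by linarith) hfix hy2.symm hx ?_
        rw [hxw, ← collarMap_eq_twist hg hψ hκ' hy1.le, hy]
      · rintro rfl
        rw [collarMap_eq_twist hg hψ hκ' (by rw [hx]; exact hw.le), hxw]
    rw [this]
    exact isConnected_singleton

theorem exists_boundary_homeomorph (hψ : MonotoneLift g ψ) (hκ : 0 < κ) (hκ' : κ < 1) :
    ∃ B : ℂ ≃ₜ ℂ, ∀ x, B x = twist (fun y => (1 - κ) * angularShift ψ y) x := by
  obtain ⟨hc, hm, hp⟩ := lift_average hψ.1 hψ.2.1 hψ.2.2.1 hκ hκ'.le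
  have hfix : ∀ ρ : ℝ, 0 < ρ → ∀ θ : ℝ, θ + (1 - κ) *
        angularShift ψ (ρ * Complex.exp (θ * Complex.I)) = θ + (1 - κ) * (ψ θ - θ) := by
    intro ρ hρ θ
    rw [angularShift_polar hψ.2.2.1 hρ]
  have h0 : twist (fun y => (1 - κ) * angularShift ψ y) 0 = 0 := by simp [twist]
  have hB : IsHomeomorph (twist fun y => (1 - κ) * angularShift ψ y) := by
    refine isHomeomorph_of_norm_eq (continuous_twist fun x hx => continuousAt_const.mul
      (continuousAt_angularShift hψ.1 hψ.2.2.1 hx)) (norm_twist _) ⟨fun x y hxy => ?_, fun y => ?_⟩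
    · have hn : ‖x‖ = ‖y‖ := by rw [← norm_twist, hxy, norm_twist]
      by_cases hy : y = 0
      · rw [hy, norm_zero, norm_eq_zero] at hn
        rw [hn, hy]
      · have hy' := norm_pos_iff.2 hy
        exact twist_injOn hm hp hy' (hfix _ hy') hn rfl hxy
    · by_cases hy : y = 0
      · exact ⟨0, by rw [h0, hy]⟩
      · have hy' := norm_pos_iff.2 hy
        obtain ⟨x, -, hx⟩ := twist_surjOn (a := fun y => (1 - κ) * angularShift ψ y) hc hp hy'.le
          (hfix _ hy') rfl
        exact ⟨x, hx⟩
  exact ⟨hB.homeomorph, fun x => rfl⟩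

theorem exists_norm_collarMap_sub_lt (hg : DiskMonotone g) (hψ : MonotoneLift g ψ) {ε : ℝ}
    (hε : 0 < ε) : ∃ κ, 0 < κ ∧ κ < 1 ∧ ∀ x, ‖x‖ ≤ 1 → ‖collarMap g ψ κ x - g x‖ < ε := by
  obtain ⟨M, hM⟩ := (isCompact_Icc (a := -Real.pi) (b := Real.pi)).exists_bound_of_continuousOn
    (f := fun θ => ψ θ - θ) (hψ.1.sub continuous_id).continuousOn
  have hM' : ∀ x, |angularShift ψ x| ≤ M := fun x =>
    hM _ ⟨(Complex.neg_pi_lt_arg x).le, Complex.arg_le_pi x⟩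
  have hM0 : 0 ≤ M := (abs_nonneg _).trans (hM' 0)
  obtain ⟨δ, hδ, hδ'⟩ := Metric.uniformContinuousOn_iff.1
    ((isCompact_closedBall (0 : ℂ) 2).uniformContinuousOn_of_continuous hg.continuous.continuousOn)
    (ε / 2) (by linarith)
  obtain ⟨κ, hκ0, hκ⟩ := exists_between (show 0 < min (1 / 2) (min (δ / 2) (ε / (2 * (1 + M)))) by
    positivity)
  rw [lt_min_iff, lt_min_iff] at hκ
  obtain ⟨hκ1, hκ2, hκ3⟩ := hκ
  rw [lt_div_iff₀ (by positivity)] at hκ3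
  refine ⟨κ, hκ0, by linarith, fun x hx => ?_⟩
  have hpos : 0 < 1 - κ := by linarith
  have hne : ((1 - κ : ℝ) : ℂ) ≠ 0 := by exact_mod_cast hpos.ne'
  set x' := x / ((1 - κ : ℝ) : ℂ) with hx'
  have hd : ‖x' - x‖ ≤ 2 * κ := by
    have : x' - x = ((κ / (1 - κ) : ℝ) : ℂ) * x := by
      rw [hx']
      push_cast at hne ⊢
      field_simp
      ring
    rw [this, norm_mul, Complex.norm_of_nonneg (by positivity)]
    have h2 : κ / (1 - κ) ≤ 2 * κ := by
      rw [div_le_iff₀ hpos]; nlinarith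
    nlinarith [norm_nonneg x]
  have hosc : ‖g x' - g x‖ < ε / 2 := by
    rw [← dist_eq_norm]
    refine hδ' _ ?_ _ ?_ ?_
    · rw [mem_closedBall_zero_iff]
      have := norm_add_le (x' - x) x
      rw [sub_add_cancel] at this
      linarith
    · rw [mem_closedBall_zero_iff]; linarith
    · rw [dist_eq_norm]; linarith
  set m := max ‖x‖ (1 - κ) with hm
  have hm1 : m ≤ 1 := max_le hx (by linarith)
  have hm2 : 1 - κ ≤ m := le_max_right _ _
  set t := -(collarParam κ x * angularShift ψ x) with ht
  set e := Complex.exp (t * Complex.I) with he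
  have he1 : ‖e‖ = 1 := Complex.norm_exp_ofReal_mul_I t
  have he2 : ‖e - 1‖ ≤ κ * M := by
    have := Real.norm_exp_I_mul_ofReal_sub_one_le (x := t)
    rw [mul_comm Complex.I] at this
    refine this.trans ?_
    rw [Real.norm_eq_abs, ht, abs_neg, abs_mul, abs_of_nonneg (collarParam_nonneg hκ0)]
    exact mul_le_mul (collarParam_le x) (hM' x) (abs_nonneg _) hκ0.le
  have hsplit : collarMap g ψ κ x - g x =
      ((m - 1 : ℝ) : ℂ) * (g x' * e) + g x' * (e - 1) + (g x' - g x) := by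
    rw [collarMap, ← hm, ← hx', ← ht, ← he]
    push_cast
    ring
  have hgx := hg.norm_le x'
  have b1 : ‖((m - 1 : ℝ) : ℂ) * (g x' * e)‖ ≤ κ := by
    rw [norm_mul, norm_mul, he1, mul_one, Complex.norm_real, Real.norm_eq_abs,
      abs_of_nonpos (by linarith)]
    nlinarith [norm_nonneg (g x')]
  have b2 : ‖g x' * (e - 1)‖ ≤ κ * M := by
    rw [norm_mul]
    nlinarith [norm_nonneg (g x'), norm_nonneg (e - 1)]
  rw [hsplit]
  calc _ ≤ ‖((m - 1 : ℝ) : ℂ) * (g x' * e)‖ + ‖g x' * (e - 1)‖ + ‖g x' - g x‖ := norm_add₃_le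
    _ < ε := by linarith

theorem exists_homeomorph_of_lift (hg : DiskMonotone g) (hψ : MonotoneLift g ψ) {ε : ℝ}
    (hε : 0 < ε) : ∃ F : ℂ ≃ₜ ℂ, (∀ x, ‖F x‖ ≤ 1 ↔ ‖x‖ ≤ 1) ∧
      ∀ x, ‖x‖ ≤ 1 → ‖F x - g x‖ < ε := by
  obtain ⟨κ, hκ, hκ', happ⟩ := exists_norm_collarMap_sub_lt hg hψ (half_pos hε)
  obtain ⟨B, hB⟩ := exists_boundary_homeomorph hψ hκ hκ'
  have hBn : ∀ x, ‖B x‖ = ‖x‖ := fun x => by rw [hB, norm_twist]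
  have hBs : ∀ y, ‖B.symm y‖ = ‖y‖ := fun y => by rw [← hBn, B.apply_symm_apply]
  have hT := continuous_collarMap hg hψ hκ hκ'
  obtain ⟨Φ, hΦ1, hΦ2⟩ := exists_homeomorph_dist_lt_of_disk
    (G := fun y => collarMap g ψ κ (B.symm y)) (by fun_prop)
    (fun y hy => by
      have hy' : 1 ≤ ‖B.symm y‖ := by rwa [hBs]
      have : collarMap g ψ κ (B.symm y) = B (B.symm y) := by
        rw [collarMap_eq_twist hg hψ hκ' (by linarith), hB, twist, twist,
          collarParam_of_one_le hκ hy']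
      rw [this, B.apply_symm_apply])
    (fun y hy => (norm_collarMap_le hg _).trans (max_le (by rwa [hBs]) (by linarith)))
    (fun b => by
      have : (fun y => collarMap g ψ κ (B.symm y)) ⁻¹' {b} = B '' (collarMap g ψ κ ⁻¹' {b}) := by
        rw [← Homeomorph.preimage_symm]
        rfl
      rw [this]
      exact (isConnected_collarMap_fiber hg hψ hκ hκ' b).image _ B.continuous.continuousOn)
    (half_pos hε)
  refine ⟨B.trans Φ, fun x => by rw [Homeomorph.trans_apply, hΦ1, hBn], fun x hx => ?_⟩
  have h1 := hΦ2 (B x) (by rwa [hBn])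
  have h2 := happ x hx
  rw [B.symm_apply_apply] at h1
  rw [Homeomorph.trans_apply]
  calc _ ≤ ‖Φ (B x) - collarMap g ψ κ x‖ + ‖collarMap g ψ κ x - g x‖ :=
        norm_sub_le_norm_sub_add_norm_sub _ _ _
    _ < ε := by linarith

theorem exists_homeomorph (hg : DiskMonotone g) {ε : ℝ}
    (hε : 0 < ε) : ∃ F : ℂ ≃ₜ ℂ, (∀ x, ‖F x‖ ≤ 1 ↔ ‖x‖ ≤ 1) ∧
      ∀ x, ‖x‖ ≤ 1 → ‖F x - g x‖ < ε := by
  rcases hg.exists_monotoneLift with ⟨ψ, hψ⟩ | ⟨ψ, hψ⟩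
  · exact hg.exists_homeomorph_of_lift hψ hε
  · obtain ⟨F, hF1, hF2⟩ := hg.star.exists_homeomorph_of_lift hψ hε
    refine ⟨F.trans Complex.conjCLE.toHomeomorph, fun x => ?_, fun x hx => ?_⟩
    · rw [Homeomorph.trans_apply, ← hF1 x]
      simp
    · have := hF2 x hx
      rw [Homeomorph.trans_apply, ← Complex.norm_conj]
      simpa using this

end DiskMonotone

/-- Fibers of a uniform limit of homeomorphisms of a compact convex set are connected. -/
theorem isPreconnected_fiber_of_tendstoUniformly {E : Type*} [NormedAddCommGroup E]
    [NormedSpace ℝ E] {K : Set E} (hK : IsCompact K) (hconv : Convex ℝ K) {h : K → K}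
    (hcont : Continuous h) {H : ℕ → (K ≃ₜ K)}
    (hH : TendstoUniformly (fun j x => H j x) h atTop) (b : K) : IsPreconnected (h ⁻¹' {b}) := by
  have : CompactSpace K := isCompact_iff_compactSpace.1 hK
  have hcl : IsClosed (h ⁻¹' {b}) := isClosed_singleton.preimage hcont
  rw [isPreconnected_closed_iff]
  intro A B hA hB hsub ⟨x, hxF, hxA⟩ ⟨y, hyF, hyB⟩
  by_contra hemp
  have hdisj : Disjoint (h ⁻¹' {b} ∩ A) (h ⁻¹' {b} ∩ B) := by
    rw [Set.disjoint_left]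
    exact fun z hz hz' => hemp ⟨z, hz.1, hz.2, hz'.2⟩
  obtain ⟨U, V, hU, hV, hAU, hBV, hUV⟩ :=
    normal_separation (hcl.inter hA) (hcl.inter hB) hdisj
  have hcomp : IsCompact (U ∪ V)ᶜ := (hU.union hV).isClosed_compl.isCompact
  have hpos : ∃ δ > 0, ∀ z ∉ U ∪ V, δ ≤ dist (h z) b := by
    rcases (U ∪ V)ᶜ.eq_empty_or_nonempty with he | hne
    · exact ⟨1, one_pos, fun z hz => absurd (show z ∈ (U ∪ V)ᶜ from hz) (by rw [he]; simp)⟩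
    · obtain ⟨z₀, hz₀, hmin⟩ := hcomp.exists_isMinOn hne
        (f := fun z => dist (h z) b) (by fun_prop)
      refine ⟨_, dist_pos.2 fun hcon => hz₀ ?_, fun z hz => hmin hz⟩
      rcases hsub (show z₀ ∈ h ⁻¹' {b} from hcon) with hh | hh
      · exact Or.inl (hAU ⟨hcon, hh⟩)
      · exact Or.inr (hBV ⟨hcon, hh⟩)
  obtain ⟨δ, hδ, hδ'⟩ := hpos
  obtain ⟨j, hj⟩ := (Metric.tendstoUniformly_iff.1 hH (δ / 2) (half_pos hδ)).exists
  have hball : IsPreconnected (H j ⁻¹' Metric.ball b (δ / 2)) := by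
    have h1 : IsPreconnected (Metric.ball b (δ / 2)) := by
      have : Subtype.val '' (Metric.ball b (δ / 2)) = K ∩ Metric.ball (b : E) (δ / 2) := by
        ext z
        simp only [mem_image, Metric.mem_ball, Subtype.exists, mem_inter_iff]
        constructor
        · rintro ⟨z, hz, h2, rfl⟩
          exact ⟨hz, h2⟩
        · rintro ⟨hz, h2⟩
          exact ⟨z, hz, h2, rfl⟩
      rw [← Topology.IsInducing.subtypeVal.isPreconnected_image, this]
      exact (hconv.inter (convex_ball _ _)).isPreconnected
    rw [← Homeomorph.image_symm]
    exact h1.image _ (H j).symm.continuous.continuousOn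
  have hsub' : H j ⁻¹' Metric.ball b (δ / 2) ⊆ U ∪ V := by
    intro z hz
    by_contra hcon
    have h1 := hδ' z hcon
    have h2 := hj z
    have h3 : dist (H j z) b < δ / 2 := hz
    have := dist_triangle (h z) (H j z) b
    linarith
  have hmem : ∀ z, h z = b → z ∈ H j ⁻¹' Metric.ball b (δ / 2) := by
    intro z hz
    have := hj z
    rw [hz, dist_comm] at this
    exact this
  obtain ⟨z, -, hzU, hzV⟩ := hball U V hU hV hsub' ⟨x, hmem x hxF, hAU ⟨hxF, hxA⟩⟩
    ⟨y, hmem y hyF, hBV ⟨hyF, hyB⟩⟩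
  exact Set.disjoint_left.1 hUV hzU hzV

theorem surjective_of_tendstoUniformly {K : Type*} [MetricSpace K] [CompactSpace K] {h : K → K}
    (hcont : Continuous h) {H : ℕ → (K ≃ₜ K)}
    (hH : TendstoUniformly (fun j x => H j x) h atTop) : Function.Surjective h := by
  intro b
  have hcl : IsClosed (range h) := (isCompact_range hcont).isClosed
  change b ∈ range h
  rw [← hcl.closure_eq, Metric.mem_closure_iff]
  intro ε hε
  obtain ⟨j, hj⟩ := (Metric.tendstoUniformly_iff.1 hH ε hε).exists
  refine ⟨_, mem_range_self ((H j).symm b), ?_⟩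
  have := hj ((H j).symm b)
  rwa [Homeomorph.apply_symm_apply, dist_comm] at this

/-- The restriction of a homeomorphism to an invariant set. -/
def Homeomorph.restrictSet {X : Type*} [TopologicalSpace X] (F : X ≃ₜ X) (K : Set X)
    (hF : ∀ x, F x ∈ K ↔ x ∈ K) : K ≃ₜ K :=
  F.subtype fun x => (hF x).symm

theorem exists_homeomorph_closedBall_of_monotone
    {h : Metric.closedBall (0 : EuclideanSpace ℝ (Fin 2)) 1 →
      Metric.closedBall (0 : EuclideanSpace ℝ (Fin 2)) 1} (hcont : Continuous h)
    (hfib : ∀ b, IsConnected (h ⁻¹' {b})) {ε : ℝ} (hε : 0 < ε) :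
    ∃ F : Metric.closedBall (0 : EuclideanSpace ℝ (Fin 2)) 1 ≃ₜ
      Metric.closedBall (0 : EuclideanSpace ℝ (Fin 2)) 1, ∀ x, dist (h x) (F x) < ε := by
  set e : ℂ ≃ₗᵢ[ℝ] EuclideanSpace ℝ (Fin 2) := Complex.orthonormalBasisOneI.repr with he
  have hn : ∀ x, ‖e.symm x‖ = ‖x‖ := e.symm.norm_map
  have hr : ∀ x, e (diskRetract x) ∈ Metric.closedBall (0 : EuclideanSpace ℝ (Fin 2)) 1 :=
    fun x => by
      rw [mem_closedBall_zero_iff, e.norm_map]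
      exact norm_diskRetract_le x
  set g : ℂ → ℂ := fun x => e.symm (h ⟨e (diskRetract x), hr x⟩) with hgdef
  have hgeq : ∀ (x : ℂ) (hx : ‖x‖ ≤ 1),
      g x = e.symm (h ⟨e x, by rwa [mem_closedBall_zero_iff, e.norm_map]⟩) := by
    intro x hx
    simp only [hgdef, diskRetract_of_norm_le hx]
  have hg : DiskMonotone g := by
    refine ⟨?_, fun x => ?_, fun x => ?_, fun b hb => ?_⟩
    · refine e.symm.continuous.comp (continuous_subtype_val.comp (hcont.comp ?_))
      exact (e.continuous.comp continuous_diskRetract).subtype_mk _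
    · rw [hn]
      exact mem_closedBall_zero_iff.1 (h _).2
    · simp only [hgdef, diskRetract_of_norm_le (norm_diskRetract_le x)]
    · have hb' : e b ∈ Metric.closedBall (0 : EuclideanSpace ℝ (Fin 2)) 1 := by
        rwa [mem_closedBall_zero_iff, e.norm_map]
      have : Metric.closedBall 0 1 ∩ g ⁻¹' {b} =
          (fun x : Metric.closedBall (0 : EuclideanSpace ℝ (Fin 2)) 1 => e.symm (x : _)) ''
            (h ⁻¹' {⟨e b, hb'⟩}) := by
        ext x
        simp only [mem_inter_iff, mem_closedBall_zero_iff, mem_preimage, mem_singleton_iff,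
          mem_image]
        constructor
        · rintro ⟨hx, hxb⟩
          refine ⟨⟨e x, by rwa [mem_closedBall_zero_iff, e.norm_map]⟩, ?_, by simp⟩
          rw [hgeq x hx] at hxb
          apply Subtype.ext
          exact e.symm.injective (hxb.trans (e.symm_apply_apply b).symm)
        · rintro ⟨y, hy, rfl⟩
          have hy1 : ‖e.symm (y : EuclideanSpace ℝ (Fin 2))‖ ≤ 1 := by
            rw [hn]
            exact mem_closedBall_zero_iff.1 y.2
          refine ⟨hy1, ?_⟩
          rw [hgeq _ hy1]
          simp only [LinearIsometryEquiv.apply_symm_apply, Subtype.coe_eta, hy]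
          simp
      rw [this]
      exact (hfib _).image _ (e.symm.continuous.comp continuous_subtype_val).continuousOn
  obtain ⟨F, hF1, hF2⟩ := hg.exists_homeomorph hε
  refine ⟨((e.symm.toHomeomorph.trans F).trans e.toHomeomorph).restrictSet _ fun x => ?_,
    fun x => ?_⟩
  · rw [mem_closedBall_zero_iff, mem_closedBall_zero_iff, ← hn x, ← hF1]
    simp
  · have hx : ‖e.symm (x : EuclideanSpace ℝ (Fin 2))‖ ≤ 1 := by
      rw [hn]
      exact mem_closedBall_zero_iff.1 x.2
    have := hF2 _ hx
    rw [hgeq _ hx] at this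
    simp only [LinearIsometryEquiv.apply_symm_apply, Subtype.coe_eta] at this
    rw [← e.norm_map, map_sub, e.apply_symm_apply, ← dist_eq_norm, dist_comm] at this
    exact this

/-- Youngs' approximation theorem on the closed unit disk: a continuous self-map of
`D̄` is monotone (surjective with connected fibers) iff it is a uniform limit of
self-homeomorphisms of `D̄`. -/
theorem monotone_iff_uniform_limit_of_homeomorphs_disk
    (h : (Metric.closedBall (0 : EuclideanSpace ℝ (Fin 2)) 1) →
         (Metric.closedBall (0 : EuclideanSpace ℝ (Fin 2)) 1))
    (hcont : Continuous h) :
    (Function.Surjective h ∧ ∀ b, IsConnected (h ⁻¹' {b})) ↔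
    ∃ H : ℕ → ((Metric.closedBall (0 : EuclideanSpace ℝ (Fin 2)) 1) ≃ₜ
               (Metric.closedBall (0 : EuclideanSpace ℝ (Fin 2)) 1)),
      TendstoUniformly (fun j x => (H j) x) h atTop := by
  constructor
  · rintro ⟨-, hfib⟩
    choose H hH using fun j : ℕ =>
      exists_homeomorph_closedBall_of_monotone hcont hfib (Nat.one_div_pos_of_nat (α := ℝ) (n := j))
    refine ⟨H, Metric.tendstoUniformly_iff.2 fun ε hε => ?_⟩
    filter_upwards [(tendsto_one_div_add_atTop_nhds_zero_nat (𝕜 := ℝ)).eventually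
      (gt_mem_nhds hε)] with j hj x
    exact (hH j x).trans hj
  · rintro ⟨H, hH⟩
    have : CompactSpace (Metric.closedBall (0 : EuclideanSpace ℝ (Fin 2)) 1) :=
      isCompact_iff_compactSpace.1 (isCompact_closedBall _ _)
    have hs := surjective_of_tendstoUniformly hcont hH
    refine ⟨hs, fun b => ⟨?_, isPreconnected_fiber_of_tendstoUniformly (isCompact_closedBall _ _)
      (convex_closedBall _ _) hcont hH b⟩⟩
    obtain ⟨x, hx⟩ := hs b
    exact ⟨x, hx⟩
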